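/- Let F be a convex cone subequation on ℝⁿ that is invariant under O(n) (i.e., gᵀAg ∈ F for all g ∈ O(n) and A ∈ F) and has Riesz characteristic p with 1 < p < 2. Let Ω ⊂ ℝⁿ be a bounded domain with smooth strictly F-convex boundary and let x₀ ∈ Ω. Then for every Θ ≥ 0 and every φ ∈ C(∂Ω) there exists a unique H ∈ C(Ω̄) that is F-harmonic on Ω ∖ {x₀}, satisfies H = φ on ∂Ω, and satisfies lim_{x→x₀} (H(x) − H(x₀))/|x − x₀|^{2−p} = Θ. -/

import Mathlib

open scoped Topology Classical
open Filter

noncomputable section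

/-- Euclidean space ℝⁿ. -/
abbrev EucSp (n : ℕ) := EuclideanSpace ℝ (Fin n)

/-- The space Sym²(ℝⁿ) of symmetric real n×n matrices, with its subspace topology. -/
abbrev SymMat (n : ℕ) := selfAdjoint (Matrix (Fin n) (Fin n) ℝ)

variable {n : ℕ}

/-- The matrix of the orthogonal projection onto the line ℝ·e (for a unit vector e). -/
def projMat (e : EucSp n) : Matrix (Fin n) (Fin n) ℝ := Matrix.of fun i j => e i * e j

lemma projMat_selfAdjoint (e : EucSp n) :
    projMat e ∈ selfAdjoint (Matrix (Fin n) (Fin n) ℝ) := by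
  rw [selfAdjoint.mem_iff]
  ext i j
  simp [projMat, Matrix.star_apply, mul_comm]

/-- P_e, the projection onto ℝ·e, as an element of Sym²(ℝⁿ). -/
def symProj (e : EucSp n) : SymMat n := ⟨projMat e, projMat_selfAdjoint e⟩

/-- The matrix P_{e⊥} − (p−1)·P_e. -/
def charMatM (p : ℝ) (e : EucSp n) : Matrix (Fin n) (Fin n) ℝ :=
  (1 - projMat e) - (p - 1) • projMat e

lemma charMatM_selfAdjoint (p : ℝ) (e : EucSp n) :
    charMatM p e ∈ selfAdjoint (Matrix (Fin n) (Fin n) ℝ) := by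
  have h := projMat_selfAdjoint e
  rw [selfAdjoint.mem_iff] at h ⊢
  simp [charMatM, star_sub, star_smul, star_one, h]

/-- P_{e⊥} − (p−1)·P_e as an element of Sym²(ℝⁿ). -/
def charMat (p : ℝ) (e : EucSp n) : SymMat n := ⟨charMatM p e, charMatM_selfAdjoint p e⟩

/-- A (constant coefficient, pure second order) cone subequation on ℝⁿ: a nonempty,
closed, proper subset of Sym²(ℝⁿ) satisfying positivity (F1) and the cone property (F2). -/
structure ConeSubequation (n : ℕ) where
  carrier : Set (SymMat n)
  nonempty' : carrier.Nonempty
  proper' : carrier ≠ Set.univ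
  isClosed' : IsClosed carrier
  f1 : ∀ A ∈ carrier, ∀ P : SymMat n, (P : Matrix (Fin n) (Fin n) ℝ).PosSemidef → A + P ∈ carrier
  f2 : ∀ A ∈ carrier, ∀ t : ℝ, 0 < t → t • A ∈ carrier

/-- The dual of a set of symmetric matrices: F̃ = {A : −A ∉ Int F}. -/
def dualSet (S : Set (SymMat n)) : Set (SymMat n) := {A | -A ∉ interior S}

/-- The subequation P = {A ≥ 0} of positive semidefinite matrices. -/
def PosP (n : ℕ) : Set (SymMat n) := {A | (A : Matrix (Fin n) (Fin n) ℝ).PosSemidef}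

/-- The Hessian matrix (D²f)(x) of a real function on ℝⁿ. -/
def hessMatrix (f : EucSp n → ℝ) (x : EucSp n) : Matrix (Fin n) (Fin n) ℝ :=
  Matrix.of fun i j =>
    iteratedFDeriv ℝ 2 f x ![EuclideanSpace.single i 1, EuclideanSpace.single j 1]

/-- ψ is a test function for u at x₀ (relative to the set X): ψ is C² near x₀,
u ≤ ψ near x₀ (within X), and u(x₀) = ψ(x₀). -/
def IsTestAt (X : Set (EucSp n)) (u : EucSp n → EReal) (ψ : EucSp n → ℝ) (x₀ : EucSp n) :
    Prop :=
  ContDiffAt ℝ 2 ψ x₀ ∧ (∀ᶠ x in 𝓝[X] x₀, u x ≤ (ψ x : EReal)) ∧ u x₀ = (ψ x₀ : EReal)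

/-- u admits no test functions at x₀ (relative to X). -/
def NoTestAt (X : Set (EucSp n)) (u : EucSp n → EReal) (x₀ : EucSp n) : Prop :=
  ∀ ψ : EucSp n → ℝ, ¬ IsTestAt X u ψ x₀

/-- u is S-subharmonic on X (viscosity sense): u is upper semicontinuous on X with values
in [−∞,∞), and for every test function ψ for u at a point of X, the Hessian of ψ there
lies in S. -/
def FSubharmonicOn (S : Set (SymMat n)) (X : Set (EucSp n)) (u : EucSp n → EReal) : Prop :=
  UpperSemicontinuousOn u X ∧ (∀ x ∈ X, u x ≠ ⊤) ∧
    ∀ x₀ ∈ X, ∀ ψ : EucSp n → ℝ, IsTestAt X u ψ x₀ →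
      hessMatrix ψ x₀ ∈ Subtype.val '' S

/-- u is F-harmonic on X: u is F-subharmonic and −u is F̃-subharmonic on X. -/
def FHarmonicOn (F : ConeSubequation n) (X : Set (EucSp n)) (u : EucSp n → EReal) : Prop :=
  FSubharmonicOn F.carrier X u ∧ FSubharmonicOn (dualSet F.carrier) X (fun x => -u x)

/-- u is subaffine on X, i.e. P̃-subharmonic on X. -/
def SubaffineOn (X : Set (EucSp n)) (u : EucSp n → EReal) : Prop :=
  FSubharmonicOn (dualSet (PosP n)) X u

/-- h is a downward-pointing singular F-harmonic at x₀ on the neighborhood U: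
continuous, F-subharmonic on U, F-harmonic on U∖{x₀}, with a strict minimum at x₀, and
either of polar type (h(x₀) = −∞) or of finite type (h(x₀) > −∞, no test functions at x₀). -/
structure DPSingular (F : ConeSubequation n) (U : Set (EucSp n)) (x₀ : EucSp n)
    (h : EucSp n → EReal) : Prop where
  isOpen' : IsOpen U
  mem : x₀ ∈ U
  cont : ContinuousOn h U
  subh : FSubharmonicOn F.carrier U h
  harm : FHarmonicOn F (U \ {x₀}) h
  strictMin : ∀ x ∈ U, x ≠ x₀ → h x₀ < h x
  polarOrFinite : h x₀ = ⊥ ∨ (h x₀ ≠ ⊥ ∧ NoTestAt U h x₀)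

/-- Polar-case asymptotic equivalence H ≈ h at x₀: h − C ≤ H ≤ h + C near x₀. -/
def PolarAsymp (H : EucSp n → ℝ) (h : EucSp n → EReal) (x₀ : EucSp n) : Prop :=
  ∃ C : ℝ, ∀ᶠ x in 𝓝[≠] x₀, h x - (C : EReal) ≤ (H x : EReal) ∧ (H x : EReal) ≤ h x + (C : EReal)

/-- Finite-case asymptotic equivalence H ∼ h at x₀:
lim_{x→x₀} (H(x) − H(x₀))/(h(x) − h(x₀)) = 1. -/
def FiniteAsymp (H : EucSp n → ℝ) (h : EucSp n → EReal) (x₀ : EucSp n) : Prop :=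
  Tendsto (fun x => (H x - H x₀) / ((h x).toReal - (h x₀).toReal)) (𝓝[≠] x₀) (𝓝 1)

/-- Ω is a bounded domain: open, connected and bounded. -/
def IsBoundedDomain (Ω : Set (EucSp n)) : Prop :=
  IsOpen Ω ∧ IsConnected Ω ∧ Bornology.IsBounded Ω

/-- Condition (F3): −P_e ∉ F for every unit vector e. -/
def CondF3 (F : ConeSubequation n) : Prop :=
  ∀ e : EucSp n, ‖e‖ = 1 → -(symProj e) ∉ F.carrier

/-- The inward unit normal −∇ρ(x)/|∇ρ(x)| of the hypersurface {ρ = 0} bounding {ρ < 0}. -/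
def innerNormal (ρ : EucSp n → ℝ) (x : EucSp n) : EucSp n :=
  -(‖gradient ρ x‖⁻¹ • gradient ρ x)

/-- The second fundamental form of {ρ = 0} at x with respect to the inward normal,
extended by zero on the normal line: the tangential part of Hess ρ(x)/|∇ρ(x)|. -/
def secondFF (ρ : EucSp n → ℝ) (x : EucSp n) : Matrix (Fin n) (Fin n) ℝ :=
  ‖gradient ρ x‖⁻¹ •
    ((1 - projMat (innerNormal ρ x)) * hessMatrix ρ x * (1 - projMat (innerNormal ρ x)))

/-- Ω has smooth boundary which is strictly F-convex: Ω is globally defined by a smooth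
defining function ρ with nonvanishing gradient along ∂Ω, and at every boundary point
II_x + t·P_{ν(x)} ∈ Int F for all sufficiently large t. -/
def StrictlyConvexBoundary (F : ConeSubequation n) (Ω : Set (EucSp n)) : Prop :=
  ∃ ρ : EucSp n → ℝ, ContDiff ℝ (⊤ : ℕ∞) ρ ∧ Ω = {x | ρ x < 0} ∧
    ∀ x ∈ frontier Ω, gradient ρ x ≠ 0 ∧
      ∃ t₀ : ℝ, ∀ t ≥ t₀,
        secondFF ρ x + t • projMat (innerNormal ρ x) ∈ Subtype.val '' interior F.carrier

/-- F is invariant under O(n): gᵀ A g ∈ F for every orthogonal g and A ∈ F. -/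
def OrthInvariant (F : ConeSubequation n) : Prop :=
  ∀ g : Matrix (Fin n) (Fin n) ℝ, g.transpose * g = 1 →
    ∀ A ∈ F.carrier, ∀ B : SymMat n,
      (B : Matrix (Fin n) (Fin n) ℝ) = g.transpose * (A : Matrix (Fin n) (Fin n) ℝ) * g →
      B ∈ F.carrier

/-- F has Riesz characteristic p: P_{e⊥} − (p−1)P_e ∈ ∂F for every unit vector e. -/
def HasRieszChar (F : ConeSubequation n) (p : ℝ) : Prop :=
  ∀ e : EucSp n, ‖e‖ = 1 → charMat p e ∈ frontier F.carrier

/-- The Riesz kernel K_p. -/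
def rieszKernel (p : ℝ) (x : EucSp n) : ℝ :=
  if p = 2 then Real.log ‖x‖ else -(p - 2)⁻¹ * ‖x‖ ^ (2 - p)

/-! ### Quadratic forms of symmetric matrices -/

/-- The quadratic form `h ↦ ⟨A h, h⟩`. -/
def qf (A : SymMat n) (h : EucSp n) : ℝ := ∑ i, ∑ j, A.1 i j * h i * h j

@[simp] lemma qf_add (A B : SymMat n) (h : EucSp n) : qf (A + B) h = qf A h + qf B h := by
  simp [qf, add_mul, Finset.sum_add_distrib]

@[simp] lemma qf_neg (A : SymMat n) (h : EucSp n) : qf (-A) h = -qf A h := by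
  simp [qf]

@[simp] lemma qf_sub (A B : SymMat n) (h : EucSp n) : qf (A - B) h = qf A h - qf B h := by
  rw [sub_eq_add_neg, qf_add, qf_neg]; ring

@[simp] lemma qf_smul (c : ℝ) (A : SymMat n) (h : EucSp n) : qf (c • A) h = c * qf A h := by
  simp [qf, Finset.mul_sum, mul_assoc]

@[simp] lemma qf_zero_left (h : EucSp n) : qf (0 : SymMat n) h = 0 := by
  simp [qf]

@[simp] lemma qf_zero_right (A : SymMat n) : qf A 0 = 0 := by
  simp [qf]

@[simp] lemma qf_one (h : EucSp n) : qf (1 : SymMat n) h = ‖h‖ ^ 2 := by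
  rw [EuclideanSpace.real_norm_sq_eq]
  simp [qf, Matrix.one_apply, pow_two]

@[simp] lemma qf_symProj (v h : EucSp n) : qf (symProj v) h = (inner ℝ v h) ^ 2 := by
  simp only [qf, symProj, projMat, Matrix.of_apply, PiLp.inner_apply, pow_two, Finset.sum_mul_sum]
  refine Finset.sum_congr rfl fun i _ => Finset.sum_congr rfl fun j _ => ?_
  simp
  ring

lemma qf_smul_right (A : SymMat n) (t : ℝ) (h : EucSp n) : qf A (t • h) = t ^ 2 * qf A h := by
  simp only [qf, Finset.mul_sum]
  refine Finset.sum_congr rfl fun i _ => Finset.sum_congr rfl fun j _ => ?_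
  simp
  ring

lemma charMat_eq (p : ℝ) (e : EucSp n) : charMat p e = 1 - p • symProj e := by
  apply Subtype.ext
  simp only [charMat, charMatM, symProj, AddSubgroup.coe_sub, selfAdjoint.val_one,
    selfAdjoint.val_smul]
  rw [sub_smul, one_smul]
  abel

lemma symMat_apply_comm (A : SymMat n) (i j : Fin n) : A.1 i j = A.1 j i := by
  have h := A.2
  rw [selfAdjoint.mem_iff] at h
  have := congrFun (congrFun h j) i
  simpa [Matrix.star_apply] using this

lemma qf_eq_dotProduct (A : SymMat n) (h : EucSp n) :
    qf A h = dotProduct (h : Fin n → ℝ) (Matrix.mulVec A.1 h) := by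
  simp only [qf, dotProduct, Matrix.mulVec, Finset.mul_sum]
  refine Finset.sum_congr rfl fun i _ => Finset.sum_congr rfl fun j _ => ?_
  ring

lemma symMat_isHermitian (A : SymMat n) : A.1.IsHermitian := by
  have h := A.2
  rwa [selfAdjoint.mem_iff] at h

lemma qf_add_right (A : SymMat n) (z h : EucSp n) :
    qf A (z + h) = qf A z + qf A h + 2 * inner ℝ (WithLp.toLp 2 (A.1.mulVec z) : EucSp n) h := by
  have e3 : inner ℝ (WithLp.toLp 2 (A.1.mulVec z) : EucSp n) h =
      ∑ i, ∑ j, A.1 i j * z j * h i := by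
    simp [PiLp.inner_apply, Matrix.mulVec, dotProduct, Finset.mul_sum]
    exact Finset.sum_congr rfl fun i _ => Finset.sum_congr rfl fun j _ => by ring
  have e4 : ∑ i, ∑ j, A.1 i j * z j * h i = ∑ i, ∑ j, A.1 i j * z i * h j := by
    rw [Finset.sum_comm]
    exact Finset.sum_congr rfl fun i _ => Finset.sum_congr rfl fun j _ => by
      rw [symMat_apply_comm A j i]
  rw [two_mul, e3]
  nth_rewrite 2 [e4]
  simp only [qf, ← Finset.sum_add_distrib]
  exact Finset.sum_congr rfl fun i _ => Finset.sum_congr rfl fun j _ => by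
    simp; ring

lemma posSemidef_of_qf_nonneg {A : SymMat n} (h : ∀ x, 0 ≤ qf A x) : A.1.PosSemidef := by
  refine Matrix.PosSemidef.of_dotProduct_mulVec_nonneg (symMat_isHermitian A) fun x => ?_
  have := h (WithLp.toLp 2 x)
  rw [qf_eq_dotProduct] at this
  simpa using this

/-- Symmetric matrices are determined by their quadratic forms. -/
lemma symMat_ext_qf {A B : SymMat n} (h : ∀ x, qf A x = qf B x) : A = B := by
  have hd : ∀ x, qf (A - B) x = 0 := fun x => by rw [qf_sub, h, sub_self]
  rw [← sub_eq_zero]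
  set C := A - B
  have key : ∀ i j, C.1 i j = 0 := by
    have hii : ∀ i, C.1 i i = 0 := by
      intro i
      have := hd (EuclideanSpace.single i 1)
      simpa [qf] using this
    intro i j
    by_cases hij : i = j
    · rw [hij]; exact hii j
    · have := hd (EuclideanSpace.single i 1 + EuclideanSpace.single j 1)
      simp [qf, mul_add, Finset.sum_add_distrib] at this
      rw [hii i, hii j, symMat_apply_comm C j i] at this
      linarith
  apply Subtype.ext
  ext i j
  simpa using key i j

/-- The sum of absolute values of the entries bounds the quadratic form. -/
lemma abs_qf_le (A : SymMat n) (h : EucSp n) :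
    |qf A h| ≤ (∑ i, ∑ j, |A.1 i j|) * ‖h‖ ^ 2 := by
  unfold qf
  refine (Finset.abs_sum_le_sum_abs _ _).trans ?_
  rw [Finset.sum_mul]
  refine Finset.sum_le_sum fun i _ => ?_
  refine (Finset.abs_sum_le_sum_abs _ _).trans ?_
  rw [Finset.sum_mul]
  refine Finset.sum_le_sum fun j _ => ?_
  rw [abs_mul, abs_mul, mul_assoc, pow_two]
  have h1 : |h i| ≤ ‖h‖ := by simpa using PiLp.norm_apply_le h i
  have h2 : |h j| ≤ ‖h‖ := by simpa using PiLp.norm_apply_le h j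
  gcongr

lemma exists_qf_bound (A : SymMat n) : ∃ C : ℝ, 0 ≤ C ∧ ∀ h, |qf A h| ≤ C * ‖h‖ ^ 2 :=
  ⟨_, by positivity, abs_qf_le A⟩

lemma eventually_abs_qf_sub_le (A : SymMat n) {δ : ℝ} (hδ : 0 < δ) :
    ∀ᶠ B in 𝓝 A, ∀ h, |qf B h - qf A h| ≤ δ * ‖h‖ ^ 2 := by
  have hc : Continuous fun B : SymMat n => ∑ i, ∑ j, |(B - A).1 i j| := by
    refine continuous_finsetSum _ fun i _ => continuous_finsetSum _ fun j _ => ?_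
    have h1 : Continuous fun B : SymMat n => B.1 i j := (continuous_subtype_val).matrix_elem i j
    simp only [AddSubgroup.coe_sub, Matrix.sub_apply]
    exact (h1.sub continuous_const).abs
  have h0 : (fun B : SymMat n => ∑ i, ∑ j, |(B - A).1 i j|) A < δ := by simpa using hδ
  filter_upwards [hc.continuousAt.eventually_lt continuousAt_const h0] with B hB h
  rw [← qf_sub]
  exact (abs_qf_le _ _).trans (by gcongr)

lemma symMat_continuous_add_smul_one (A : SymMat n) :
    Continuous fun t : ℝ => A + t • (1 : SymMat n) := by
  rw [continuous_induced_rng]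
  change Continuous fun t : ℝ => A.1 + t • (1 : Matrix (Fin n) (Fin n) ℝ)
  fun_prop

/-! ### Cone subequations -/

namespace ConeSubequation

variable {F : ConeSubequation n}

lemma mono {A B : SymMat n} (hA : A ∈ F.carrier) (h : ∀ x, qf A x ≤ qf B x) : B ∈ F.carrier := by
  have := F.f1 A hA (B - A) (posSemidef_of_qf_nonneg fun x => by rw [qf_sub]; linarith [h x])
  simpa using this

lemma closed_of_add {A : SymMat n} (h : ∀ δ : ℝ, 0 < δ → A + δ • (1 : SymMat n) ∈ F.carrier) :
    A ∈ F.carrier := by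
  have h1 : Tendsto (fun t : ℝ => A + t • (1 : SymMat n)) (𝓝[>] 0) (𝓝 A) := by
    have := ((symMat_continuous_add_smul_one A).tendsto 0).mono_left (nhdsWithin_le_nhds (s := Set.Ioi 0))
    simpa using this
  exact F.isClosed'.mem_of_tendsto h1 (by filter_upwards [self_mem_nhdsWithin] with t ht using h t ht)

lemma mem_interior_iff {A : SymMat n} :
    A ∈ interior F.carrier ↔ ∃ δ : ℝ, 0 < δ ∧ A - δ • (1 : SymMat n) ∈ F.carrier := by
  constructor
  · intro hA
    have h1 : Tendsto (fun t : ℝ => A + t • (1 : SymMat n)) (𝓝[<] 0) (𝓝 A) := by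
      have := ((symMat_continuous_add_smul_one A).tendsto 0).mono_left
        (nhdsWithin_le_nhds (s := Set.Iio 0))
      simpa using this
    have h2 := h1.eventually (isOpen_interior.mem_nhds hA)
    obtain ⟨t, ht, ht0⟩ := (h2.and self_mem_nhdsWithin).exists
    refine ⟨-t, by simpa using ht0, ?_⟩
    have := interior_subset ht
    simpa using this
  · rintro ⟨δ, hδ, h⟩
    rw [mem_interior_iff_mem_nhds]
    filter_upwards [eventually_abs_qf_sub_le A hδ] with B hB
    refine mono h fun x => ?_
    have := abs_le.1 (hB x)
    simp only [qf_sub, qf_smul, qf_one]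
    linarith [this.1]

lemma zero_mem : (0 : SymMat n) ∈ F.carrier := by
  obtain ⟨A, hA⟩ := F.nonempty'
  obtain ⟨C, hC, h⟩ := exists_qf_bound A
  refine closed_of_add fun δ hδ => ?_
  refine mono (F.f2 A hA (δ / (C + 1)) (by positivity)) fun x => ?_
  simp only [qf_smul, zero_add, qf_one]
  have h1 := (abs_le.1 (h x)).2
  have h2 : δ / (C + 1) * qf A x ≤ δ / (C + 1) * ((C + 1) * ‖x‖ ^ 2) := by
    gcongr
    nlinarith [sq_nonneg ‖x‖]
  refine h2.trans (le_of_eq ?_)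
  field_simp

lemma mem_of_nonneg {A : SymMat n} (h : ∀ x, 0 ≤ qf A x) : A ∈ F.carrier :=
  mono zero_mem fun x => by simpa using h x

lemma smul_mem {A : SymMat n} (hA : A ∈ F.carrier) {t : ℝ} (ht : 0 ≤ t) : t • A ∈ F.carrier := by
  rcases ht.eq_or_lt with rfl | ht
  · simpa using zero_mem
  · exact F.f2 A hA t ht

lemma add_mem (hconv : Convex ℝ F.carrier) {A B : SymMat n} (hA : A ∈ F.carrier)
    (hB : B ∈ F.carrier) : A + B ∈ F.carrier := by
  have := hconv hA hB (show (0 : ℝ) ≤ 1 / 2 by norm_num) (show (0 : ℝ) ≤ 1 / 2 by norm_num)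
    (by norm_num)
  have h2 := F.f2 _ this 2 (by norm_num)
  convert h2 using 1
  rw [smul_add, smul_smul, smul_smul]
  norm_num

lemma sum_mem (hconv : Convex ℝ F.carrier) {ι : Type*} (s : Finset ι) (A : ι → SymMat n)
    (hA : ∀ i ∈ s, A i ∈ F.carrier) : ∑ i ∈ s, A i ∈ F.carrier := by
  induction s using Finset.induction_on with
  | empty => simpa using zero_mem
  | insert a s ha ih =>
    rw [Finset.sum_insert ha]
    exact add_mem hconv (hA a (Finset.mem_insert_self a s))
      (ih fun i hi => hA i (Finset.mem_insert_of_mem hi))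

lemma neg_smul_one_notMem {δ : ℝ} (hδ : 0 < δ) :
    -(δ • (1 : SymMat n)) ∉ F.carrier := by
  intro h
  apply F.proper'
  rw [Set.eq_univ_iff_forall]
  intro A
  obtain ⟨C, hC, hA⟩ := exists_qf_bound A
  refine mono (F.f2 _ h ((C + 1) / δ) (by positivity)) fun x => ?_
  have h1 := (abs_le.1 (hA x)).1
  simp only [qf_smul, qf_neg, qf_one]
  have : (C + 1) / δ * -(δ * ‖x‖ ^ 2) = -(C + 1) * ‖x‖ ^ 2 := by field_simp
  rw [this]
  nlinarith [sq_nonneg ‖x‖]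

lemma mem_dualSet_iff {A : SymMat n} :
    A ∈ dualSet F.carrier ↔ ∀ δ : ℝ, 0 < δ → -A - δ • (1 : SymMat n) ∉ F.carrier := by
  simp only [dualSet, Set.mem_ofPred_eq, mem_interior_iff, not_exists, not_and]

end ConeSubequation

/-! ### Orthogonal invariance and ellipticity in the direction of the Riesz kernel -/

lemma qf_reflection_mem {F : ConeSubequation n} (hinv : OrthInvariant F) {w : EucSp n}
    (hw : ‖w‖ = 1) {A B : SymMat n} (hA : A ∈ F.carrier)
    (hB : ∀ h, qf B h = qf A (h - (2 * inner ℝ w h) • w)) : B ∈ F.carrier := by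
  set g : Matrix (Fin n) (Fin n) ℝ := 1 - (2 : ℝ) • projMat w with hg
  have hsq : projMat w * projMat w = projMat w := by
    ext i j
    have h1 : ∑ k, w k * w k = 1 := by
      have := EuclideanSpace.real_norm_sq_eq w
      rw [hw] at this
      simpa [pow_two] using this.symm
    simp only [projMat, Matrix.mul_apply, Matrix.of_apply]
    calc ∑ k, w i * w k * (w k * w j) = (w i * w j) * ∑ k, w k * w k := by
          rw [Finset.mul_sum]; exact Finset.sum_congr rfl fun k _ => by ring
      _ = w i * w j := by rw [h1, mul_one]
  have hT : g.transpose = g := by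
    have : (projMat w).transpose = projMat w := by
      ext i j; simp [projMat, mul_comm]
    rw [hg, Matrix.transpose_sub, Matrix.transpose_smul, this, Matrix.transpose_one]
  have hgg : g.transpose * g = 1 := by
    rw [hT, hg]
    simp only [sub_mul, mul_sub, one_mul, mul_one, smul_mul_assoc, mul_smul_comm, hsq]
    module
  have hsa : g.transpose * A.1 * g ∈ selfAdjoint (Matrix (Fin n) (Fin n) ℝ) := by
    rw [selfAdjoint.mem_iff]
    have hA' := symMat_isHermitian A
    have hA2 : A.1.transpose = A.1 := by simpa [Matrix.IsHermitian] using hA'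
    rw [Matrix.star_eq_conjTranspose, Matrix.conjTranspose_eq_transpose_of_trivial]
    simp only [Matrix.transpose_mul, Matrix.transpose_transpose, hA2, mul_assoc]
  have hC := hinv g hgg A hA ⟨_, hsa⟩ rfl
  convert hC using 1
  apply symMat_ext_qf
  intro h
  rw [hB, qf_eq_dotProduct, qf_eq_dotProduct]
  have hgh : Matrix.mulVec g (h : Fin n → ℝ) = (h - (2 * inner ℝ w h) • w : EucSp n) := by
    ext i
    have : Matrix.mulVec (projMat w) (h : Fin n → ℝ) i = inner ℝ w h * w i := by
      simp only [Matrix.mulVec, dotProduct, projMat, Matrix.of_apply, PiLp.inner_apply,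
        Finset.sum_mul]
      exact Finset.sum_congr rfl fun k _ => by simp; ring
    simp [hg, Matrix.sub_mulVec, Matrix.smul_mulVec, this]
    ring
  rw [← hgh]
  simp only [← Matrix.mulVec_mulVec, Matrix.dotProduct_mulVec, Matrix.vecMul_transpose]

lemma mem_of_equal_coordinates {F : ConeSubequation n} (hinv : OrthInvariant F)
    {e v v' : EucSp n} (hn : ‖v‖ = ‖v'‖) (he : inner ℝ e v = inner ℝ e v') {x y c : ℝ}
    (h : x • (1 : SymMat n) + y • symProj e - c • symProj v ∈ F.carrier) :
    x • (1 : SymMat n) + y • symProj e - c • symProj v' ∈ F.carrier := by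
  by_cases hv : v = v'
  · rwa [← hv]
  set d : ℝ := ‖v - v'‖ with hd
  have hd0 : d ≠ 0 := by rw [hd, norm_ne_zero_iff, sub_ne_zero]; exact hv
  set w : EucSp n := d⁻¹ • (v - v') with hw
  have hw1 : ‖w‖ = 1 := by
    rw [hw, norm_smul, norm_inv, ← hd, Real.norm_of_nonneg (norm_nonneg _)]
    exact inv_mul_cancel₀ hd0
  have hew : inner ℝ e w = 0 := by
    rw [hw, inner_smul_right, inner_sub_right, he, sub_self, mul_zero]
  have hd2 : d ^ 2 = 2 * (‖v‖ ^ 2 - inner ℝ v v') := by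
    rw [hd, norm_sub_sq_real, ← hn]; ring
  have hvw : inner ℝ v w = d / 2 := by
    rw [hw, inner_smul_right, inner_sub_right, real_inner_self_eq_norm_sq]
    field_simp
    linarith
  have hdw : d • w = v - v' := by
    rw [hw, smul_smul, mul_inv_cancel₀ hd0, one_smul]
  refine qf_reflection_mem hinv hw1 h fun k => ?_
  simp only [qf_sub, qf_add, qf_smul, qf_one, qf_symProj]
  have h1 : ‖k - (2 * inner ℝ w k) • w‖ ^ 2 = ‖k‖ ^ 2 := by
    rw [norm_sub_sq_real, inner_smul_right, norm_smul, hw1, real_inner_comm, mul_one,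
      Real.norm_eq_abs, sq_abs]
    ring
  have h2 : inner ℝ e (k - (2 * inner ℝ w k) • w) = inner ℝ e k := by
    rw [inner_sub_right, inner_smul_right, hew]; ring
  have h3 : inner ℝ v (k - (2 * inner ℝ w k) • w) = inner ℝ v' k := by
    have h4 : inner ℝ (d • w) k = inner ℝ v k - inner ℝ v' k := by
      rw [hdw, inner_sub_left]
    rw [inner_smul_left] at h4
    simp only [conj_trivial] at h4
    rw [inner_sub_right, inner_smul_right, hvw]
    linarith
  rw [h1, h2, h3]

lemma charMat_mem {F : ConeSubequation n} {p : ℝ} (hchar : HasRieszChar F p) {e : EucSp n}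
    (he : ‖e‖ = 1) : charMat p e ∈ F.carrier :=
  F.isClosed'.frontier_subset (hchar e he)

lemma charMat_sub_notMem {F : ConeSubequation n} {p : ℝ} (hchar : HasRieszChar F p) {e : EucSp n}
    (he : ‖e‖ = 1) {δ : ℝ} (hδ : 0 < δ) : charMat p e - δ • (1 : SymMat n) ∉ F.carrier := fun h =>
  (hchar e he).2 (ConeSubequation.mem_interior_iff.2 ⟨δ, hδ, h⟩)

lemma radial_mem_imp {F : ConeSubequation n} (hconv : Convex ℝ F.carrier) {p : ℝ} (hp1 : 1 < p)
    (hchar : HasRieszChar F p) {e : EucSp n} (he : ‖e‖ = 1) {x y : ℝ}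
    (h : x • (1 : SymMat n) + y • symProj e ∈ F.carrier) : 0 ≤ p * x + y := by
  by_contra! hlt
  set k : ℝ := |x| + 1
  have hk : 0 ≤ k := by positivity
  have hx : 0 < x + k := by have := neg_abs_le x; simp only [k]; linarith
  have h1 := ConeSubequation.add_mem hconv h (ConeSubequation.smul_mem (charMat_mem hchar he) hk)
  set q : ℝ := (p * k - y) / (x + k)
  have hq : p < q := by
    rw [lt_div_iff₀ hx]; linarith
  have h2 := F.f2 _ h1 ((x + k)⁻¹ * (p / q)) (by have : 0 < q := by linarith
                                                 positivity)
  refine charMat_sub_notMem hchar he (δ := 1 - p / q) ?_ ?_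
  · rw [sub_pos, div_lt_one (by linarith)]; exact hq
  · convert h2 using 1
    apply symMat_ext_qf
    intro z
    have hq0 : q ≠ 0 := by linarith
    have hqe : y - p * k = - q * (x + k) := by simp only [q]; field_simp; ring
    simp only [charMat_eq, qf_sub, qf_add, qf_smul, qf_one, qf_symProj]
    have e1 : x * ‖z‖ ^ 2 + y * inner ℝ e z ^ 2 + k * (‖z‖ ^ 2 - p * inner ℝ e z ^ 2)
      = (x + k) * ‖z‖ ^ 2 + (y - p * k) * inner ℝ e z ^ 2 := by ring
    rw [e1, hqe]
    field_simp
    ring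

/-- Averaging over rotations fixing `e`: a rank-one perturbation of a multiple of
`P_{e⊥} - (p-1) P_e` cannot stay in `F` unless it is compensated. -/
lemma rank_one_bound {F : ConeSubequation n} (hconv : Convex ℝ F.carrier) (hinv : OrthInvariant F)
    {p : ℝ} (hp1 : 1 < p) (hp2 : p < 2) (hchar : HasRieszChar F p) (hn2 : 2 ≤ n)
    {e : EucSp n} (he : ‖e‖ = 1) {C c₁ c₂ : ℝ} (hc₂ : 0 ≤ c₂) {v : EucSp n}
    (h : C • charMat p e + c₁ • (1 : SymMat n) - c₂ • symProj v ∈ F.carrier) :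
    c₂ * (p - 1) * ‖v‖ ^ 2 ≤ (n - 1) * p * c₁ := by
  obtain ⟨u, b, hu, hb⟩ :=
    Orthonormal.exists_orthonormalBasis_extension (𝕜 := ℝ) (E := EucSp n) (v := {e})
      (by rw [orthonormal_iff_ite]; rintro ⟨i, rfl⟩ ⟨j, rfl⟩; simp [he])
  have heu : e ∈ u := hu rfl
  have hcard : u.card = n := by
    have := Module.finrank_eq_card_basis b.toBasis
    simpa using this.symm
  set s : ℝ := inner ℝ e v with hs
  have hst : s ^ 2 ≤ ‖v‖ ^ 2 := by
    have := abs_real_inner_le_norm e v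
    rw [he, one_mul] at this
    exact sq_le_sq.2 (by rwa [abs_of_nonneg (norm_nonneg v)])
  set t : ℝ := √(‖v‖ ^ 2 - s ^ 2) with ht
  have ht2 : t ^ 2 = ‖v‖ ^ 2 - s ^ 2 := Real.sq_sqrt (by linarith)
  have hform : C • charMat p e + c₁ • (1 : SymMat n) =
      (C + c₁) • (1 : SymMat n) + (-(C * p)) • symProj e := by
    rw [charMat_eq]; module
  rw [hform] at h
  have hmem : ∀ f ∈ u.erase e, ∀ ε : ℝ, ε ^ 2 = 1 →
      (C + c₁) • (1 : SymMat n) + (-(C * p)) • symProj e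
        - c₂ • symProj (s • e + (ε * t) • f) ∈ F.carrier := by
    intro f hf ε hε
    obtain ⟨hfe, hfu⟩ := Finset.mem_erase.1 hf
    have hef : inner ℝ e f = 0 := by
      have := b.orthonormal.2 (i := ⟨e, heu⟩) (j := ⟨f, hfu⟩) (by simpa using Ne.symm hfe)
      simpa [hb] using this
    have hf1 : ‖f‖ = 1 := by
      have := b.orthonormal.1 ⟨f, hfu⟩
      simpa [hb] using this
    refine mem_of_equal_coordinates hinv ?_ ?_ h
    · rw [← sq_eq_sq₀ (norm_nonneg _) (norm_nonneg _), norm_add_sq_real, inner_smul_left,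
        inner_smul_right, hef, norm_smul, norm_smul, he, hf1, Real.norm_eq_abs, Real.norm_eq_abs,
        mul_one, mul_one, sq_abs, sq_abs, mul_pow, hε, ht2]
      simp
    · rw [inner_add_right, inner_smul_right, inner_smul_right, hef, real_inner_self_eq_norm_sq, he]
      simp [hs]
  have hsum := ConeSubequation.sum_mem hconv (u.erase e)
    (fun f => ((C + c₁) • (1 : SymMat n) + (-(C * p)) • symProj e
        - c₂ • symProj (s • e + ((1 : ℝ) * t) • f)) +
        ((C + c₁) • (1 : SymMat n) + (-(C * p)) • symProj e
        - c₂ • symProj (s • e + ((-1 : ℝ) * t) • f)))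
    (fun f hf => ConeSubequation.add_mem hconv (hmem f hf 1 (by norm_num))
      (hmem f hf (-1) (by norm_num)))
  set N : ℝ := (n : ℝ) - 1 with hN
  have hNcard : ((u.erase e).card : ℝ) = N := by
    rw [Finset.card_erase_of_mem heu, hcard, Nat.cast_sub (by omega)]; simp [hN]
  have hN1 : 1 ≤ N := by
    have : (2 : ℝ) ≤ n := by exact_mod_cast hn2
    linarith
  have hPars : ∀ z : EucSp n, ∑ f ∈ u.erase e, inner ℝ f z ^ 2 = ‖z‖ ^ 2 - inner ℝ e z ^ 2 := by
    intro z
    have h1 := b.sum_sq_norm_inner_right z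
    have h2 : ∑ i : u, ‖inner ℝ (b i) z‖ ^ 2 = ∑ f ∈ u, inner ℝ f z ^ 2 := by
      rw [hb, ← Finset.sum_coe_sort u (fun f => inner ℝ f z ^ 2)]
      simp
    rw [h2] at h1
    rw [← h1, ← Finset.add_sum_erase u _ heu]
    ring
  have hfin : (2 * (N * (C + c₁) - c₂ * t ^ 2)) • (1 : SymMat n) +
      (2 * (N * (-(C * p)) - c₂ * N * s ^ 2 + c₂ * t ^ 2)) • symProj e ∈ F.carrier := by
    convert hsum using 1
    apply symMat_ext_qf
    intro z
    have hqs : ∀ (S : Finset (EucSp n)) (G : EucSp n → SymMat n),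
        qf (∑ f ∈ S, G f) z = ∑ f ∈ S, qf (G f) z := by
      intro S G
      induction S using Finset.induction_on with
      | empty => simp
      | insert a S ha ih => rw [Finset.sum_insert ha, Finset.sum_insert ha, qf_add, ih]
    rw [hqs]
    have hterm : ∀ f ∈ u.erase e,
        qf (((C + c₁) • (1 : SymMat n) + (-(C * p)) • symProj e
        - c₂ • symProj (s • e + ((1 : ℝ) * t) • f)) +
        ((C + c₁) • (1 : SymMat n) + (-(C * p)) • symProj e
        - c₂ • symProj (s • e + ((-1 : ℝ) * t) • f))) z =
        2 * ((C + c₁) * ‖z‖ ^ 2 + (-(C * p)) * inner ℝ e z ^ 2 - c₂ * s ^ 2 * inner ℝ e z ^ 2)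
          - 2 * c₂ * t ^ 2 * inner ℝ f z ^ 2 := by
      intro f _
      simp only [qf_add, qf_sub, qf_smul, qf_one, qf_symProj, inner_add_left, inner_smul_left,
        conj_trivial]
      ring
    rw [Finset.sum_congr rfl hterm, Finset.sum_sub_distrib, Finset.sum_const, nsmul_eq_mul,
      hNcard, ← Finset.mul_sum, hPars]
    simp only [qf_add, qf_smul, qf_one, qf_symProj]
    ring
  have := radial_mem_imp hconv hp1 hchar he hfin
  have hss : 0 ≤ s ^ 2 := sq_nonneg s
  have h5 : c₂ * (p - 1) * ‖v‖ ^ 2 ≤ c₂ * (N * s ^ 2 + (p - 1) * t ^ 2) := by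
    have : (p - 1) * ‖v‖ ^ 2 ≤ N * s ^ 2 + (p - 1) * t ^ 2 := by
      rw [ht2]; nlinarith
    calc c₂ * (p - 1) * ‖v‖ ^ 2 = c₂ * ((p - 1) * ‖v‖ ^ 2) := by ring
      _ ≤ _ := by gcongr
  nlinarith [h5]

lemma two_le_of_hasRieszChar {F : ConeSubequation n} {p : ℝ} (hp1 : 1 < p)
    (hchar : HasRieszChar F p) : 2 ≤ n := by
  by_contra! hlt
  interval_cases n
  · apply F.proper'
    obtain ⟨A, hA⟩ := F.nonempty'
    rw [Set.eq_univ_iff_forall]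
    intro B
    have : A = B := symMat_ext_qf fun x => by simp [qf]
    rwa [← this]
  · have h1 : ‖(EuclideanSpace.single 0 1 : EucSp 1)‖ = 1 := by simp
    have := charMat_mem hchar h1
    refine ConeSubequation.neg_smul_one_notMem (F := F) (δ := p - 1) (by linarith) ?_
    convert this using 1
    apply symMat_ext_qf
    intro x
    simp [charMat_eq, EuclideanSpace.real_norm_sq_eq, PiLp.inner_apply]
    ring

/-! ### Second order Taylor expansions -/

lemma isLittleO_second_order {E : Type*} [NormedAddCommGroup E] [NormedSpace ℝ E] {f : E → ℝ}
    {f' : E → E →L[ℝ] ℝ} {f'' : E →L[ℝ] E →L[ℝ] ℝ} {x : E}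
    (hf : ∀ᶠ y in 𝓝 x, HasFDerivAt f (f' y) y) (hx : HasFDerivAt f' f'' x) :
    (fun h => f (x + h) - f x - f' x h - f'' h h / 2) =o[𝓝 0] fun h => ‖h‖ ^ 2 := by
  have hsymm : ∀ v w, f'' v w = f'' w v := fun v w =>
    second_derivative_symmetric_of_eventually hf hx v w
  rw [Asymptotics.isLittleO_iff]
  intro ε hε
  have h1 := (hasFDerivAt_iff_isLittleO_nhds_zero.1 hx).def hε
  have h2 : ∀ᶠ h in 𝓝 (0 : E), HasFDerivAt f (f' (x + h)) (x + h) := by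
    have : Tendsto (fun h : E => x + h) (𝓝 0) (𝓝 x) := by
      simpa using (continuous_const_add x).tendsto 0
    exact this.eventually hf
  obtain ⟨r, hr, hball⟩ := Metric.eventually_nhds_iff_ball.1 (h1.and h2)
  filter_upwards [Metric.ball_mem_nhds (0 : E) hr] with h hh
  have hder : ∀ k ∈ Metric.ball (0 : E) r, HasFDerivAt
      (fun h => f (x + h) - f x - f' x h - f'' h h / 2) (f' (x + k) - f' x - f'' k) k := by
    intro k hk
    have a1 : HasFDerivAt (fun h => f (x + h)) (f' (x + k)) k := by
      have := (hball k hk).2.comp k ((hasFDerivAt_id k).const_add x)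
      simpa [Function.comp_def] using this
    have a2 : HasFDerivAt (fun h => f'' h h) (f'' k + (f''.flip k)) k := by
      have := (f''.hasFDerivAt (x := k)).clm_apply (hasFDerivAt_id k)
      simpa using this
    have a3 := ((a1.sub_const (f x)).sub (f' x).hasFDerivAt).sub (a2.mul_const (1 / 2 : ℝ))
    refine (a3.congr_fderiv ?_).congr_of_eventuallyEq ?_
    · ext w
      have := hsymm k w
      simp only [sub_apply, smul_apply, add_apply, ContinuousLinearMap.flip_apply, smul_eq_mul]
      rw [hsymm w k]
      ring
    · filter_upwards with w
      simp [div_eq_mul_inv]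
  have hmem : ∀ k ∈ Metric.closedBall (0 : E) ‖h‖, k ∈ Metric.ball (0 : E) r := by
    intro k hk
    rw [mem_ball_zero_iff] at *
    rw [mem_closedBall_zero_iff] at hk
    exact hk.trans_lt hh
  have := (convex_closedBall (0 : E) ‖h‖).norm_image_sub_le_of_norm_hasFDerivWithin_le
    (f := fun h => f (x + h) - f x - f' x h - f'' h h / 2)
    (f' := fun k => f' (x + k) - f' x - f'' k) (C := ε * ‖h‖)
    (fun k hk => (hder k (hmem k hk)).hasFDerivWithinAt)
    (fun k hk => ((hball k (hmem k hk)).1).trans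
      (by rw [mem_closedBall_zero_iff] at hk; gcongr))
    (x := 0) (y := h) (by simp) (by simp)
  simpa [pow_two, mul_assoc] using this

/-- `f` has the second order Taylor expansion at `x` with gradient `b` and Hessian `A`. -/
def Taylor2 (f : EucSp n → ℝ) (x b : EucSp n) (A : SymMat n) : Prop :=
  (fun h => f (x + h) - f x - inner ℝ b h - qf A h / 2) =o[𝓝 0] fun h => ‖h‖ ^ 2

namespace Taylor2

variable {f g : EucSp n → ℝ} {x b c : EucSp n} {A B : SymMat n}

lemma add (hf : Taylor2 f x b A) (hg : Taylor2 g x c B) :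
    Taylor2 (fun y => f y + g y) x (b + c) (A + B) := by
  refine (Asymptotics.IsLittleO.add hf hg).congr_left fun h => ?_
  simp only [inner_add_left, qf_add]; ring

lemma const_mul (k : ℝ) (hf : Taylor2 f x b A) :
    Taylor2 (fun y => k * f y) x (k • b) (k • A) := by
  refine (Asymptotics.IsLittleO.const_mul_left hf k).congr_left fun h => ?_
  simp only [inner_smul_left, qf_smul, conj_trivial]; ring

lemma neg (hf : Taylor2 f x b A) : Taylor2 (fun y => -f y) x (-b) (-A) := by
  refine (Asymptotics.IsLittleO.neg_left hf).congr_left fun h => ?_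
  simp only [inner_neg_left, qf_neg]; ring

lemma sub (hf : Taylor2 f x b A) (hg : Taylor2 g x c B) :
    Taylor2 (fun y => f y - g y) x (b - c) (A - B) := by
  simpa only [sub_eq_add_neg] using hf.add hg.neg

lemma const (k : ℝ) (x : EucSp n) : Taylor2 (fun _ => k) x 0 0 := by
  simp [Taylor2]

lemma add_const (hf : Taylor2 f x b A) (k : ℝ) : Taylor2 (fun y => f y + k) x b A := by
  simpa using hf.add (const k x)

lemma const_add (hf : Taylor2 f x b A) (k : ℝ) : Taylor2 (fun y => k + f y) x b A := by
  simpa using (const k x).add hf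

lemma const_sub (hf : Taylor2 f x b A) (k : ℝ) : Taylor2 (fun y => k - f y) x (-b) (-A) := by
  simpa using (const k x).sub hf

lemma congr (hf : Taylor2 f x b A) (h : g =ᶠ[𝓝 x] f) : Taylor2 g x b A := by
  refine Asymptotics.IsLittleO.congr' hf ?_ EventuallyEq.rfl
  have h1 : Tendsto (fun h : EucSp n => x + h) (𝓝 0) (𝓝 x) := by
    simpa using (continuous_const_add x).tendsto 0
  filter_upwards [h1.eventually h] with k hk
  rw [hk, h.self_of_nhds]

lemma quadratic (b x y : EucSp n) (A : SymMat n) :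
    Taylor2 (fun z => inner ℝ b z + qf A (z - y) / 2) x
      (b + WithLp.toLp 2 (A.1.mulVec (x - y : EucSp n))) A := by
  have : ∀ h, inner ℝ b (x + h) + qf A (x + h - y) / 2 - (inner ℝ b x + qf A (x - y) / 2) -
      inner ℝ (b + WithLp.toLp 2 (A.1.mulVec (x - y : EucSp n))) h - qf A h / 2 = 0 := by
    intro h
    have e1 : x + h - y = (x - y) + h := by abel
    rw [e1]
    generalize x - y = z
    rw [qf_add_right, inner_add_left, inner_add_right]
    ring
  exact (Asymptotics.isLittleO_zero _ _).congr_left fun h => (this h).symm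

lemma isBigO (hf : Taylor2 f x b A) : (fun h => f (x + h) - f x) =O[𝓝 0] fun h => ‖h‖ := by
  have h2 : (fun h : EucSp n => ‖h‖ ^ 2) =O[𝓝 0] fun h => ‖h‖ := by
    refine Asymptotics.IsBigO.of_bound 1 ?_
    filter_upwards [Metric.closedBall_mem_nhds (0 : EucSp n) one_pos] with h hh
    rw [mem_closedBall_zero_iff] at hh
    simp only [norm_pow, norm_norm, one_mul]
    nlinarith [norm_nonneg h]
  have h3 : (fun h => qf A h / 2) =O[𝓝 0] fun h => ‖h‖ := by
    obtain ⟨C, hC, hA⟩ := exists_qf_bound A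
    refine Asymptotics.IsBigO.trans (Asymptotics.IsBigO.of_bound C ?_) h2
    filter_upwards with h
    rw [norm_div, Real.norm_eq_abs, norm_pow, norm_norm]
    have := hA h
    norm_num
    linarith [abs_nonneg (qf A h)]
  have h4 : (fun h => inner ℝ b h) =O[𝓝 0] fun h => ‖h‖ := by
    refine Asymptotics.IsBigO.of_bound ‖b‖ ?_
    filter_upwards with h
    rw [norm_norm]
    exact norm_inner_le_norm b h
  refine ((((Asymptotics.IsLittleO.isBigO hf).trans h2).add h3).add h4).congr_left fun h => ?_
  ring

lemma comp {φ φ' : ℝ → ℝ} {k : ℝ} (hf : Taylor2 f x b A)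
    (hφ : ∀ᶠ s in 𝓝 (f x), HasDerivAt φ (φ' s) s) (hφ' : HasDerivAt φ' k (f x)) :
    Taylor2 (fun y => φ (f y)) x (φ' (f x) • b) (φ' (f x) • A + k • symProj b) := by
  have h1 := isLittleO_second_order (f := φ) (x := f x)
    (f' := fun s => ContinuousLinearMap.toSpanSingleton ℝ (φ' s))
    (f'' := ContinuousLinearMap.toSpanSingleton ℝ (ContinuousLinearMap.toSpanSingleton ℝ k))
    (by filter_upwards [hφ] with s hs using hs.hasFDerivAt)
    (by
      have := (ContinuousLinearMap.toSpanSingletonCLE (𝕜 := ℝ) (E := ℝ)).hasFDerivAt.comp (f x)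
        hφ'.hasFDerivAt
      refine this.congr_fderiv ?_
      ext
      simp)
  have hO := hf.isBigO
  have ht : Tendsto (fun h => f (x + h) - f x) (𝓝 0) (𝓝 0) :=
    hO.trans_tendsto (by simpa using (continuous_norm (E := EucSp n)).tendsto 0)
  have h2 := h1.comp_tendsto ht
  have hsq : (fun h => (f (x + h) - f x) ^ 2) =O[𝓝 0] fun h => ‖h‖ ^ 2 := hO.pow 2
  have h3 : (fun h => φ (f (x + h)) - φ (f x) - φ' (f x) * (f (x + h) - f x) -
      k * (f (x + h) - f x) ^ 2 / 2) =o[𝓝 0] fun h : EucSp n => ‖h‖ ^ 2 := by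
    refine (h2.congr_left fun h => ?_).trans_isBigO (hsq.congr_left fun h => ?_)
    · simp [pow_two]
      ring
    · simp
  have h4 : (fun h => (f (x + h) - f x) ^ 2 - inner ℝ b h ^ 2) =o[𝓝 0]
      fun h : EucSp n => ‖h‖ ^ 2 := by
    have hb : (fun h => inner ℝ b h) =O[𝓝 0] fun h : EucSp n => ‖h‖ := by
      refine Asymptotics.IsBigO.of_bound ‖b‖ ?_
      filter_upwards with h
      rw [norm_norm]
      exact norm_inner_le_norm b h
    have hd : (fun h => f (x + h) - f x - inner ℝ b h) =o[𝓝 0] fun h => ‖h‖ := by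
      have h5 : (fun h : EucSp n => ‖h‖ ^ 2) =o[𝓝 0] fun h => ‖h‖ := by
        have := Asymptotics.isLittleO_norm_pow_id (E' := EucSp n) (n := 2) (by norm_num)
        exact this.norm_right
      have h6 : (fun h => qf A h / 2) =O[𝓝 0] fun h : EucSp n => ‖h‖ ^ 2 := by
        obtain ⟨C, hC, hA⟩ := exists_qf_bound A
        refine Asymptotics.IsBigO.of_bound C ?_
        filter_upwards with h
        rw [norm_div, Real.norm_eq_abs, norm_pow, norm_norm]
        have := hA h
        norm_num
        linarith [abs_nonneg (qf A h)]
      refine (((Asymptotics.IsLittleO.isBigO hf).add h6).trans_isLittleO h5).congr_left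
        fun h => ?_
      ring
    refine ((hd.mul_isBigO (hO.add hb)).congr_left fun h => ?_).congr_right fun h => ?_
    · ring
    · ring
  refine ((h3.add (hf.const_mul_left (φ' (f x)))).add (h4.const_mul_left (k / 2))).congr_left
    fun h => ?_
  simp only [inner_smul_left, qf_add, qf_smul, conj_trivial, qf_symProj]
  ring

lemma sq (hf : Taylor2 f x b A) :
    Taylor2 (fun y => f y ^ 2) x ((2 * f x) • b) ((2 * f x) • A + (2 : ℝ) • symProj b) :=
  hf.comp (φ := fun s => s ^ 2) (φ' := fun s => 2 * s)
    (by filter_upwards with s using by simpa using hasDerivAt_pow 2 s)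
    (by simpa using (hasDerivAt_id (f x)).const_mul (2 : ℝ))

lemma mul (hf : Taylor2 f x b A) (hg : Taylor2 g x c B) {M : SymMat n}
    (hM : ∀ h, qf M h = f x * qf B h + g x * qf A h + 2 * inner ℝ b h * inner ℝ c h) :
    Taylor2 (fun y => f y * g y) x (f x • c + g x • b) M := by
  have h := (((hf.add hg).sq.sub (hf.sub hg).sq).const_mul (1 / 4))
  have e1 : (fun y => 1 / 4 * ((f y + g y) ^ 2 - (f y - g y) ^ 2)) = fun y => f y * g y := by
    ext y; ring
  rw [e1] at h
  convert h using 1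
  · module
  · apply symMat_ext_qf
    intro z
    simp only [hM, qf_smul, qf_sub, qf_add, qf_symProj, inner_add_left, inner_sub_left]
    ring

lemma unique (hf : Taylor2 f x b A) (hg : Taylor2 f x c B) : A = B := by
  have hd : (fun h => inner ℝ (b - c) h + qf (A - B) h / 2) =o[𝓝 0]
      fun h : EucSp n => ‖h‖ ^ 2 := by
    refine (Asymptotics.IsLittleO.sub hg hf).congr_left fun h => ?_
    simp only [inner_sub_left, qf_sub]
    ring
  have hd2 : (fun h => qf (A - B) h) =o[𝓝 0] fun h : EucSp n => ‖h‖ ^ 2 := by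
    have hneg : Tendsto (fun h : EucSp n => -h) (𝓝 0) (𝓝 0) := by
      simpa using (continuous_neg (G := EucSp n)).tendsto 0
    have h2 := hd.comp_tendsto hneg
    refine ((hd.add (h2.congr_right fun h => ?_)).congr_left fun h => ?_)
    · simp
    · have := qf_smul_right (A - B) (-1) h
      rw [neg_one_smul] at this
      simp only [Function.comp, inner_neg_right, this]
      ring
  apply symMat_ext_qf
  intro h
  rw [← sub_eq_zero, ← qf_sub]
  by_contra hne
  have h0 : 0 < |qf (A - B) h| := abs_pos.2 hne
  have hpos : 0 < ‖h‖ := by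
    rw [norm_pos_iff]
    rintro rfl
    simp at hne
  have h3 := hd2.def (show 0 < |qf (A - B) h| / (2 * ‖h‖ ^ 2) by positivity)
  have ht : Tendsto (fun t : ℝ => t • h) (𝓝[>] 0) (𝓝 0) := by
    have : Tendsto (fun t : ℝ => t • h) (𝓝 0) (𝓝 ((0 : ℝ) • h)) :=
      (continuous_id.smul continuous_const).tendsto 0
    rw [zero_smul] at this
    exact this.mono_left nhdsWithin_le_nhds
  obtain ⟨t, ht1, ht2⟩ := ((ht.eventually h3).and self_mem_nhdsWithin).exists
  have ht0 : 0 < t := ht2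
  rw [qf_smul_right, norm_smul, norm_mul, norm_pow, norm_pow, norm_mul, norm_norm, mul_pow,
    norm_norm, Real.norm_eq_abs (qf _ _), Real.norm_of_nonneg ht0.le] at ht1
  have : |qf (A - B) h| / (2 * ‖h‖ ^ 2) * (t ^ 2 * ‖h‖ ^ 2) = t ^ 2 * |qf (A - B) h| / 2 := by
    field_simp
  rw [this] at ht1
  nlinarith [mul_pos (pow_pos ht0 2) h0]

end Taylor2

namespace Taylor2

variable {f g : EucSp n → ℝ} {x b c : EucSp n} {A B : SymMat n}

lemma norm_sub_sq (x z : EucSp n) :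
    Taylor2 (fun y => ‖y - z‖ ^ 2) x ((2 : ℝ) • (x - z)) ((2 : ℝ) • 1) := by
  refine (Asymptotics.isLittleO_zero _ _).congr_left fun h => ?_
  have : x + h - z = (x - z) + h := by abel
  beta_reduce
  rw [this, norm_add_sq_real, inner_smul_left, qf_smul, qf_one]
  simp only [conj_trivial]
  ring

lemma rpow_kernel {p : ℝ} {x z : EucSp n} (hxz : x ≠ z) :
    Taylor2 (fun y => ‖y - z‖ ^ (2 - p)) x
      (((2 - p) * ‖x - z‖ ^ (-p)) • (x - z))
      (((2 - p) * ‖x - z‖ ^ (-p)) • charMat p (‖x - z‖⁻¹ • (x - z))) := by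
  have hpos : 0 < ‖x - z‖ := norm_pos_iff.2 (sub_ne_zero.2 hxz)
  have hs : 0 < ‖x - z‖ ^ 2 := by positivity
  set q : ℝ := (2 - p) / 2 with hq
  have h1 := (norm_sub_sq x z).comp (φ := fun s => s ^ q) (φ' := fun s => q * s ^ (q - 1))
    (k := q * ((q - 1) * (‖x - z‖ ^ 2) ^ (q - 1 - 1)))
    (by
      filter_upwards [lt_mem_nhds hs] with s hs'
      simpa using Real.hasDerivAt_rpow_const (p := q) (Or.inl hs'.ne'))
    (by simpa using (Real.hasDerivAt_rpow_const (p := q - 1) (Or.inl hs.ne')).const_mul q)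
  have e1 : (fun y : EucSp n => (‖y - z‖ ^ 2) ^ q) = fun y => ‖y - z‖ ^ (2 - p) := by
    ext y
    rw [← Real.rpow_natCast, ← Real.rpow_mul (norm_nonneg _), hq]
    congr 1
    push_cast
    ring
  have e2 : (‖x - z‖ ^ 2) ^ (q - 1) = ‖x - z‖ ^ (-p) := by
    rw [← Real.rpow_natCast, ← Real.rpow_mul (norm_nonneg _), hq]
    congr 1
    push_cast
    ring
  have e3 : (‖x - z‖ ^ 2) ^ (q - 1 - 1) = ‖x - z‖ ^ (-p) * (‖x - z‖⁻¹) ^ 2 := by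
    rw [Real.rpow_sub hs, e2, Real.rpow_one]
    field_simp
  rw [e1] at h1
  convert h1 using 1
  · rw [e2, smul_smul, hq]
    congr 1
    ring
  · rw [e2, e3]
    apply symMat_ext_qf
    intro h
    simp only [charMat_eq, qf_smul, qf_sub, qf_add, qf_one, qf_symProj, inner_smul_left,
      conj_trivial, hq]
    ring

lemma exp_bump (α : ℝ) (x z : EucSp n) :
    Taylor2 (fun y => Real.exp (-α * ‖y - z‖ ^ 2)) x
      ((Real.exp (-α * ‖x - z‖ ^ 2)) • (-α) • (2 : ℝ) • (x - z))
      (Real.exp (-α * ‖x - z‖ ^ 2) • ((4 * α ^ 2) • symProj (x - z) - (2 * α) • 1)) := by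
  have h1 := ((norm_sub_sq x z).const_mul (-α)).comp (φ := Real.exp) (φ' := Real.exp)
    (k := Real.exp (-α * ‖x - z‖ ^ 2))
    (by filter_upwards with s using Real.hasDerivAt_exp s) (Real.hasDerivAt_exp _)
  convert h1 using 1
  apply symMat_ext_qf
  intro h
  simp only [qf_smul, qf_sub, qf_add, qf_one, qf_symProj, inner_smul_left, conj_trivial]
  ring

end Taylor2

lemma hessMatrix_selfAdjoint {f : EucSp n → ℝ} {x : EucSp n} (hf : ContDiffAt ℝ 2 f x) :
    hessMatrix f x ∈ selfAdjoint (Matrix (Fin n) (Fin n) ℝ) := by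
  rw [selfAdjoint.mem_iff]
  ext i j
  have hs : IsSymmSndFDerivAt ℝ f x := hf.isSymmSndFDerivAt (by simp)
  simpa [hessMatrix, Matrix.star_apply, iteratedFDeriv_two_apply] using hs _ _

/-- The Hessian of a function which is twice continuously differentiable at `x`. -/
def symHess (f : EucSp n → ℝ) (x : EucSp n) : SymMat n :=
  if h : ContDiffAt ℝ 2 f x then ⟨hessMatrix f x, hessMatrix_selfAdjoint h⟩ else 0

lemma symHess_coe {f : EucSp n → ℝ} {x : EucSp n} (hf : ContDiffAt ℝ 2 f x) :
    (symHess f x).1 = hessMatrix f x := by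
  rw [symHess, dif_pos hf]

lemma taylor2_of_contDiffAt {f : EucSp n → ℝ} {x : EucSp n} (hf : ContDiffAt ℝ 2 f x) :
    Taylor2 f x (gradient f x) (symHess f x) := by
  have h1 : ∀ᶠ y in 𝓝 x, HasFDerivAt f (fderiv ℝ f y) y := by
    filter_upwards [hf.eventually (by simp)] with y hy
    exact (hy.differentiableAt (by simp)).hasFDerivAt
  have h2 : HasFDerivAt (fderiv ℝ f) (fderiv ℝ (fderiv ℝ f) x) x :=
    ((hf.fderiv_right (m := 1) (by norm_num)).differentiableAt (by simp)).hasFDerivAt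
  refine (isLittleO_second_order h1 h2).congr_left fun h => ?_
  have e1 : fderiv ℝ f x h = inner ℝ (gradient f x) h := by
    rw [gradient, InnerProductSpace.toDual_symm_apply]
  have e2 : fderiv ℝ (fderiv ℝ f) x h h = qf (symHess f x) h := by
    have hsum : h = ∑ i, h i • (EuclideanSpace.single i (1 : ℝ) : EucSp n) := by
      ext j
      simp [Pi.single_apply]
    simp only [qf, symHess_coe hf, hessMatrix, Matrix.of_apply, iteratedFDeriv_two_apply]
    conv_lhs => rw [hsum]
    simp only [map_sum, map_smul, FunLike.coe_sum, Finset.sum_apply, Finset.mul_sum,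
      smul_apply, smul_eq_mul]
    rw [Finset.sum_comm]
    refine Finset.sum_congr rfl fun i _ => Finset.sum_congr rfl fun j _ => ?_
    simp
    ring
  rw [e1, e2]

/-- A real function `u` satisfies the viscosity condition for `S` on `X`, formulated in terms of
quadratic upper contact. -/
def SubQ (S : Set (SymMat n)) (X : Set (EucSp n)) (u : EucSp n → ℝ) : Prop :=
  ∀ x ∈ X, ∀ (b : EucSp n) (A : SymMat n),
    (∀ᶠ h in 𝓝 0, u (x + h) ≤ u x + inner ℝ b h + qf A h / 2) → A ∈ S

lemma tendsto_const_add_nhds_zero (x : EucSp n) :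
    Tendsto (fun h : EucSp n => x + h) (𝓝 0) (𝓝 x) := by
  simpa using (continuous_const_add x).tendsto 0

lemma tendsto_sub_const_nhds (x : EucSp n) :
    Tendsto (fun y : EucSp n => y - x) (𝓝 x) (𝓝 0) := by
  simpa using (continuous_sub_right x).tendsto x

lemma subQ_of_fSubharmonicOn {S : Set (SymMat n)} {X : Set (EucSp n)} {u : EucSp n → ℝ}
    (hu : FSubharmonicOn S X fun y => (u y : EReal)) : SubQ S X u := by
  intro x hx b A h
  have hq := (Taylor2.quadratic b x x A).add_const (u x - inner ℝ b x)
  set ψ : EucSp n → ℝ := fun z => inner ℝ b z + qf A (z - x) / 2 + (u x - inner ℝ b x) with hψ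
  have hc : ContDiff ℝ 2 ψ := by
    simp only [hψ, qf]
    have hin : ContDiff ℝ 2 fun z : EucSp n => inner ℝ b z := (innerSL ℝ b).contDiff
    have : ∀ i : Fin n, ContDiff ℝ 2 fun z : EucSp n => (z - x) i := fun i => by
      simp only [PiLp.sub_apply]
      fun_prop
    fun_prop
  obtain ⟨A', hA', hAψ⟩ := hu.2.2 x hx ψ ⟨hc.contDiffAt, by
    refine nhdsWithin_le_nhds ?_
    filter_upwards [(tendsto_sub_const_nhds x).eventually h] with y hy
    rw [add_sub_cancel] at hy
    rw [EReal.coe_le_coe_iff]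
    refine hy.trans (le_of_eq ?_)
    rw [inner_sub_right]
    ring, by simp [hψ]⟩
  have h2 := hq.unique (taylor2_of_contDiffAt hc.contDiffAt)
  have : A = A' := by
    rw [h2]
    apply Subtype.ext
    rw [symHess_coe hc.contDiffAt, hAψ]
  rwa [this]

lemma Taylor2.eventually_le {f : EucSp n → ℝ} {x b : EucSp n} {A : SymMat n}
    (hf : Taylor2 f x b A) {δ : ℝ} (hδ : 0 < δ) :
    ∀ᶠ h in 𝓝 0, f (x + h) ≤ f x + inner ℝ b h + qf (A + δ • 1) h / 2 := by
  filter_upwards [hf.def (half_pos hδ)] with h hh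
  rw [Real.norm_eq_abs, norm_pow, norm_norm] at hh
  have := (abs_le.1 hh).2
  simp only [qf_add, qf_smul, qf_one]
  linarith

/-- Membership in `S` is detected by adding small multiples of the identity. -/
def ClosedAbove (S : Set (SymMat n)) : Prop :=
  ∀ A : SymMat n, (∀ δ : ℝ, 0 < δ → A + δ • (1 : SymMat n) ∈ S) → A ∈ S

lemma ConeSubequation.closedAbove (F : ConeSubequation n) : ClosedAbove F.carrier :=
  fun _ => F.closed_of_add

lemma ConeSubequation.closedAbove_dualSet (F : ConeSubequation n) :
    ClosedAbove (dualSet F.carrier) := by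
  intro A h
  rw [mem_dualSet_iff]
  intro δ hδ hmem
  refine mem_dualSet_iff.1 (h (δ / 2) (half_pos hδ)) (δ / 2) (half_pos hδ) ?_
  convert hmem using 1
  module

lemma SubQ.mem_of_taylor2 {S : Set (SymMat n)} (hS : ClosedAbove S) {X : Set (EucSp n)}
    {u ψ : EucSp n → ℝ} (hu : SubQ S X u) {x b : EucSp n} {A : SymMat n} (hx : x ∈ X)
    (hψ : Taylor2 ψ x b A) (hle : ∀ᶠ y in 𝓝 x, u y - ψ y ≤ u x - ψ x) : A ∈ S := by
  refine hS A fun δ hδ => hu x hx b _ ?_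
  filter_upwards [hψ.eventually_le hδ, (tendsto_const_add_nhds_zero x).eventually hle] with h h1 h2
  linarith

lemma fSubharmonicOn_of_subQ {S : Set (SymMat n)} (hS : ClosedAbove S) {X : Set (EucSp n)}
    (hX : IsOpen X) {u : EucSp n → ℝ} (hc : ContinuousOn u X) (hu : SubQ S X u) :
    FSubharmonicOn S X fun y => (u y : EReal) := by
  refine ⟨?_, fun _ _ => EReal.coe_ne_top _, ?_⟩
  · exact ContinuousOn.upperSemicontinuousOn
      (continuous_coe_real_ereal.comp_continuousOn hc)
  · rintro x hx ψ ⟨hψ, hle, heq⟩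
    rw [EReal.coe_eq_coe_iff] at heq
    refine ⟨symHess ψ x, ?_, symHess_coe hψ⟩
    refine hu.mem_of_taylor2 hS hx (taylor2_of_contDiffAt hψ) ?_
    rw [hX.nhdsWithin_eq hx] at hle
    filter_upwards [hle] with y hy
    rw [EReal.coe_le_coe_iff] at hy
    linarith

lemma SubQ.mono_set {S : Set (SymMat n)} {X Y : Set (EucSp n)} {u : EucSp n → ℝ}
    (hu : SubQ S X u) (h : Y ⊆ X) : SubQ S Y u := fun x hx => hu x (h hx)

lemma SubQ.congr {S : Set (SymMat n)} {X : Set (EucSp n)} (hX : IsOpen X) {u v : EucSp n → ℝ}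
    (hu : SubQ S X u) (h : Set.EqOn u v X) : SubQ S X v := by
  intro x hx b A hA
  refine hu x hx b A ?_
  filter_upwards [hA, (tendsto_const_add_nhds_zero x).eventually (hX.mem_nhds hx)] with k h1 h2
  rwa [h hx, h h2]

lemma SubQ.max {S : Set (SymMat n)} {X : Set (EucSp n)} {u v : EucSp n → ℝ}
    (hu : SubQ S X u) (hv : SubQ S X v) : SubQ S X fun y => max (u y) (v y) := by
  intro x hx b A hA
  rcases le_total (u x) (v x) with h | h
  · refine hv x hx b A ?_
    filter_upwards [hA] with k hk
    rw [max_eq_right h] at hk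
    exact (le_max_right _ _).trans hk
  · refine hu x hx b A ?_
    filter_upwards [hA] with k hk
    rw [max_eq_left h] at hk
    exact (le_max_left _ _).trans hk

/-- A function with second order expansions whose Hessians lie in `F` is `F`-subharmonic. -/
lemma subQ_of_taylor2 {F : ConeSubequation n} {X : Set (EucSp n)} {u : EucSp n → ℝ}
    (h : ∀ x ∈ X, ∃ b, ∃ A ∈ F.carrier, Taylor2 u x b A) : SubQ F.carrier X u := by
  intro x hx c B hB
  obtain ⟨b, A, hA, hT⟩ := h x hx
  have hlow : ∀ δ : ℝ, 0 < δ → ∀ᶠ h in 𝓝 0,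
      inner ℝ (b - c) h + qf (A - B - δ • 1) h / 2 ≤ 0 := by
    intro δ hδ
    filter_upwards [hT.neg.eventually_le hδ, hB] with k h1 h2
    simp only [qf_add, qf_sub, qf_neg, qf_smul, qf_one, inner_neg_left, inner_sub_left] at *
    linarith
  have hle : ∀ k, ∀ δ : ℝ, 0 < δ → qf (A - B - δ • 1) k ≤ 0 := by
    intro k δ hδ
    have ht : Tendsto (fun t : ℝ => t • k) (𝓝[>] 0) (𝓝 0) := by
      have : Tendsto (fun t : ℝ => t • k) (𝓝 0) (𝓝 ((0 : ℝ) • k)) :=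
        (continuous_id.smul continuous_const).tendsto 0
      rw [zero_smul] at this
      exact this.mono_left nhdsWithin_le_nhds
    have hneg : Tendsto (fun h : EucSp n => -h) (𝓝 0) (𝓝 0) := by
      simpa using (continuous_neg (G := EucSp n)).tendsto 0
    obtain ⟨t, ⟨h1, h2⟩, ht2⟩ := ((ht.eventually ((hlow δ hδ).and
      (hneg.eventually (hlow δ hδ)))).and self_mem_nhdsWithin).exists
    have ht0 : 0 < t := ht2
    have e := qf_smul_right (A - B - δ • 1) (-1) (t • k)
    rw [neg_one_smul] at e
    rw [inner_neg_right, e] at h2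
    rw [qf_smul_right] at h1 h2
    nlinarith [pow_pos ht0 2]
  refine F.closed_of_add fun δ hδ => F.mono hA fun k => ?_
  have := hle k δ hδ
  simp only [qf_add, qf_sub, qf_smul] at *
  linarith

/-! ### Maximum principles -/

lemma max_principle_core {K D : Set (EucSp n)} (hK : IsCompact K) (hDK : D ⊆ K) (hD : IsOpen D)
    {u g : EucSp n → ℝ} (hu : ContinuousOn u K) (hg : ContinuousOn g K)
    (hbd : ∀ x ∈ K \ D, u x ≤ g x)
    (hloc : ∀ x ∈ D, ∀ δ : ℝ, 0 < δ → ∃ᶠ y in 𝓝 x,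
      u x - g x + δ * ‖x‖ ^ 2 < u y - g y + δ * ‖y‖ ^ 2) :
    ∀ x ∈ K, u x ≤ g x := by
  intro x₁ hx₁
  by_contra! hlt
  obtain ⟨R, hR, hKR⟩ := hK.isBounded.exists_pos_norm_le
  set δ : ℝ := (u x₁ - g x₁) / (2 * R ^ 2) with hδ
  have hδ0 : 0 < δ := div_pos (by linarith) (by positivity)
  obtain ⟨x, hx, hmax⟩ := hK.exists_isMaxOn ⟨x₁, hx₁⟩
    ((hu.sub hg).add ((continuous_norm.pow 2).const_mul δ).continuousOn)
  by_cases hxD : x ∈ D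
  · obtain ⟨y, hy, hyD⟩ := ((hloc x hxD δ hδ0).and_eventually (hD.mem_nhds hxD)).exists
    exact absurd (hmax (hDK hyD)) (not_le.2 hy)
  · have h1 := hbd x ⟨hx, hxD⟩
    have h2 : u x₁ - g x₁ + δ * ‖x₁‖ ^ 2 ≤ u x - g x + δ * ‖x‖ ^ 2 := hmax hx₁
    have h3 : δ * ‖x‖ ^ 2 ≤ δ * R ^ 2 := by
      have := hKR x hx
      gcongr
    have h4 : δ * R ^ 2 = (u x₁ - g x₁) / 2 := by rw [hδ]; field_simp
    nlinarith [mul_nonneg hδ0.le (sq_nonneg ‖x₁‖)]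

lemma SubQ.frequently_lt {S : Set (SymMat n)} {u g : EucSp n → ℝ} {X : Set (EucSp n)}
    (hS : SubQ S X u) {x b : EucSp n} {A : SymMat n} (hx : x ∈ X) (hg : Taylor2 g x b A)
    (hA : ∀ δ : ℝ, 0 < δ → A - δ • 1 ∉ S) {δ : ℝ} (hδ : 0 < δ) :
    ∃ᶠ y in 𝓝 x, u x - g x + δ * ‖x‖ ^ 2 < u y - g y + δ * ‖y‖ ^ 2 := by
  intro hev
  refine hA δ hδ ?_
  have h1 := (hg.sub ((Taylor2.norm_sub_sq x 0).const_mul δ)).eventually_le hδ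
  refine hS x hx (b - δ • ((2 : ℝ) • (x - 0))) _ ?_
  filter_upwards [h1, (tendsto_const_add_nhds_zero x).eventually hev] with h h2 h3
  simp only [sub_zero, qf_add, qf_sub, qf_smul, qf_one, not_lt] at *
  linarith

lemma max_principle {S : Set (SymMat n)} {K D : Set (EucSp n)} (hK : IsCompact K) (hDK : D ⊆ K)
    (hD : IsOpen D) {u g : EucSp n → ℝ} (hu : ContinuousOn u K) (hg : ContinuousOn g K)
    (hS : SubQ S D u) (hbd : ∀ x ∈ K \ D, u x ≤ g x)
    (hT : ∀ x ∈ D, ∃ b A, Taylor2 g x b A ∧ ∀ δ : ℝ, 0 < δ → A - δ • 1 ∉ S) :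
    ∀ x ∈ K, u x ≤ g x := by
  refine max_principle_core hK hDK hD hu hg hbd fun x hx δ hδ => ?_
  obtain ⟨b, A, hA, hAS⟩ := hT x hx
  exact hS.frequently_lt hx hA hAS hδ

lemma SubQ.add_taylor2 {F : ConeSubequation n} (hconv : Convex ℝ F.carrier) {X : Set (EucSp n)}
    {u v : EucSp n → ℝ} (hu : SubQ F.carrier X u)
    (hv : ∀ x ∈ X, ∃ b, ∃ A ∈ F.carrier, Taylor2 v x b A) :
    SubQ F.carrier X fun y => u y + v y := by
  intro x hx c B hB
  obtain ⟨b, A, hA, hT⟩ := hv x hx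
  refine F.closed_of_add fun δ hδ => ?_
  have h1 : B - A + δ • 1 ∈ F.carrier := by
    refine hu x hx (c - b) _ ?_
    filter_upwards [hT.neg.eventually_le hδ, hB] with h h1 h2
    simp only [qf_add, qf_sub, qf_neg, qf_smul, qf_one, inner_neg_left, inner_sub_left] at *
    linarith
  convert ConeSubequation.add_mem hconv h1 hA using 1
  abel

lemma eventually_mul_lt_rpow {p : ℝ} (hp1 : 1 < p) (L : ℝ) {ε : ℝ} (hε : 0 < ε) :
    ∀ᶠ r in 𝓝[>] (0 : ℝ), L * r < ε * r ^ (2 - p) := by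
  have h1 : Tendsto (fun r : ℝ => L * r ^ (p - 1)) (𝓝[>] 0) (𝓝 0) := by
    have : ContinuousAt (fun r : ℝ => L * r ^ (p - 1)) 0 :=
      (Real.continuousAt_rpow_const 0 (p - 1) (Or.inr (by linarith))).const_mul L
    have h2 := this.tendsto
    rw [Real.zero_rpow (by linarith), mul_zero] at h2
    exact h2.mono_left nhdsWithin_le_nhds
  filter_upwards [h1.eventually_lt_const hε, self_mem_nhdsWithin] with r hr hr0
  have hr0' : 0 < r := hr0
  have h3 : r = r ^ (p - 1) * r ^ (2 - p) := by
    rw [← Real.rpow_add hr0']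
    norm_num
  calc L * r = L * r ^ (p - 1) * r ^ (2 - p) := by rw [mul_assoc, ← h3]
    _ < ε * r ^ (2 - p) := by gcongr

/-- Radial functions built from the Riesz kernel have Hessian on the boundary of `F`. -/
lemma kernel_hess_notMem {F : ConeSubequation n} (hconv : Convex ℝ F.carrier) {p : ℝ}
    (hp1 : 1 < p) (hchar : HasRieszChar F p) {x z : EucSp n} (hxz : x ≠ z) (k c : ℝ) :
    ∃ b A, Taylor2 (fun y => c + k * ‖y - z‖ ^ (2 - p)) x b A ∧
      ∀ δ : ℝ, 0 < δ → A - δ • 1 ∉ F.carrier := by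
  refine ⟨_, _, ((Taylor2.rpow_kernel hxz).const_mul k).const_add c, fun δ hδ hmem => ?_⟩
  have hpos : 0 < ‖x - z‖ := norm_pos_iff.2 (sub_ne_zero.2 hxz)
  have he : ‖‖x - z‖⁻¹ • (x - z)‖ = 1 := by
    rw [norm_smul, norm_inv, norm_norm, inv_mul_cancel₀ hpos.ne']
  set t : ℝ := (2 - p) * ‖x - z‖ ^ (-p) with ht
  have := radial_mem_imp hconv hp1 hchar he (x := k * t - δ) (y := -(k * t * p)) (by
    convert hmem using 1
    rw [charMat_eq]
    module)
  nlinarith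

lemma kernel_hess_mem {F : ConeSubequation n} {p : ℝ} (hp2 : p < 2) (hchar : HasRieszChar F p)
    {x z : EucSp n} (hxz : x ≠ z) {k : ℝ} (hk : 0 ≤ k) (c : ℝ) :
    ∃ b, ∃ A ∈ F.carrier, Taylor2 (fun y => c + k * ‖y - z‖ ^ (2 - p)) x b A := by
  have hpos : 0 < ‖x - z‖ := norm_pos_iff.2 (sub_ne_zero.2 hxz)
  refine ⟨_, _, ?_, ((Taylor2.rpow_kernel hxz).const_mul k).const_add c⟩
  refine F.smul_mem (F.smul_mem (charMat_mem hchar ?_) ?_) hk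
  · rw [norm_smul, norm_inv, norm_norm, inv_mul_cancel₀ hpos.ne']
  · have : 0 ≤ 2 - p := by linarith
    positivity

lemma continuous_kernel {p : ℝ} (hp2 : p < 2) (z : EucSp n) (k c : ℝ) :
    Continuous fun y : EucSp n => c + k * ‖y - z‖ ^ (2 - p) :=
  continuous_const.add (((continuous_id.sub continuous_const).norm.rpow_const
    fun _ => Or.inr (by linarith)).const_mul k)

/-- The value of `u` at `x₀` does not exceed its maximum over small spheres about `x₀`. -/
def CenterLe (x₀ : EucSp n) (u : EucSp n → ℝ) : Prop :=
  ∀ᶠ r in 𝓝[>] (0 : ℝ), ∃ x, ‖x - x₀‖ = r ∧ u x₀ ≤ u x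

/-- The maximum principle for functions which are `F`-subharmonic off one point. -/
lemma max_principle_exc {F : ConeSubequation n} (hconv : Convex ℝ F.carrier) {p : ℝ}
    (hp1 : 1 < p) (hp2 : p < 2) (hchar : HasRieszChar F p) {x₀ : EucSp n}
    {K D : Set (EucSp n)} (hK : IsCompact K) (hDK : D ⊆ K)
    (hD : IsOpen D) {u g : EucSp n → ℝ} (hu : ContinuousOn u K) (hg : ContinuousOn g K)
    (hS : SubQ F.carrier (D \ {x₀}) u) (hexc : x₀ ∈ D → CenterLe x₀ u)
    (hbd : ∀ x ∈ K \ D, u x ≤ g x)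
    (hT : ∀ x ∈ D, ∃ b A, Taylor2 g x b A ∧ ∀ δ : ℝ, 0 < δ → A - δ • 1 ∉ F.carrier) :
    ∀ x ∈ K, u x ≤ g x := by
  have hKc : Continuous fun y : EucSp n => ‖y - x₀‖ ^ (2 - p) := by
    simpa using continuous_kernel hp2 x₀ 1 0
  obtain ⟨M, hM⟩ := (hK.image hKc).bddAbove
  have hM' : ∀ x ∈ K, ‖x - x₀‖ ^ (2 - p) ≤ M := fun x hx => hM ⟨x, hx, rfl⟩
  have key : ∀ ε : ℝ, 0 < ε → ∀ x ∈ K, u x + ε * ‖x - x₀‖ ^ (2 - p) ≤ g x + ε * M := by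
    intro ε hε
    refine max_principle_core hK hDK hD (hu.add (hKc.const_mul ε).continuousOn)
      (hg.add continuousOn_const) (fun x hx => ?_) (fun x hx δ hδ => ?_)
    · have := hbd x hx
      have := hM' x hx.1
      gcongr
    obtain ⟨b, A, hA, hAS⟩ := hT x hx
    by_cases hxx : x = x₀
    · subst hxx
      have hO := (hA.sub ((Taylor2.norm_sub_sq x 0).const_mul δ)).isBigO
      obtain ⟨L, hL⟩ := hO.bound
      rw [Filter.frequently_iff]
      intro U hU
      obtain ⟨s, hs, hsU⟩ := Metric.eventually_nhds_iff_ball.1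
        (hL.and ((tendsto_const_add_nhds_zero x).eventually hU))
      obtain ⟨r, ⟨⟨y, hy, huy⟩, hr1⟩, hr2⟩ := (((hexc hx).and
        (eventually_mul_lt_rpow hp1 L hε)).and (Ioo_mem_nhdsGT hs)).exists
      have hys : y - x ∈ Metric.ball 0 s := by
        rw [mem_ball_zero_iff, hy]; exact hr2.2
      have h2 := hsU _ hys
      rw [add_sub_cancel] at h2
      refine ⟨y, h2.2, ?_⟩
      have h3 := (abs_le.1 h2.1).2
      rw [norm_norm, hy] at h3
      simp only [sub_zero, sub_self, norm_zero] at *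
      rw [hy, Real.zero_rpow (by linarith)]
      linarith
    · refine SubQ.frequently_lt (u := fun y => u y + ε * ‖y - x₀‖ ^ (2 - p))
        (SubQ.add_taylor2 hconv hS fun y hy => ?_) ⟨hx, hxx⟩ (hA.add_const (ε * M)) hAS hδ
      simpa using kernel_hess_mem hp2 hchar (x := y) (z := x₀) (fun h => hy.2 h) hε.le 0
  intro x hx
  have h0 : 0 ≤ ‖x - x₀‖ ^ (2 - p) := by positivity
  refine le_of_forall_pos_le_add fun η hη => ?_
  have hM0 : 0 ≤ M := h0.trans (hM' x hx)
  have := key (η / (M + 1)) (by positivity) x hx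
  have h2 : η / (M + 1) * M ≤ η := by
    rw [div_mul_eq_mul_div, div_le_iff₀ (by positivity)]
    nlinarith
  have h3 : 0 ≤ η / (M + 1) * ‖x - x₀‖ ^ (2 - p) := by positivity
  linarith

/-- Comparison with the Riesz kernel centred at `z` on a ball about `z`. -/
lemma le_kernel_of_subQ {F : ConeSubequation n} (hconv : Convex ℝ F.carrier) {p : ℝ}
    (hp1 : 1 < p) (hp2 : p < 2) (hchar : HasRieszChar F p) {x₀ z : EucSp n} {R : ℝ}
    {u : EucSp n → ℝ} (hu : ContinuousOn u (Metric.closedBall z R))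
    (hS : SubQ F.carrier (Metric.ball z R \ {x₀}) u) (hexc : x₀ ∈ Metric.ball z R → CenterLe x₀ u)
    {c k : ℝ} (hz : u z ≤ c) (hbd : ∀ x, ‖x - z‖ = R → u x ≤ c + k * R ^ (2 - p)) :
    ∀ x, ‖x - z‖ ≤ R → u x ≤ c + k * ‖x - z‖ ^ (2 - p) := by
  have key := max_principle_exc (x₀ := x₀) (D := Metric.ball z R \ {z}) hconv hp1 hp2 hchar
    (isCompact_closedBall z R)
    (Set.sdiff_subset.trans Metric.ball_subset_closedBall)
    (Metric.isOpen_ball.sdiff isClosed_singleton) hu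
    (continuous_kernel hp2 z k c).continuousOn
    (hS.mono_set fun x hx => ⟨hx.1.1, hx.2⟩) (fun h => hexc h.1) ?_
    (fun x hx => kernel_hess_notMem hconv hp1 hchar hx.2 k c)
  · intro x hx
    exact key x (by rwa [Metric.mem_closedBall, dist_eq_norm])
  · rintro x ⟨hx1, hx2⟩
    by_cases hxz : x = z
    · rw [hxz, sub_self, norm_zero, Real.zero_rpow (by linarith)]
      simpa using hz
    · have hxR : ‖x - z‖ = R := by
        rw [Metric.mem_closedBall, dist_eq_norm] at hx1
        refine le_antisymm hx1 ?_
        by_contra! h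
        exact hx2 ⟨by rwa [Metric.mem_ball, dist_eq_norm], hxz⟩
      rw [hxR]
      exact hbd x hxR

/-! ### Densities at a point -/

/-- The upper density of `u` at `x₀` is at least `Θ` on spheres of radius up to `R`. -/
def DensityGe (p : ℝ) (x₀ : EucSp n) (R : ℝ) (u : EucSp n → ℝ) (Θ : ℝ) : Prop :=
  ∀ r : ℝ, 0 < r → r ≤ R → ∃ x, ‖x - x₀‖ = r ∧ u x₀ + Θ * r ^ (2 - p) ≤ u x

lemma DensityGe.centerLe {p : ℝ} {x₀ : EucSp n} {R : ℝ} {u : EucSp n → ℝ} {Θ : ℝ} (hR : 0 < R)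
    (hΘ : 0 ≤ Θ) (h : DensityGe p x₀ R u Θ) : CenterLe x₀ u := by
  filter_upwards [Ioo_mem_nhdsGT hR] with r hr
  obtain ⟨x, hx, hux⟩ := h r hr.1 hr.2.le
  refine ⟨x, hx, ?_⟩
  have : 0 ≤ Θ * r ^ (2 - p) := mul_nonneg hΘ (Real.rpow_nonneg hr.1.le _)
  linarith

lemma SubQ.comp_scaling {F : ConeSubequation n} {X : Set (EucSp n)} {u : EucSp n → ℝ}
    (hu : SubQ F.carrier X u) {t c : ℝ} (ht : 0 < t) (hc : 0 < c) (k : ℝ) (x₀ : EucSp n) :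
    SubQ F.carrier {w | x₀ + t • w ∈ X} fun w => c * (u (x₀ + t • w) - k) := by
  intro w hw b A hA
  have h1 := hu (x₀ + t • w) hw ((c * t)⁻¹ • b) ((c * t ^ 2)⁻¹ • A) (by
    have ht' : Tendsto (fun h : EucSp n => t⁻¹ • h) (𝓝 0) (𝓝 0) := by
      simpa using (continuous_const_smul (T := EucSp n) t⁻¹).tendsto 0
    filter_upwards [ht'.eventually hA] with h hh
    have e1 : x₀ + t • (w + t⁻¹ • h) = x₀ + t • w + h := by
      rw [smul_add, smul_inv_smul₀ ht.ne', add_assoc]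
    rw [e1, inner_smul_right, qf_smul_right] at hh
    rw [inner_smul_left, qf_smul, conj_trivial, mul_inv, mul_inv]
    have e2 : u (x₀ + t • w + h) - k ≤ c⁻¹ * (c * (u (x₀ + t • w) - k) + t⁻¹ * inner ℝ b h +
        t⁻¹ ^ 2 * qf A h / 2) := by
      rw [← div_eq_inv_mul, le_div_iff₀ hc]
      linarith
    have e3 : c⁻¹ * (c * (u (x₀ + t • w) - k) + t⁻¹ * inner ℝ b h + t⁻¹ ^ 2 * qf A h / 2) =
        u (x₀ + t • w) - k + c⁻¹ * t⁻¹ * inner ℝ b h + c⁻¹ * (t ^ 2)⁻¹ * qf A h / 2 := by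
      field_simp
    linarith)
  have h2 := F.smul_mem h1 (show 0 ≤ c * t ^ 2 by positivity)
  rwa [smul_smul, mul_inv_cancel₀ (by positivity), one_smul] at h2

/-- Hölder estimate for functions that are `F`-subharmonic off one point. -/
lemma holder_of_subQ {F : ConeSubequation n} (hconv : Convex ℝ F.carrier) {p : ℝ}
    (hp1 : 1 < p) (hp2 : p < 2) (hchar : HasRieszChar F p) {x₀ : EucSp n} {R : ℝ} (hR : 0 < R)
    {u : EucSp n → ℝ} (hu : ContinuousOn u (Metric.closedBall x₀ R))
    (hS : SubQ F.carrier (Metric.ball x₀ R \ {x₀}) u) (hexc : CenterLe x₀ u) :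
    ∃ C : ℝ, 0 ≤ C ∧ ∀ x y, ‖x - x₀‖ ≤ R / 4 → ‖y - x₀‖ ≤ R / 4 →
      |u x - u y| ≤ C * ‖x - y‖ ^ (2 - p) := by
  obtain ⟨M, hM⟩ := (isCompact_closedBall x₀ R).exists_bound_of_continuousOn hu
  have hR2 : 0 < (R / 2) ^ (2 - p) := by positivity
  have hM0 : 0 ≤ M := (norm_nonneg _).trans (hM x₀ (by simpa using hR.le))
  set C : ℝ := 2 * M / (R / 2) ^ (2 - p)
  have key : ∀ x y, ‖x - x₀‖ ≤ R / 4 → ‖y - x₀‖ ≤ R / 4 →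
      u x ≤ u y + C * ‖x - y‖ ^ (2 - p) := by
    intro x y hx hy
    have hsub : Metric.closedBall y (R / 2) ⊆ Metric.closedBall x₀ R := by
      refine Metric.closedBall_subset_closedBall' ?_
      rw [dist_eq_norm]; linarith
    have hsub2 : Metric.ball y (R / 2) ⊆ Metric.ball x₀ R := by
      refine Metric.ball_subset_ball' ?_
      rw [dist_eq_norm]; linarith
    refine le_kernel_of_subQ (x₀ := x₀) hconv hp1 hp2 hchar (hu.mono hsub)
      (hS.mono_set (Set.sdiff_subset_sdiff_left hsub2)) (fun _ => hexc) le_rfl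
      (fun z hz => ?_) x ?_
    · have h1 := abs_le.1 (hM z (hsub (by rw [Metric.mem_closedBall, dist_eq_norm, hz])))
      have h2 := abs_le.1 (hM y (by rw [Metric.mem_closedBall, dist_eq_norm]; linarith))
      rw [div_mul_cancel₀ _ hR2.ne']
      linarith [h1.2, h2.1]
    · calc ‖x - y‖ = ‖(x - x₀) - (y - x₀)‖ := by congr 1; abel
        _ ≤ _ := norm_sub_le _ _
        _ ≤ R / 2 := by linarith
  refine ⟨C, by positivity, fun x y hx hy => ?_⟩
  have h1 := key x y hx hy
  have h2 := key y x hy hx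
  rw [norm_sub_rev] at h2
  rw [abs_le]
  constructor <;> linarith

lemma exists_density {F : ConeSubequation n} (hconv : Convex ℝ F.carrier) {p : ℝ}
    (hp1 : 1 < p) (hp2 : p < 2) (hchar : HasRieszChar F p) {x₀ : EucSp n} {R : ℝ} (hR : 0 < R)
    {u : EucSp n → ℝ} (hu : ContinuousOn u (Metric.closedBall x₀ R))
    (hS : SubQ F.carrier (Metric.ball x₀ R \ {x₀}) u) (hexc : CenterLe x₀ u)
    {Θ : ℝ} (hd : DensityGe p x₀ R u Θ) :
    ∃ Θ₁, Θ ≤ Θ₁ ∧ DensityGe p x₀ R u Θ₁ ∧ ∀ ε : ℝ, 0 < ε → ∃ r, 0 < r ∧ r ≤ R ∧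
      ∀ x, ‖x - x₀‖ ≤ r → u x ≤ u x₀ + (Θ₁ + ε) * ‖x - x₀‖ ^ (2 - p) := by
  have hmax : ∀ r, 0 < r → r ≤ R → ∃ y, ‖y - x₀‖ = r ∧ ∀ x, ‖x - x₀‖ = r → u x ≤ u y := by
    intro r hr hrR
    obtain ⟨x, hx, -⟩ := hd r hr hrR
    obtain ⟨y, hy, hy2⟩ := (isCompact_sphere x₀ r).exists_isMaxOn
      ⟨x, by rw [mem_sphere_iff_norm, hx]⟩ (hu.mono
        (Metric.sphere_subset_closedBall.trans (Metric.closedBall_subset_closedBall hrR)))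
    refine ⟨y, by rwa [mem_sphere_iff_norm] at hy, fun x hx => hy2 ?_⟩
    rwa [mem_sphere_iff_norm]
  set T : Set ℝ := {θ | DensityGe p x₀ R u θ} with hT
  have hle : ∀ r, 0 < r → r ≤ R → ∀ y, ‖y - x₀‖ = r → (∀ x, ‖x - x₀‖ = r → u x ≤ u y) →
      ∀ θ ∈ T, θ ≤ (u y - u x₀) / r ^ (2 - p) := by
    intro r hr hrR y hy hmy θ hθ
    obtain ⟨x, hx, hux⟩ := hθ r hr hrR
    rw [le_div_iff₀ (by positivity)]
    linarith [hmy x hx]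
  have hbdd : BddAbove T := by
    obtain ⟨y, hy, hmy⟩ := hmax R hR le_rfl
    exact ⟨_, fun θ hθ => hle R hR le_rfl y hy hmy θ hθ⟩
  refine ⟨sSup T, le_csSup hbdd hd, ?_, ?_⟩
  · intro r hr hrR
    obtain ⟨y, hy, hmy⟩ := hmax r hr hrR
    refine ⟨y, hy, ?_⟩
    have := csSup_le ⟨Θ, hd⟩ (hle r hr hrR y hy hmy)
    rw [le_div_iff₀ (by positivity)] at this
    linarith
  · intro ε hε
    have : sSup T + ε ∉ T := fun h => by linarith [le_csSup hbdd h]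
    rw [hT, Set.mem_ofPred_eq, DensityGe] at this
    push Not at this
    obtain ⟨r, hr, hrR, hlt⟩ := this
    refine ⟨r, hr, hrR, ?_⟩
    exact le_kernel_of_subQ (x₀ := x₀) hconv hp1 hp2 hchar
      (hu.mono (Metric.closedBall_subset_closedBall hrR))
      (hS.mono_set (Set.sdiff_subset_sdiff_left (Metric.ball_subset_ball hrR)))
      (fun _ => hexc) le_rfl (fun x hx => (hlt x hx).le)

/-- A quantitative strong maximum principle: a definite gap below `Θ * ‖·‖ ^ (2 - p)` on a small
ball propagates to larger balls. -/
lemma hopf_decay {F : ConeSubequation n} (hconv : Convex ℝ F.carrier) (hinv : OrthInvariant F)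
    {p : ℝ} (hp1 : 1 < p) (hp2 : p < 2) (hchar : HasRieszChar F p) {w z : EucSp n}
    {ρ θ η Θ : ℝ} (hθ : 0 < θ) (hη : 0 < η) (hzw : ‖z - w‖ < ρ) (hρ : ρ < ‖w‖) :
    ∃ ε : ℝ, 0 < ε ∧ ∃ κ : ℝ, 0 < κ ∧ ∀ v : EucSp n → ℝ, ContinuousOn v (Metric.closedBall w ρ) →
      SubQ F.carrier (Metric.ball w ρ) v →
      (∀ y, ‖y - w‖ = ρ → v y ≤ (Θ + ε) * ‖y‖ ^ (2 - p)) →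
      (∀ y, ‖y - w‖ ≤ θ → v y ≤ Θ * ‖y‖ ^ (2 - p) - η) →
      v z ≤ Θ * ‖z‖ ^ (2 - p) - κ := by
  have hn2 := two_le_of_hasRieszChar hp1 hchar
  have hn : (0 : ℝ) < n - 1 := by
    have : (2 : ℝ) ≤ n := by exact_mod_cast hn2
    linarith
  have hp0 : 0 < p - 1 := by linarith
  have hpp : 0 < p := by linarith
  set α : ℝ := (n - 1) * p / (2 * (p - 1) * θ ^ 2) with hα
  have hα0 : 0 < α := by positivity
  have hαθ : 2 * α * (p - 1) * θ ^ 2 = (n - 1) * p := by rw [hα]; field_simp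
  set κ₁ : ℝ := η * (Real.exp (-α * ‖z - w‖ ^ 2) - Real.exp (-α * ρ ^ 2)) with hκ₁
  have hκ₁0 : 0 < κ₁ := by
    refine mul_pos hη (sub_pos.2 (Real.exp_lt_exp.2 ?_))
    have : ‖z - w‖ ^ 2 < ρ ^ 2 := by gcongr
    nlinarith
  have hz0 : 0 ≤ ‖z‖ ^ (2 - p) := by positivity
  set ε : ℝ := κ₁ / (2 * (‖z‖ ^ (2 - p) + 1)) with hε
  have hε0 : 0 < ε := by positivity
  have hεz : ε * ‖z‖ ^ (2 - p) ≤ κ₁ / 2 := by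
    rw [hε, div_mul_eq_mul_div, div_le_div_iff₀ (by positivity) (by norm_num)]
    nlinarith
  refine ⟨ε, hε0, min (κ₁ / 2) η, lt_min (by positivity) hη, fun v hv hS hout hin => ?_⟩
  by_cases hzθ : ‖z - w‖ ≤ θ
  · linarith [hin z hzθ, min_le_right (κ₁ / 2) η]
  push Not at hzθ
  have hne : ∀ y, ‖y - w‖ ≤ ρ → y ≠ 0 := by
    rintro y hy rfl
    rw [zero_sub, norm_neg] at hy
    linarith
  set g : EucSp n → ℝ := fun y => (0 + (Θ + ε) * ‖y - 0‖ ^ (2 - p)) -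
    η * Real.exp (-α * ‖y - w‖ ^ 2) + η * Real.exp (-α * ρ ^ 2) with hg
  have hgc : Continuous g := by
    refine ((continuous_kernel hp2 0 (Θ + ε) 0).sub ?_).add continuous_const
    fun_prop
  have key := max_principle (S := F.carrier) (u := v) (g := g)
    (K := Metric.closedBall w ρ \ Metric.ball w θ)
    (D := Metric.ball w ρ \ Metric.closedBall w θ)
    ((isCompact_closedBall w ρ).diff Metric.isOpen_ball)
    (Set.sdiff_subset_sdiff Metric.ball_subset_closedBall Metric.ball_subset_closedBall)
    (Metric.isOpen_ball.sdiff Metric.isClosed_closedBall)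
    (hv.mono Set.sdiff_subset) hgc.continuousOn (hS.mono_set Set.sdiff_subset) ?_ ?_
    z ⟨by rw [Metric.mem_closedBall, dist_eq_norm]; exact hzw.le,
      by rw [Metric.mem_ball, dist_eq_norm, not_lt]; exact hzθ.le⟩
  · simp only [hg, sub_zero, zero_add] at key
    have := min_le_left (κ₁ / 2) η
    nlinarith
  · rintro y ⟨⟨hy1, hy2⟩, hy3⟩
    simp only [Set.mem_sdiff, Metric.mem_ball, Metric.mem_closedBall, dist_eq_norm, not_lt,
      not_and, not_not] at hy1 hy2 hy3
    simp only [hg, sub_zero, zero_add]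
    rcases hy1.lt_or_eq with h | h
    · have h1 := hin y (hy3 h)
      have h2 : Real.exp (-α * ‖y - w‖ ^ 2) ≤ 1 :=
        Real.exp_le_one_iff.2 (by nlinarith [sq_nonneg ‖y - w‖])
      have h3 := Real.exp_pos (-α * ρ ^ 2)
      have h4 : 0 ≤ ε * ‖y‖ ^ (2 - p) := by positivity
      nlinarith
    · rw [h]
      linarith [hout y h]
  · rintro y ⟨hy1, hy2⟩
    simp only [Metric.mem_ball, Metric.mem_closedBall, dist_eq_norm, not_le] at hy1 hy2
    have hy0 := hne y hy1.le
    refine ⟨_, _, (((Taylor2.rpow_kernel hy0).const_mul (Θ + ε)).const_add 0).sub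
      ((Taylor2.exp_bump α y w).const_mul η) |>.add_const _, fun δ hδ hmem => ?_⟩
    set E : ℝ := Real.exp (-α * ‖y - w‖ ^ 2)
    have hE : 0 < E := Real.exp_pos _
    have he : ‖‖y - 0‖⁻¹ • (y - 0)‖ = 1 := by
      rw [sub_zero, norm_smul, norm_inv, norm_norm, inv_mul_cancel₀ (norm_ne_zero_iff.2 hy0)]
    have := rank_one_bound hconv hinv hp1 hp2 hchar hn2 he
      (C := (Θ + ε) * ((2 - p) * ‖y - 0‖ ^ (-p))) (c₁ := η * E * (2 * α) - δ)
      (c₂ := η * E * (4 * α ^ 2)) (by positivity) (v := y - w) (by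
        convert hmem using 1
        module)
    have h1 : η * E * (4 * α ^ 2) * (p - 1) * θ ^ 2 ≤
        η * E * (4 * α ^ 2) * (p - 1) * ‖y - w‖ ^ 2 := by gcongr
    have h2 : η * E * (4 * α ^ 2) * (p - 1) * θ ^ 2 = (n - 1) * p * (η * E * (2 * α)) := by
      rw [← hαθ]; ring
    have h3 : 0 < (n - 1) * p * δ := by positivity
    nlinarith

/-- The density exists as a genuine limit. -/
lemma tendsto_density {F : ConeSubequation n} (hconv : Convex ℝ F.carrier) (hinv : OrthInvariant F)
    {p : ℝ} (hp1 : 1 < p) (hp2 : p < 2) (hchar : HasRieszChar F p) {x₀ : EucSp n} {R : ℝ}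
    (hR : 0 < R) {u : EucSp n → ℝ} (hu : ContinuousOn u (Metric.closedBall x₀ R))
    (hS : SubQ F.carrier (Metric.ball x₀ R \ {x₀}) u) (hexc : CenterLe x₀ u)
    {Θ : ℝ} (hd : DensityGe p x₀ R u Θ)
    (hup : ∀ ε : ℝ, 0 < ε → ∃ r, 0 < r ∧ r ≤ R ∧
      ∀ x, ‖x - x₀‖ ≤ r → u x ≤ u x₀ + (Θ + ε) * ‖x - x₀‖ ^ (2 - p)) :
    Tendsto (fun x => (u x - u x₀) / ‖x - x₀‖ ^ (2 - p)) (𝓝[≠] x₀) (𝓝 Θ) := by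
  have hn2 := two_le_of_hasRieszChar hp1 hchar
  have hq : 0 < 2 - p := by linarith
  have hpos : ∀ x, x ≠ x₀ → 0 < ‖x - x₀‖ := fun x hx => norm_pos_iff.2 (sub_ne_zero.2 hx)
  have hT0 : Tendsto (fun x : EucSp n => ‖x - x₀‖) (𝓝[≠] x₀) (𝓝 0) := by
    have := ((continuous_sub_right x₀).norm.tendsto x₀)
    rw [sub_self, norm_zero] at this
    exact this.mono_left nhdsWithin_le_nhds
  rw [tendsto_order]
  constructor
  swap
  · intro a ha
    obtain ⟨r, hr, -, hle⟩ := hup ((a - Θ) / 2) (by linarith)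
    filter_upwards [hT0.eventually_lt_const hr, self_mem_nhdsWithin] with x hx hxne
    have h1 := hle x hx.le
    have h2 := hpos x hxne
    rw [div_lt_iff₀ (by positivity)]
    have : 0 < ‖x - x₀‖ ^ (2 - p) := by positivity
    nlinarith
  intro a ha
  by_contra hcon
  rw [not_eventually] at hcon
  obtain ⟨C, hC, hhol⟩ := holder_of_subQ hconv hp1 hp2 hchar hR hu hS hexc
  set S : Set (EucSp n) := {x | ¬ a < (u x - u x₀) / ‖x - x₀‖ ^ (2 - p)}
  have : NeBot (𝓝[≠] x₀ ⊓ 𝓟 S) := Filter.inf_principal_neBot_iff.2 fun U hU => by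
    obtain ⟨x, hx, hxU⟩ := (hcon.and_eventually hU).exists
    exact ⟨x, hxU, hx⟩
  set 𝒰 : Ultrafilter (EucSp n) := Ultrafilter.of (𝓝[≠] x₀ ⊓ 𝓟 S)
  have h𝒰 : (𝒰 : Filter (EucSp n)) ≤ 𝓝[≠] x₀ ⊓ 𝓟 S := Ultrafilter.of_le _
  have hne : ∀ᶠ x in (𝒰 : Filter (EucSp n)), x ≠ x₀ :=
    (h𝒰.trans inf_le_left) self_mem_nhdsWithin
  have hbad : ∀ᶠ x in (𝒰 : Filter (EucSp n)), x ∈ S :=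
    (h𝒰.trans inf_le_right) (mem_principal_self S)
  have hT : Tendsto (fun x : EucSp n => ‖x - x₀‖) 𝒰 (𝓝 0) :=
    hT0.mono_left (h𝒰.trans inf_le_left)
  set v : EucSp n → EucSp n → ℝ := fun x w =>
    (‖x - x₀‖ ^ (2 - p))⁻¹ * (u (x₀ + ‖x - x₀‖ • w) - u x₀) with hv
  have hsmall : ∀ L : ℝ, 0 < L → ∀ r : ℝ, 0 < r → ∀ᶠ x in (𝒰 : Filter (EucSp n)),
      0 < ‖x - x₀‖ ∧ ∀ w : EucSp n, ‖w‖ ≤ L → ‖(x₀ + ‖x - x₀‖ • w) - x₀‖ < r := by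
    intro L hL r hr
    filter_upwards [hne, hT.eventually_lt_const (show 0 < r / L by positivity)] with x hx hx2
    refine ⟨hpos x hx, fun w hw => ?_⟩
    rw [add_sub_cancel_left, norm_smul, norm_norm]
    rw [lt_div_iff₀ hL] at hx2
    exact (mul_le_mul_of_nonneg_left hw (norm_nonneg _)).trans_lt hx2
  have hvhol : ∀ L : ℝ, 0 < L → ∀ᶠ x in (𝒰 : Filter (EucSp n)), ∀ w w' : EucSp n, ‖w‖ ≤ L →
      ‖w'‖ ≤ L → |v x w - v x w'| ≤ C * ‖w - w'‖ ^ (2 - p) := by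
    intro L hL
    filter_upwards [hsmall L hL (R / 4) (by positivity)] with x hx w w' hw hw'
    have h1 := hhol _ _ (hx.2 w hw).le (hx.2 w' hw').le
    have e1 : x₀ + ‖x - x₀‖ • w - (x₀ + ‖x - x₀‖ • w') = ‖x - x₀‖ • (w - w') := by
      rw [smul_sub]; abel
    rw [e1, norm_smul, norm_norm, Real.mul_rpow (norm_nonneg _) (norm_nonneg _)] at h1
    have hpw : 0 < ‖x - x₀‖ ^ (2 - p) := Real.rpow_pos_of_pos hx.1 _
    simp only [hv]
    rw [← mul_sub, sub_sub_sub_cancel_right, abs_mul, abs_inv, abs_of_pos hpw,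
      inv_mul_le_iff₀ hpw]
    linarith
  have hvup : ∀ L : ℝ, 0 < L → ∀ ε : ℝ, 0 < ε → ∀ᶠ x in (𝒰 : Filter (EucSp n)), ∀ w : EucSp n,
      ‖w‖ ≤ L → v x w ≤ (Θ + ε) * ‖w‖ ^ (2 - p) := by
    intro L hL ε hε
    obtain ⟨r, hr, -, hle⟩ := hup ε hε
    filter_upwards [hsmall L hL r hr] with x hx w hw
    have h1 := hle _ (hx.2 w hw).le
    rw [add_sub_cancel_left, norm_smul, norm_norm,
      Real.mul_rpow (norm_nonneg _) (norm_nonneg _)] at h1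
    have hpw : 0 < ‖x - x₀‖ ^ (2 - p) := Real.rpow_pos_of_pos hx.1 _
    simp only [hv]
    rw [inv_mul_le_iff₀ hpw]
    linarith
  set D : Set (EucSp n) := {w | ∃ η : ℝ, 0 < η ∧ ∀ᶠ x in (𝒰 : Filter (EucSp n)),
    v x w ≤ Θ * ‖w‖ ^ (2 - p) - η} with hD
  have hDunif : ∀ w ∈ D, ∃ θ : ℝ, 0 < θ ∧ ∃ η : ℝ, 0 < η ∧ ∀ᶠ x in (𝒰 : Filter (EucSp n)),
      ∀ y, ‖y - w‖ ≤ θ → v x y ≤ Θ * ‖y‖ ^ (2 - p) - η := by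
    rintro w ⟨η, hη, hw⟩
    have hcont : Continuous fun y : EucSp n =>
        Θ * ‖y‖ ^ (2 - p) - C * ‖y - w‖ ^ (2 - p) := by
      have h1 : Continuous fun y : EucSp n => Θ * ‖y‖ ^ (2 - p) := by
        simpa using continuous_kernel hp2 (0 : EucSp n) Θ 0
      have h2 : Continuous fun y : EucSp n => C * ‖y - w‖ ^ (2 - p) := by
        simpa using continuous_kernel hp2 w C 0
      exact h1.sub h2
    have h3 := hcont.continuousAt.eventually_const_lt
      (show Θ * ‖w‖ ^ (2 - p) - η / 2 < Θ * ‖w‖ ^ (2 - p) - C * ‖w - w‖ ^ (2 - p) by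
        rw [sub_self, norm_zero, Real.zero_rpow hq.ne']; linarith)
    obtain ⟨θ, hθ, hball⟩ := Metric.nhds_basis_closedBall.eventually_iff.1 h3
    refine ⟨θ, hθ, η / 2, half_pos hη, ?_⟩
    filter_upwards [hw, hvhol (‖w‖ + θ + 1) (by positivity)] with x hx1 hx2 y hy
    have h4 := hball (show y ∈ Metric.closedBall w θ by rwa [Metric.mem_closedBall, dist_eq_norm])
    have hy2 : ‖y‖ ≤ ‖w‖ + θ + 1 := by
      have := norm_le_norm_add_norm_sub' y w
      linarith
    have h5 := (abs_le.1 (hx2 y w hy2 (by linarith))).2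
    linarith
  have hDopen : IsOpen D := by
    rw [Metric.isOpen_iff]
    intro w hw
    obtain ⟨θ, hθ, η, hη, h⟩ := hDunif w hw
    refine ⟨θ, hθ, fun y hy => ⟨η, hη, ?_⟩⟩
    filter_upwards [h] with x hx
    rw [Metric.mem_ball, dist_eq_norm] at hy
    exact hx y hy.le
  have hunit : ∀ y : EucSp n → EucSp n, (∀ᶠ x in (𝒰 : Filter (EucSp n)), ‖y x‖ = 1) →
      ∃ z : EucSp n, ‖z‖ = 1 ∧ ∀ η : ℝ, 0 < η →
        ∀ᶠ x in (𝒰 : Filter (EucSp n)), |v x (y x) - v x z| ≤ η := by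
    intro y hy
    obtain ⟨z, hz, hle⟩ := (isCompact_sphere (0 : EucSp n) 1).ultrafilter_le_nhds (𝒰.map y) (by
      rw [le_principal_iff, Ultrafilter.coe_map, mem_map]
      filter_upwards [hy] with x hx
      simpa using hx)
    have hz1 : ‖z‖ = 1 := by simpa using hz
    refine ⟨z, hz1, fun η hη => ?_⟩
    have hcont : Continuous fun y : EucSp n => C * ‖y - z‖ ^ (2 - p) := by
      simpa using continuous_kernel hp2 z C 0
    have h3 := hcont.continuousAt.eventually_lt_const
      (show C * ‖z - z‖ ^ (2 - p) < η by
        rw [sub_self, norm_zero, Real.zero_rpow hq.ne']; linarith)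
    have h4 : ∀ᶠ x in (𝒰 : Filter (EucSp n)), C * ‖y x - z‖ ^ (2 - p) < η := by
      rw [Ultrafilter.coe_map] at hle
      exact (show Tendsto y 𝒰 (𝓝 z) from hle).eventually h3
    filter_upwards [h4, hy, hvhol 1 one_pos] with x h5 h6 h7
    exact (h7 _ _ h6.le hz1.le).trans h5.le
  obtain ⟨e, he1, he2⟩ := hunit (fun x => ‖x - x₀‖⁻¹ • (x - x₀)) (by
    filter_upwards [hne] with x hx
    rw [norm_smul, norm_inv, norm_norm, inv_mul_cancel₀ (hpos x hx).ne'])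
  have heD : e ∈ D := by
    refine ⟨(Θ - a) / 2, by linarith, ?_⟩
    filter_upwards [he2 ((Θ - a) / 2) (by linarith), hbad, hne] with x hx1 hx2 hx3
    have h1 : v x (‖x - x₀‖⁻¹ • (x - x₀)) ≤ a := by
      simp only [hv]
      rw [smul_inv_smul₀ (hpos x hx3).ne', add_sub_cancel, ← div_eq_inv_mul]
      exact not_lt.1 hx2
    rw [he1, Real.one_rpow]
    linarith [(abs_le.1 hx1).1]
  have hmax : ∀ x : EucSp n, ∃ y : EucSp n, x ≠ x₀ → ‖x - x₀‖ ≤ R → ‖y‖ = 1 ∧ Θ ≤ v x y := by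
    intro x
    by_cases hx : x ≠ x₀ ∧ ‖x - x₀‖ ≤ R
    · have hx0 := hpos x hx.1
      obtain ⟨y, hy, hyu⟩ := hd _ hx0 hx.2
      refine ⟨‖x - x₀‖⁻¹ • (y - x₀), fun _ _ => ⟨?_, ?_⟩⟩
      · rw [norm_smul, norm_inv, norm_norm, hy, inv_mul_cancel₀ hx0.ne']
      · simp only [hv]
        rw [smul_inv_smul₀ hx0.ne', add_sub_cancel, ← div_eq_inv_mul,
          le_div_iff₀ (Real.rpow_pos_of_pos hx0 _)]
        linarith
    · exact ⟨0, fun h1 h2 => absurd ⟨h1, h2⟩ hx⟩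
  choose y hy using hmax
  have hyev : ∀ᶠ x in (𝒰 : Filter (EucSp n)), ‖y x‖ = 1 ∧ Θ ≤ v x (y x) := by
    filter_upwards [hne, hT.eventually_lt_const hR] with x h1 h2 using hy x h1 h2.le
  obtain ⟨m, hm1, hm2⟩ := hunit y (hyev.mono fun x hx => hx.1)
  have hmD : m ∉ D := by
    rintro ⟨η, hη, h⟩
    obtain ⟨x, ⟨h1, h2⟩, h3⟩ := ((h.and hyev).and (hm2 (η / 2) (half_pos hη))).exists
    rw [hm1, Real.one_rpow] at h1
    linarith [(abs_le.1 h3).2]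
  refine hmD ?_
  have hconn : IsPreconnected ({0}ᶜ : Set (EucSp n)) := by
    refine (isConnected_compl_singleton_of_one_lt_rank ?_ 0).isPreconnected
    rw [← Module.finrank_eq_rank, finrank_euclideanSpace_fin]
    exact_mod_cast hn2
  have h1norm : ∀ y : EucSp n, ‖y‖ = 1 → y ∈ ({0}ᶜ : Set (EucSp n)) := by
    rintro y hy rfl
    simp at hy
  refine hconn.subset_of_closure_inter_subset hDopen ⟨e, h1norm e he1, heD⟩ ?_ (h1norm m hm1)
  rintro z ⟨hzD, hz0⟩
  have hz : 0 < ‖z‖ := norm_pos_iff.2 hz0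
  obtain ⟨w, hwD, hwz⟩ := Metric.mem_closure_iff.1 hzD (‖z‖ / 4) (by positivity)
  rw [dist_eq_norm] at hwz
  have hw : 3 / 4 * ‖z‖ < ‖w‖ := by
    have := norm_sub_norm_le z w
    linarith
  obtain ⟨θ, hθ, η, hη, hw2⟩ := hDunif w hwD
  obtain ⟨ε, hε, κ, hκ, hdec⟩ := hopf_decay hconv hinv hp1 hp2 hchar (w := w) (z := z)
    (ρ := ‖z‖ / 2) (Θ := Θ) hθ hη (by linarith) (by linarith)
  refine ⟨κ, hκ, ?_⟩
  have hwL : ∀ y, ‖y - w‖ ≤ ‖z‖ / 2 → ‖y‖ ≤ ‖w‖ + ‖z‖ / 2 := by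
    intro y hy
    have := norm_le_norm_add_norm_sub' y w
    linarith
  filter_upwards [hw2, hvup (‖w‖ + ‖z‖ / 2) (by positivity) ε hε,
    hsmall (‖w‖ + ‖z‖ / 2) (by positivity) R hR] with x hx1 hx2 hx3
  refine hdec (v x) ?_ ?_ (fun y hy => hx2 y (hwL y hy.le)) hx1
  · refine continuousOn_const.mul (ContinuousOn.sub (hu.comp (by fun_prop) ?_) continuousOn_const)
    intro y hy
    rw [Metric.mem_closedBall, dist_eq_norm] at hy ⊢
    exact (hx3.2 y (hwL y hy)).le
  · refine (hS.comp_scaling hx3.1 (inv_pos.2 (Real.rpow_pos_of_pos hx3.1 _))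
      (u x₀) x₀).mono_set fun y hy => ?_
    rw [Metric.mem_ball, dist_eq_norm] at hy
    refine ⟨?_, ?_⟩
    · rw [Metric.mem_ball, dist_eq_norm]
      exact hx3.2 y (hwL y hy.le)
    · intro h
      rw [Set.mem_singleton_iff, add_eq_left, smul_eq_zero] at h
      rcases h with h | h
      · exact hx3.1.ne' h
      · rw [h, zero_sub, norm_neg] at hy
        linarith

/-! ### Half-spaces containing a convex cone subequation -/

/-- The linear functional on symmetric matrices with coefficients `β`. -/
def pairing (β : Fin n → Fin n → ℝ) (A : SymMat n) : ℝ := ∑ i, ∑ j, β i j * A.1 i j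

@[simp] lemma pairing_add (β : Fin n → Fin n → ℝ) (A B : SymMat n) :
    pairing β (A + B) = pairing β A + pairing β B := by
  simp [pairing, mul_add, Finset.sum_add_distrib]

@[simp] lemma pairing_neg (β : Fin n → Fin n → ℝ) (A : SymMat n) :
    pairing β (-A) = -pairing β A := by
  simp [pairing]

@[simp] lemma pairing_sub (β : Fin n → Fin n → ℝ) (A B : SymMat n) :
    pairing β (A - B) = pairing β A - pairing β B := by
  rw [sub_eq_add_neg, pairing_add, pairing_neg]; ring

@[simp] lemma pairing_smul (β : Fin n → Fin n → ℝ) (c : ℝ) (A : SymMat n) :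
    pairing β (c • A) = c * pairing β A := by
  simp only [pairing, Finset.mul_sum]
  refine Finset.sum_congr rfl fun i _ => Finset.sum_congr rfl fun j _ => ?_
  simp
  ring

@[simp] lemma pairing_zero (β : Fin n → Fin n → ℝ) : pairing β 0 = 0 := by
  simp [pairing]

/-- The subequation `G` is the half-space `{A | 0 ≤ ⟨β, A⟩}`. -/
structure IsHalfSpace (G : ConeSubequation n) (β : Fin n → Fin n → ℝ) : Prop where
  one_pos : 0 < pairing β 1
  mem_iff : ∀ A, A ∈ G.carrier ↔ 0 ≤ pairing β A

lemma exists_halfSpace {F : ConeSubequation n} (hconv : Convex ℝ F.carrier) {A : SymMat n}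
    (hA : A ∉ F.carrier) : ∃ (G : ConeSubequation n) (β : Fin n → Fin n → ℝ),
      IsHalfSpace G β ∧ F.carrier ⊆ G.carrier ∧ pairing β A < 0 := by
  let ι : SymMat n → (Fin n → Fin n → ℝ) := fun A i j => A.1 i j
  have hclosed : IsClosed (ι '' F.carrier) := by
    have hsa : IsClosed {A : Matrix (Fin n) (Fin n) ℝ | star A = A} :=
      isClosed_eq continuous_star continuous_id
    have h1 : IsClosed (Subtype.val '' F.carrier : Set (Matrix (Fin n) (Fin n) ℝ)) :=
      hsa.isClosedEmbedding_subtypeVal.isClosedMap _ F.isClosed'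
    exact h1
  have hcv : Convex ℝ (ι '' F.carrier) := by
    rintro _ ⟨B, hB, rfl⟩ _ ⟨C, hC, rfl⟩ a b ha hb hab
    exact ⟨_, hconv hB hC ha hb hab, rfl⟩
  have hnot : ι A ∉ ι '' F.carrier := by
    rintro ⟨B, hB, h⟩
    have : B = A := by
      apply Subtype.ext
      ext i j
      exact congrFun (congrFun h i) j
    exact hA (this ▸ hB)
  obtain ⟨f, s, hfA, hf⟩ := geometric_hahn_banach_point_closed hcv hclosed hnot
  set β : Fin n → Fin n → ℝ := fun i j => f (Pi.single i (Pi.single j 1)) with hβ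
  have hpair : ∀ B, pairing β B = f (ι B) := by
    intro B
    have : ι B = ∑ i, ∑ j, B.1 i j • (Pi.single i (Pi.single j (1 : ℝ)) : Fin n → Fin n → ℝ) := by
      ext k l
      rw [Finset.sum_apply, Finset.sum_apply, Finset.sum_eq_single k]
      · rw [Finset.sum_apply, Finset.sum_apply, Finset.sum_eq_single l]
        · simp [ι]
        · intro j _ hj
          simp [hj.symm]
        · simp
      · intro i _ hi
        rw [Finset.sum_apply, Finset.sum_apply]
        exact Finset.sum_eq_zero fun j _ => by simp [hi.symm]
      · simp
    rw [this]
    simp only [map_sum, map_smul, pairing, hβ, smul_eq_mul]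
    exact Finset.sum_congr rfl fun i _ => Finset.sum_congr rfl fun j _ => mul_comm _ _
  have hs : s < 0 := by
    have := hf _ ⟨0, F.zero_mem, rfl⟩
    rwa [← hpair, pairing_zero] at this
  have hnonneg : ∀ B ∈ F.carrier, 0 ≤ pairing β B := by
    intro B hB
    by_contra! hlt
    have h1 := hf _ ⟨_, F.smul_mem hB (show 0 ≤ s / pairing β B from
      (div_pos_of_neg_of_neg hs hlt).le), rfl⟩
    rw [← hpair, pairing_smul, div_mul_cancel₀ _ hlt.ne] at h1
    exact lt_irrefl _ h1
  have hAneg : pairing β A < 0 := by rw [hpair]; exact hfA.trans hs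
  have hone : 0 < pairing β 1 := by
    obtain ⟨C, hC, h⟩ := exists_qf_bound A
    have h2 : A + C • 1 ∈ F.carrier := F.mem_of_nonneg fun x => by
      have := (abs_le.1 (h x)).1
      simp only [qf_add, qf_smul, qf_one]
      linarith
    have h3 := hnonneg _ h2
    simp only [pairing_add, pairing_smul] at h3
    by_contra! h4
    nlinarith
  refine ⟨⟨{B | 0 ≤ pairing β B}, ⟨0, by simp⟩, fun h => ?_, ?_, fun B hB P hP => ?_,
    fun B hB t ht => ?_⟩, β, ⟨hone, fun _ => Iff.rfl⟩, hnonneg, hAneg⟩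
  · exact absurd (h ▸ Set.mem_univ A : A ∈ {B | 0 ≤ pairing β B}) (not_le.2 hAneg)
  · refine isClosed_le continuous_const ?_
    unfold pairing
    refine continuous_finsetSum _ fun i _ => continuous_finsetSum _ fun j _ => ?_
    exact continuous_const.mul ((continuous_subtype_val).matrix_elem i j)
  · have : P ∈ F.carrier := by
      have := F.f1 0 F.zero_mem P hP
      rwa [zero_add] at this
    have h1 := hnonneg P this
    simp only [Set.mem_ofPred_eq, pairing_add] at *
    linarith
  · simp only [Set.mem_ofPred_eq, pairing_smul] at *
    positivity

/-! ### Polynomial solutions of the constant coefficient equation `⟨β, D²h⟩ = 0` -/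

/-- `h` is a continuous classical solution of `⟨β, D²h⟩ = 0`. -/
def Harm (β : Fin n → Fin n → ℝ) (h : EucSp n → ℝ) : Prop :=
  Continuous h ∧ ∀ x, ∃ b A, Taylor2 h x b A ∧ pairing β A = 0

namespace Harm

variable {β : Fin n → Fin n → ℝ} {g h : EucSp n → ℝ}

lemma add (hg : Harm β g) (hh : Harm β h) : Harm β fun y => g y + h y := by
  refine ⟨hg.1.add hh.1, fun x => ?_⟩
  obtain ⟨b, A, h1, h2⟩ := hg.2 x
  obtain ⟨c, B, h3, h4⟩ := hh.2 x
  exact ⟨_, _, h1.add h3, by simp [h2, h4]⟩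

lemma const_mul (hh : Harm β h) (k : ℝ) : Harm β fun y => k * h y := by
  refine ⟨continuous_const.mul hh.1, fun x => ?_⟩
  obtain ⟨b, A, h1, h2⟩ := hh.2 x
  exact ⟨_, _, h1.const_mul k, by simp [h2]⟩

lemma add_const (hh : Harm β h) (k : ℝ) : Harm β fun y => h y + k := by
  refine ⟨hh.1.add continuous_const, fun x => ?_⟩
  obtain ⟨b, A, h1, h2⟩ := hh.2 x
  exact ⟨_, _, h1.add_const k, h2⟩

end Harm

lemma IsHalfSpace.le_harm {G : ConeSubequation n} {β : Fin n → Fin n → ℝ} (hG : IsHalfSpace G β)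
    {u h : EucSp n → ℝ} {z : EucSp n} {r : ℝ} (hu : ContinuousOn u (Metric.closedBall z r))
    (hS : SubQ G.carrier (Metric.ball z r) u) (hh : Harm β h)
    (hle : ∀ x ∈ Metric.sphere z r, u x ≤ h x) : ∀ x ∈ Metric.closedBall z r, u x ≤ h x := by
  refine max_principle (isCompact_closedBall z r) Metric.ball_subset_closedBall Metric.isOpen_ball
    hu hh.1.continuousOn hS (fun x hx => hle x ?_) fun x _ => ?_
  · rw [Metric.closedBall_sdiff_ball] at hx
    exact hx
  · obtain ⟨b, A, h1, h2⟩ := hh.2 x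
    refine ⟨b, A, h1, fun δ hδ => ?_⟩
    rw [hG.mem_iff, pairing_sub, pairing_smul, h2, not_le]
    have := mul_pos hδ hG.one_pos
    linarith

lemma Harm.subQ {G : ConeSubequation n} {β : Fin n → Fin n → ℝ} (hG : IsHalfSpace G β)
    {h : EucSp n → ℝ} (hh : Harm β h) (X : Set (EucSp n)) : SubQ G.carrier X h :=
  subQ_of_taylor2 fun x _ => by
    obtain ⟨b, A, h1, h2⟩ := hh.2 x
    exact ⟨b, A, (hG.mem_iff A).2 h2.ge, h1⟩

lemma exists_symMat_outer (b c : EucSp n) :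
    ∃ M : SymMat n, (∀ i j, M.1 i j = b i * c j + b j * c i) ∧
      ∀ h, qf M h = 2 * inner ℝ b h * inner ℝ c h := by
  refine ⟨⟨Matrix.of fun i j => b i * c j + b j * c i, ?_⟩, fun i j => rfl, fun h => ?_⟩
  · rw [selfAdjoint.mem_iff]
    ext i j
    simp [Matrix.star_apply, add_comm]
  · have e : ∀ v : EucSp n, inner ℝ v h = ∑ i, v i * h i := fun v => by
      simp [PiLp.inner_apply, mul_comm]
    have e1 : (∑ i, b i * h i) * (∑ i, c i * h i) = ∑ i, ∑ j, b i * c j * h i * h j := by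
      rw [Finset.sum_mul_sum]
      exact Finset.sum_congr rfl fun i _ => Finset.sum_congr rfl fun j _ => by ring
    have e2 : (∑ i, b i * h i) * (∑ i, c i * h i) = ∑ i, ∑ j, b j * c i * h i * h j := by
      rw [mul_comm, Finset.sum_mul_sum]
      exact Finset.sum_congr rfl fun i _ => Finset.sum_congr rfl fun j _ => by ring
    rw [mul_assoc, e, e, two_mul]
    nth_rewrite 1 [e1]
    rw [e2]
    simp only [qf, Matrix.of_apply, ← Finset.sum_add_distrib]
    exact Finset.sum_congr rfl fun i _ => Finset.sum_congr rfl fun j _ => by ring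

open MvPolynomial in
lemma taylor2_eval (q : MvPolynomial (Fin n) ℝ) (x : EucSp n) :
    ∃ b A, Taylor2 (fun y : EucSp n => eval (fun i => y i) q) x b A ∧
      (∀ i, b i = eval (fun i => x i) (pderiv i q)) ∧
      ∀ i j, A.1 i j = eval (fun i => x i) (pderiv i (pderiv j q)) := by
  induction q using MvPolynomial.induction_on with
  | C a =>
    refine ⟨0, 0, by simpa using Taylor2.const a x, by simp, by simp⟩
  | add p q hp hq =>
    obtain ⟨b, A, h1, h2, h3⟩ := hp
    obtain ⟨c, B, h4, h5, h6⟩ := hq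
    exact ⟨b + c, A + B, by simpa using h1.add h4, fun i => by simp [h2, h5],
      fun i j => by simp [h3, h6]⟩
  | mul_X p k hp =>
    obtain ⟨b, A, h1, h2, h3⟩ := hp
    have hX : Taylor2 (fun y : EucSp n => y k) x (EuclideanSpace.single k 1) 0 := by
      have := Taylor2.quadratic (EuclideanSpace.single k (1 : ℝ)) x x (0 : SymMat n)
      simpa [EuclideanSpace.inner_single_left] using this
    obtain ⟨M, hM1, hM2⟩ := exists_symMat_outer b (EuclideanSpace.single k (1 : ℝ))
    refine ⟨_, x k • A + M, by
      simpa using h1.mul hX (M := x k • A + M) (by intro h; simp [hM2]), ?_, ?_⟩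
    · intro i
      by_cases hik : i = k
      · subst hik
        simp [h2, mul_comm]
      · simp [h2, Ne.symm hik, mul_comm, hik]
    · intro i j
      by_cases hik : i = k <;> by_cases hjk : j = k
      · subst hik; subst hjk
        simp [hM1, h2, h3]
        ring
      · subst hik
        simp [hM1, h2, h3, hjk, Ne.symm hjk, mul_comm]
      · subst hjk
        simp [hM1, h2, h3, hik, Ne.symm hik]
        ring
      · simp [hM1, h3, hik, Ne.symm hik, hjk, Ne.symm hjk, mul_comm]

lemma totalDegree_pderiv_le (i : Fin n) (q : MvPolynomial (Fin n) ℝ) :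
    (MvPolynomial.pderiv i q).totalDegree ≤ q.totalDegree - 1 := by
  refine Finset.sup_le fun m hm => ?_
  have h1 : MvPolynomial.coeff (m + Finsupp.single i 1) q ≠ 0 := by
    rw [MvPolynomial.mem_support_iff, MvPolynomial.coeff_pderiv] at hm
    exact left_ne_zero_of_mul hm
  have h2 := MvPolynomial.le_totalDegree (MvPolynomial.mem_support_iff.2 h1)
  rw [Finsupp.sum_add_index' (by simp) (by simp), Finsupp.sum_single_index rfl] at h2
  omega

/-- The operator `q ↦ ⟨β, D²q⟩` on polynomials. -/
def polyOp (β : Fin n → Fin n → ℝ) : MvPolynomial (Fin n) ℝ →ₗ[ℝ] MvPolynomial (Fin n) ℝ :=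
  ∑ i, ∑ j, β i j • ((MvPolynomial.pderiv i).toLinearMap ∘ₗ (MvPolynomial.pderiv j).toLinearMap)

lemma polyOp_apply (β : Fin n → Fin n → ℝ) (q : MvPolynomial (Fin n) ℝ) :
    polyOp β q = ∑ i, ∑ j, β i j • MvPolynomial.pderiv i (MvPolynomial.pderiv j q) := by
  simp [polyOp]

lemma totalDegree_polyOp_le (β : Fin n → Fin n → ℝ) (q : MvPolynomial (Fin n) ℝ) :
    (polyOp β q).totalDegree ≤ q.totalDegree - 2 := by
  rw [polyOp_apply]
  refine MvPolynomial.totalDegree_finsetSum_le fun i _ =>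
    MvPolynomial.totalDegree_finsetSum_le fun j _ => ?_
  refine (MvPolynomial.totalDegree_smul_le _ _).trans ?_
  have h1 := totalDegree_pderiv_le i (MvPolynomial.pderiv j q)
  have h2 := totalDegree_pderiv_le j q
  omega

lemma harm_eval {β : Fin n → Fin n → ℝ} {q : MvPolynomial (Fin n) ℝ} (hq : polyOp β q = 0) :
    Harm β fun y : EucSp n => MvPolynomial.eval (fun i => y i) q := by
  refine ⟨(MvPolynomial.continuous_eval q).comp (PiLp.continuous_ofLp 2 _), fun x => ?_⟩
  obtain ⟨b, A, h1, -, h2⟩ := taylor2_eval q x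
  refine ⟨b, A, h1, ?_⟩
  have h3 := congrArg (MvPolynomial.eval fun i => x i) hq
  rw [polyOp_apply] at h3
  simpa [pairing, h2, map_sum] using h3

/-- The polynomial `r² - |x|²`. -/
def ballPoly (n : ℕ) (r : ℝ) : MvPolynomial (Fin n) ℝ :=
  MvPolynomial.C (r ^ 2) - ∑ i, MvPolynomial.X i ^ 2

lemma eval_ballPoly (r : ℝ) (x : EucSp n) :
    MvPolynomial.eval (fun i => x i) (ballPoly n r) = r ^ 2 - ‖x‖ ^ 2 := by
  simp [ballPoly, EuclideanSpace.norm_sq_eq]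

lemma totalDegree_ballPoly_le (r : ℝ) : (ballPoly n r).totalDegree ≤ 2 := by
  refine (MvPolynomial.totalDegree_sub _ _).trans (max_le ?_ ?_)
  · rw [MvPolynomial.totalDegree_C]
    exact Nat.zero_le _
  · exact MvPolynomial.totalDegree_finsetSum_le fun i _ => by simp

lemma IsHalfSpace.polyOp_injective {G : ConeSubequation n} {β : Fin n → Fin n → ℝ}
    (hG : IsHalfSpace G β) {r : ℝ} (hr : 0 < r) {q : MvPolynomial (Fin n) ℝ}
    (hq : polyOp β (ballPoly n r * q) = 0) : q = 0 := by
  have hh := harm_eval hq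
  set h : EucSp n → ℝ := fun y => MvPolynomial.eval (fun i => y i) (ballPoly n r * q) with hdef
  have hsph : ∀ x ∈ Metric.sphere (0 : EucSp n) r, h x = 0 := by
    intro x hx
    rw [mem_sphere_zero_iff_norm] at hx
    simp [hdef, eval_ballPoly, hx]
  have hconst : Harm β fun _ : EucSp n => (0 : ℝ) :=
    ⟨continuous_const, fun x => ⟨0, 0, Taylor2.const 0 x, by simp⟩⟩
  have hle := hG.le_harm (z := 0) (r := r) hh.1.continuousOn (hh.subQ hG _) hconst
    fun x hx => (hsph x hx).le
  have hge := hG.le_harm (z := 0) (r := r) hconst.1.continuousOn (hconst.subQ hG _) hh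
    fun x hx => (hsph x hx).ge
  have hr' : 0 < r / (n + 1) := by positivity
  refine MvPolynomial.funext_set (fun _ => Set.Ioo 0 (r / (n + 1)))
    (fun _ => Set.Ioo_infinite hr') fun y hy => ?_
  set x : EucSp n := WithLp.toLp 2 y with hx
  have hnorm : ‖x‖ ^ 2 < r ^ 2 := by
    have h1 : ‖x‖ ^ 2 ≤ ∑ _i : Fin n, (r / (n + 1)) ^ 2 := by
      rw [EuclideanSpace.norm_sq_eq]
      refine Finset.sum_le_sum fun i _ => ?_
      have := hy i (Set.mem_univ i)
      simp only [hx, Real.norm_eq_abs, sq_abs]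
      exact pow_le_pow_left₀ this.1.le this.2.le 2
    refine h1.trans_lt ?_
    rw [Finset.sum_const, Finset.card_univ, Fintype.card_fin, nsmul_eq_mul, div_pow,
      ← mul_div_assoc, div_lt_iff₀ (by positivity)]
    nlinarith [sq_nonneg (n : ℝ), (Nat.cast_nonneg n : (0 : ℝ) ≤ n), sq_pos_of_pos hr]
  have hxr : x ∈ Metric.closedBall (0 : EucSp n) r := by
    rw [mem_closedBall_zero_iff]
    exact (lt_of_pow_lt_pow_left₀ 2 hr.le hnorm).le
  have h0 : h x = 0 := le_antisymm (hle x hxr) (hge x hxr)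
  simp only [hdef, map_mul, eval_ballPoly] at h0
  rw [map_zero]
  exact (mul_eq_zero.1 h0).resolve_left (by linarith)

lemma IsHalfSpace.exists_harm_eq {G : ConeSubequation n} {β : Fin n → Fin n → ℝ}
    (hG : IsHalfSpace G β) {r : ℝ} (hr : 0 < r) (P : MvPolynomial (Fin n) ℝ) :
    ∃ h, Harm β h ∧ ∀ x ∈ Metric.sphere (0 : EucSp n) r,
      h x = MvPolynomial.eval (fun i => x i) P := by
  let V := MvPolynomial.restrictTotalDegree (Fin n) ℝ P.totalDegree
  have hmaps : ∀ q ∈ V, (polyOp β ∘ₗ LinearMap.mulLeft ℝ (ballPoly n r)) q ∈ V := by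
    intro q hq
    rw [MvPolynomial.mem_restrictTotalDegree] at hq ⊢
    have h1 := totalDegree_polyOp_le β (ballPoly n r * q)
    have h2 := MvPolynomial.totalDegree_mul (ballPoly n r) q
    have h3 := totalDegree_ballPoly_le (n := n) r
    simp only [LinearMap.comp_apply, LinearMap.mulLeft_apply]
    omega
  let T : V →ₗ[ℝ] V := (polyOp β ∘ₗ LinearMap.mulLeft ℝ (ballPoly n r)).restrict hmaps
  have hinj : Function.Injective T := by
    rw [injective_iff_map_eq_zero]
    intro q hq
    exact Subtype.ext (hG.polyOp_injective hr (congrArg Subtype.val hq))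
  have hsurj := LinearMap.injective_iff_surjective.1 hinj
  have hP : polyOp β P ∈ V := by
    rw [MvPolynomial.mem_restrictTotalDegree]
    exact (totalDegree_polyOp_le β P).trans (Nat.sub_le _ _)
  obtain ⟨q, hq⟩ := hsurj ⟨_, hP⟩
  have hq' : polyOp β (ballPoly n r * q) = polyOp β P := congrArg Subtype.val hq
  refine ⟨_, harm_eval (q := P - ballPoly n r * q.1) (by rw [map_sub, hq', sub_self]),
    fun x hx => ?_⟩
  rw [mem_sphere_zero_iff_norm] at hx
  simp [eval_ballPoly, hx]

lemma IsHalfSpace.exists_harm_near {G : ConeSubequation n} {β : Fin n → Fin n → ℝ}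
    (hG : IsHalfSpace G β) {r : ℝ} (hr : 0 < r) {g : EucSp n → ℝ}
    (hg : ContinuousOn g (Metric.sphere 0 r)) {ε : ℝ} (hε : 0 < ε) :
    ∃ h, Harm β h ∧ ∀ x ∈ Metric.sphere (0 : EucSp n) r, |h x - g x| < ε := by
  let coord : Fin n → C(Metric.sphere (0 : EucSp n) r, ℝ) := fun i =>
    ⟨fun x => x.1 i, by fun_prop⟩
  let A : Subalgebra ℝ C(Metric.sphere (0 : EucSp n) r, ℝ) := (MvPolynomial.aeval coord).range
  have hsep : A.SeparatesPoints := by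
    intro x y hxy
    obtain ⟨i, hi⟩ : ∃ i, x.1 i ≠ y.1 i := by
      by_contra! h
      exact hxy (Subtype.ext (PiLp.ext h))
    exact ⟨coord i, ⟨coord i, ⟨MvPolynomial.X i, by simp⟩, rfl⟩, hi⟩
  obtain ⟨⟨f, P, hP⟩, hf⟩ :=
    ContinuousMap.exists_mem_subalgebra_near_continuous_of_separatesPoints A hsep
      ((Metric.sphere (0 : EucSp n) r).domRestrict g) hg.domRestrict ε hε
  obtain ⟨h, hh, hhP⟩ := hG.exists_harm_eq hr P
  refine ⟨h, hh, fun x hx => ?_⟩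
  have h1 := hf ⟨x, hx⟩
  have h2 : f ⟨x, hx⟩ = MvPolynomial.eval (fun i => x i) P := by
    rw [← hP]
    rw [← MvPolynomial.coe_aeval_eq_eval]
    exact (MvPolynomial.comp_aeval_apply coord (ContinuousMap.evalAlgHom ℝ ℝ ⟨x, hx⟩) P)
  rw [hhP x hx, ← h2]
  exact h1

/-! ### Smooth approximation of subharmonic functions for convex subequations -/

/-- Continuous functions on a ball whose central value is dominated by that of every solution of
`⟨β, D²h⟩ = 0` dominating them on the sphere. -/
def subMeanSet (β : Fin n → Fin n → ℝ) {r : ℝ} (hr : 0 < r) :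
    Set C(Metric.closedBall (0 : EucSp n) r, ℝ) :=
  {g | ∀ h, Harm β h → (∀ y : Metric.closedBall (0 : EucSp n) r, ‖y.1‖ = r → g y ≤ h y) →
    g ⟨0, Metric.mem_closedBall_self hr.le⟩ ≤ h 0}

lemma isClosed_subMeanSet (β : Fin n → Fin n → ℝ) {r : ℝ} (hr : 0 < r) :
    IsClosed (subMeanSet β hr) := by
  refine isClosed_of_closure_subset fun g hg h hh hle => le_of_forall_pos_le_add fun ε hε => ?_
  obtain ⟨g', hg', hd⟩ := Metric.mem_closure_iff.1 hg (ε / 2) (half_pos hε)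
  have hpt : ∀ y, |g y - g' y| ≤ ε / 2 := fun y =>
    (ContinuousMap.dist_apply_le_dist (f := g) (g := g') y).trans hd.le
  have h1 := hg' (fun y => h y + ε / 2) (hh.add_const _) fun y hy => by
    have := hle y hy
    have := (abs_le.1 (hpt y)).1
    linarith
  have h2 := (abs_le.1 (hpt ⟨0, Metric.mem_closedBall_self hr.le⟩)).2
  linarith

lemma IsHalfSpace.convex_subMeanSet {G : ConeSubequation n} {β : Fin n → Fin n → ℝ}
    (hG : IsHalfSpace G β) {r : ℝ} (hr : 0 < r) : Convex ℝ (subMeanSet β hr) := by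
  have key : ∀ g ∈ subMeanSet β hr, ∀ ε : ℝ, 0 < ε → ∃ h, Harm β h ∧
      (∀ y : Metric.closedBall (0 : EucSp n) r, ‖y.1‖ = r → |h y - g y| < ε) ∧
      g ⟨0, Metric.mem_closedBall_self hr.le⟩ ≤ h 0 + ε := by
    intro g hg ε hε
    obtain ⟨g', hg'⟩ := ContinuousMap.exists_restrict_eq Metric.isClosed_closedBall g
    have he : ∀ y, g' y.1 = g y := fun y => by rw [← hg']; rfl
    obtain ⟨h, hh, hd⟩ := hG.exists_harm_near hr (g := g') g'.continuous.continuousOn hε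
    have hd' : ∀ y : Metric.closedBall (0 : EucSp n) r, ‖y.1‖ = r → |h y - g y| < ε := by
      intro y hy
      rw [← he]
      exact hd y (mem_sphere_zero_iff_norm.2 hy)
    refine ⟨h, hh, hd', ?_⟩
    refine hg (fun y => h y + ε) (hh.add_const ε) fun y hy => ?_
    have := (abs_lt.1 (hd' y hy)).1
    linarith
  intro g₁ h₁ g₂ h₂ a b ha hb hab h hh hle
  refine le_of_forall_pos_le_add fun ε hε => ?_
  obtain ⟨k₁, hk₁, hd₁, hc₁⟩ := key g₁ h₁ (ε / 2) (half_pos hε)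
  obtain ⟨k₂, hk₂, hd₂, hc₂⟩ := key g₂ h₂ (ε / 2) (half_pos hε)
  have hk := (hk₁.const_mul a).add (hk₂.const_mul b)
  have h1 := hG.le_harm (z := 0) (r := r) hk.1.continuousOn (hk.subQ hG _)
    (hh.add_const (ε / 2)) (fun x hx => by
      rw [mem_sphere_zero_iff_norm] at hx
      have hxr : x ∈ Metric.closedBall (0 : EucSp n) r := by
        rw [mem_closedBall_zero_iff, hx]
      have e1 := (abs_lt.1 (hd₁ ⟨x, hxr⟩ hx)).2
      have e2 := (abs_lt.1 (hd₂ ⟨x, hxr⟩ hx)).2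
      have e3 : a * g₁ ⟨x, hxr⟩ + b * g₂ ⟨x, hxr⟩ ≤ h x := hle ⟨x, hxr⟩ hx
      have e4 : b = 1 - a := by linarith
      subst e4
      simp only at e1 e2
      nlinarith) 0 (Metric.mem_closedBall_self hr.le)
  change a * g₁ ⟨0, Metric.mem_closedBall_self hr.le⟩ +
    b * g₂ ⟨0, Metric.mem_closedBall_self hr.le⟩ ≤ h 0 + ε
  have e4 : b = 1 - a := by linarith
  subst e4
  nlinarith

lemma IsHalfSpace.pairing_nonneg_of_subMean {G : ConeSubequation n} {β : Fin n → Fin n → ℝ}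
    (hG : IsHalfSpace G β) {w : EucSp n → ℝ} {x b : EucSp n} {A : SymMat n}
    (hw : Taylor2 w x b A) {R : ℝ} (hR : 0 < R)
    (hmean : ∀ r, 0 < r → r < R → ∀ h, Harm β h → (∀ y, ‖y‖ = r → w (x + y) ≤ h y) → w x ≤ h 0) :
    0 ≤ pairing β A := by
  by_contra! hneg
  set m : ℝ := -pairing β A / pairing β 1 with hm
  have hm0 : 0 < m := div_pos (neg_pos.2 hneg) hG.one_pos
  have hB : pairing β (A + m • 1) = 0 := by
    have := hG.one_pos.ne'
    simp only [pairing_add, pairing_smul, hm]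
    field_simp
    ring
  obtain ⟨s, hs, hs'⟩ := Metric.eventually_nhds_iff.1 (hw.eventually_le (half_pos hm0))
  set r : ℝ := min R s / 2 with hr
  have hr0 : 0 < r := half_pos (lt_min hR hs)
  have hrR : r < R := (half_lt_self (lt_min hR hs)).trans_le (min_le_left _ _)
  have hrs : r < s := (half_lt_self (lt_min hR hs)).trans_le (min_le_right _ _)
  have hh : Harm β fun y => inner ℝ b y + qf (A + m • 1) (y - 0) / 2 + (w x - m / 4 * r ^ 2) := by
    refine Harm.add_const ⟨?_, fun y => ⟨_, _, Taylor2.quadratic b y 0 _, hB⟩⟩ _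
    refine (continuous_const.inner continuous_id).add ((Continuous.div_const ?_ 2))
    unfold qf
    fun_prop
  have h1 := hmean r hr0 hrR _ hh fun y hy => by
    have := hs' (y := y) (by rw [dist_zero_right, hy]; exact hrs)
    simp only [sub_zero, qf_add, qf_smul, qf_one, hy] at this ⊢
    linarith
  have h0 : qf (A + m • 1) (0 : EucSp n) = 0 := qf_zero_right _
  simp only [sub_zero, inner_zero_right, h0] at h1
  have : 0 < m / 4 * r ^ 2 := by positivity
  linarith

open MeasureTheory in
lemma exists_smooth_approx {F : ConeSubequation n} (hconv : Convex ℝ F.carrier)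
    {X K : Set (EucSp n)} (hX : IsOpen X) (hK : IsCompact K) (hKX : K ⊆ X) {u : EucSp n → ℝ}
    (hu : ContinuousOn u X) (hS : SubQ F.carrier X u) {ε : ℝ} (hε : 0 < ε) :
    ∃ w : EucSp n → ℝ, Continuous w ∧ ∀ x ∈ K, |w x - u x| ≤ ε ∧
      ∃ b A, Taylor2 w x b A ∧ A ∈ F.carrier := by
  obtain ⟨δ, hδ, hδX⟩ := hK.exists_cthickening_subset_open hX hKX
  obtain ⟨v, hv⟩ := ContinuousMap.exists_restrict_eq (Metric.isClosed_cthickening (δ := δ) (E := K))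
    ⟨(Metric.cthickening δ K).domRestrict u, (hu.mono hδX).domRestrict⟩
  have hvu : ∀ x ∈ Metric.cthickening δ K, v x = u x := fun x hx =>
    congrArg (fun f : C(Metric.cthickening δ K, ℝ) => f ⟨x, hx⟩) hv
  obtain ⟨η₀, hη₀, hunif⟩ := Metric.mem_uniformity_dist.1
    (hK.uniformContinuousAt_of_continuousAt v (fun a _ => v.continuous.continuousAt)
      (Metric.dist_mem_uniformity hε))
  set η : ℝ := min η₀ (δ / 2) with hη
  have hη0 : 0 < η := lt_min hη₀ (half_pos hδ)
  let φ : ContDiffBump (0 : EucSp n) := ⟨η / 2, η, half_pos hη0, half_lt_self hη0⟩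
  let ψ : EucSp n → ℝ := φ.normed volume
  let w : EucSp n → ℝ := MeasureTheory.convolution ψ v (ContinuousLinearMap.lsmul ℝ ℝ) volume
  have hw : ContDiff ℝ 2 w :=
    φ.hasCompactSupport_normed.contDiff_convolution_left _ (φ.contDiff_normed (n := 2))
      v.continuous.locallyIntegrable
  refine ⟨w, hw.continuous, fun x hx => ⟨?_, ?_⟩⟩
  · rw [← hvu x (Metric.self_subset_cthickening K hx), ← Real.dist_eq]
    refine φ.dist_normed_convolution_le v.continuous.aestronglyMeasurable fun y hy => ?_
    rw [dist_comm]
    refine (hunif (a := x) (b := y) ?_ hx).le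
    rw [dist_comm]
    exact (Metric.mem_ball.1 hy).trans_le (min_le_left _ _)
  · refine ⟨_, symHess w x, taylor2_of_contDiffAt hw.contDiffAt, ?_⟩
    by_contra hA
    obtain ⟨G, β, hG, hFG, hneg⟩ := exists_halfSpace hconv hA
    refine absurd (hG.pairing_nonneg_of_subMean (taylor2_of_contDiffAt hw.contDiffAt)
      (half_pos hδ) fun r hr hrδ h hh hle => ?_) (not_le.2 hneg)
    let g : EucSp n → C(Metric.closedBall (0 : EucSp n) r, ℝ) := fun t =>
      (ContinuousMap.curry (⟨fun q => v (x + q.2.1 - q.1), by fun_prop⟩ :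
        C(EucSp n × Metric.closedBall (0 : EucSp n) r, ℝ))) t
    have hgc : Continuous g := ContinuousMap.continuous _
    have hgapp : ∀ t y, g t y = v (x + y.1 - t) := fun t y => rfl
    have hmem : ∀ t, ‖t‖ < η → g t ∈ subMeanSet β hr := by
      intro t ht k hk hkle
      have hthick : ∀ y, ‖y‖ ≤ r → x - t + y ∈ Metric.cthickening δ K := by
        intro y hy
        refine Metric.mem_cthickening_of_dist_le _ x _ _ hx ?_
        have e : x - t + y - x = y - t := by abel
        rw [dist_eq_norm, e]
        have := norm_sub_le y t
        have := min_le_right η₀ (δ / 2)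
        linarith
      have h1 := (hS.comp_scaling one_pos one_pos 0 (x - t)).mono_set
        (Y := Metric.ball (0 : EucSp n) r) (fun y hy => by
          rw [mem_ball_zero_iff] at hy
          simpa using hδX (hthick y hy.le))
      have h2 : SubQ G.carrier (Metric.ball (0 : EucSp n) r) fun y => v (x - t + y) := by
        have h1' : SubQ G.carrier (Metric.ball (0 : EucSp n) r)
            fun y => 1 * (u (x - t + (1 : ℝ) • y) - 0) := fun y hy b A hA => hFG (h1 y hy b A hA)
        refine h1'.congr Metric.isOpen_ball ?_
        intro y hy
        rw [mem_ball_zero_iff] at hy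
        simp [hvu _ (hthick y hy.le)]
      have h3 := hG.le_harm (z := 0) (r := r) (u := fun y => v (x - t + y))
        (Continuous.continuousOn (by fun_prop)) h2 hk (fun y hy => by
          rw [mem_sphere_zero_iff_norm] at hy
          have := hkle ⟨y, by rw [mem_closedBall_zero_iff, hy]⟩ hy
          rw [hgapp] at this
          have e : x + y - t = x - t + y := by abel
          rwa [e] at this) 0 (Metric.mem_closedBall_self hr.le)
      rw [hgapp]
      simpa using h3
    let ρ : EucSp n → NNReal := fun t => (ψ t).toNNReal
    have hψc : Continuous ψ := φ.continuous_normed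
    have hρm : Measurable ρ := hψc.measurable.real_toNNReal
    have hρ : ∀ t, (ρ t : ℝ) = ψ t := fun t => Real.coe_toNNReal _ (φ.nonneg_normed t)
    let μ : Measure (EucSp n) := volume.withDensity fun t => ρ t
    have hprob : IsProbabilityMeasure μ := by
      refine ⟨?_⟩
      rw [withDensity_apply _ MeasurableSet.univ, Measure.restrict_univ]
      have h1 := ofReal_integral_eq_lintegral_ofReal (μ := volume) φ.integrable_normed
        (Eventually.of_forall φ.nonneg_normed)
      rw [φ.integral_normed, ENNReal.ofReal_one] at h1
      exact h1.symm
    have hgint : Integrable g μ := by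
      rw [integrable_withDensity_iff_integrable_smul hρm]
      have : (fun t => ρ t • g t) = fun t => ψ t • g t := by
        ext1 t
        rw [NNReal.smul_def, hρ]
      rw [this]
      exact (hψc.smul hgc).integrable_of_hasCompactSupport φ.hasCompactSupport_normed.smul_right
    have hI : (∫ t, g t ∂μ) ∈ subMeanSet β hr := by
      refine (hG.convex_subMeanSet hr).integral_mem (isClosed_subMeanSet β hr) ?_ hgint
      rw [ae_withDensity_iff hρm.coe_nnreal_ennreal]
      refine Eventually.of_forall fun t ht => hmem t ?_
      have : t ∈ Function.support ψ := by
        intro h0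
        simp [ρ, h0] at ht
      rw [φ.support_normed_eq] at this
      exact mem_ball_zero_iff.1 this
    have hIapp : ∀ y, (∫ t, g t ∂μ) y = w (x + y.1) := by
      intro y
      rw [ContinuousMap.integral_apply hgint, integral_withDensity_eq_integral_smul hρm]
      refine integral_congr_ae (Eventually.of_forall fun t => ?_)
      simp only [NNReal.smul_def, hρ, hgapp]
      rfl
    have h4 := hI h hh fun y hy => by
      rw [hIapp]
      exact hle y hy
    rw [hIapp] at h4
    simpa using h4

/-! ### Comparison and uniqueness -/

lemma comparison {F : ConeSubequation n} (hconv : Convex ℝ F.carrier) {X K D : Set (EucSp n)}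
    (hX : IsOpen X) (hK : IsCompact K) (hKX : K ⊆ X) (hDK : D ⊆ K) (hD : IsOpen D)
    {u v : EucSp n → ℝ} (hu : ContinuousOn u X) (huS : SubQ F.carrier X u)
    (hv : ContinuousOn v K) (hvS : SubQ (dualSet F.carrier) D v) {c : ℝ}
    (hbd : ∀ x ∈ K \ D, u x + v x ≤ c) : ∀ x ∈ K, u x + v x ≤ c := by
  intro x hx
  refine le_of_forall_pos_le_add fun ε hε => ?_
  obtain ⟨w, hwc, hw⟩ := exists_smooth_approx hconv hX hK hKX hu huS (half_pos hε)
  have h1 := max_principle (g := fun y => c + ε / 2 - w y) hK hDK hD hv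
    (continuous_const.sub hwc).continuousOn hvS (fun y hy => ?_) (fun y hy => ?_) x hx
  · have := (abs_le.1 (hw x hx).1).1
    linarith
  · have h2 := (abs_le.1 (hw y hy.1).1).2
    have h3 := hbd y hy
    linarith
  · obtain ⟨-, b, A, hA, hAF⟩ := hw y (hDK hy)
    refine ⟨_, _, hA.const_sub _, fun δ hδ hmem => ?_⟩
    refine ConeSubequation.mem_dualSet_iff.1 hmem δ hδ ?_
    convert hAF using 1
    module

lemma le_of_density_eq {F : ConeSubequation n} (hconv : Convex ℝ F.carrier) {p : ℝ} (hp1 : 1 < p)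
    (hp2 : p < 2) (hchar : HasRieszChar F p) {Ω : Set (EucSp n)} (hΩ : IsOpen Ω)
    (hbd : Bornology.IsBounded Ω) {x₀ : EucSp n} (hx₀ : x₀ ∈ Ω) {u v : EucSp n → ℝ}
    (hu : ContinuousOn u (closure Ω)) (huS : SubQ F.carrier (Ω \ {x₀}) u)
    (hv : ContinuousOn v (closure Ω)) (hvS : SubQ (dualSet F.carrier) (Ω \ {x₀}) fun y => -v y)
    (huv : ∀ x ∈ frontier Ω, u x ≤ v x) {Θ : ℝ}
    (hut : Tendsto (fun y => (u y - u x₀) / ‖y - x₀‖ ^ (2 - p)) (𝓝[≠] x₀) (𝓝 Θ))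
    (hvt : Tendsto (fun y => (v y - v x₀) / ‖y - x₀‖ ^ (2 - p)) (𝓝[≠] x₀) (𝓝 Θ)) :
    ∀ x ∈ closure Ω, u x ≤ v x := by
  have hn2 := two_le_of_hasRieszChar hp1 hchar
  have : Nontrivial (EucSp n) :=
    Module.nontrivial_of_finrank_pos (R := ℝ) (by rw [finrank_euclideanSpace_fin]; omega)
  intro z hz
  by_contra! hlt
  have hcomp : IsCompact (closure Ω) := hbd.isCompact_closure
  have hK : Continuous fun y : EucSp n => ‖y - x₀‖ ^ (2 - p) := by
    simpa using continuous_kernel hp2 x₀ 1 0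
  have hK0 : ∀ y : EucSp n, 0 ≤ ‖y - x₀‖ ^ (2 - p) := fun y => Real.rpow_nonneg (norm_nonneg _) _
  obtain ⟨M, hM⟩ := hcomp.exists_bound_of_continuousOn hK.continuousOn
  have hM' : ∀ y ∈ closure Ω, ‖y - x₀‖ ^ (2 - p) ≤ M := fun y hy =>
    (le_abs_self _).trans (hM y hy)
  have hM0 : 0 ≤ M := (hK0 z).trans (hM' z hz)
  set m := u z - v z with hm
  have hm0 : 0 < m := sub_pos.2 hlt
  set ε := m / (2 * (M + 1)) with hε
  have hε0 : 0 < ε := by positivity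
  have hεM : ε * M < m := by
    rw [hε, div_mul_eq_mul_div, div_lt_iff₀ (by positivity)]
    nlinarith
  set U : EucSp n → ℝ := fun y => u y + (0 + ε * ‖y - x₀‖ ^ (2 - p)) with hU
  have hUc : ContinuousOn U (closure Ω) := hu.add (continuous_kernel hp2 x₀ ε 0).continuousOn
  have hUS : SubQ F.carrier (Ω \ {x₀}) U :=
    huS.add_taylor2 hconv fun x hx => kernel_hess_mem hp2 hchar (by simpa using hx.2) hε0.le 0
  set G : EucSp n → ℝ := fun y => U y + -v y with hG
  have hGc : ContinuousOn G (closure Ω) := hUc.add hv.neg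
  obtain ⟨x₁, hx₁, hmax⟩ := hcomp.exists_isMaxOn ⟨z, hz⟩ hGc
  have hGz : m ≤ G x₁ := by
    refine le_trans ?_ (hmax hz)
    have := mul_nonneg hε0.le (hK0 z)
    simp only [hG, hU, hm]
    linarith
  have hG0 : G x₀ < G x₁ := by
    have h1 : ∀ᶠ y in 𝓝[≠] x₀, -ε < (u y - u x₀) / ‖y - x₀‖ ^ (2 - p) -
        (v y - v x₀) / ‖y - x₀‖ ^ (2 - p) :=
      (hut.sub hvt).eventually (lt_mem_nhds (by linarith))
    obtain ⟨y, ⟨hy1, hy2⟩, hy3⟩ := ((h1.and eventually_mem_nhdsWithin).and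
      (mem_nhdsWithin_of_mem_nhds (hΩ.mem_nhds hx₀))).exists
    refine lt_of_lt_of_le ?_ (hmax (subset_closure hy3))
    have hpos : 0 < ‖y - x₀‖ ^ (2 - p) :=
      Real.rpow_pos_of_pos (norm_pos_iff.2 (sub_ne_zero.2 hy2)) _
    rw [← sub_div, lt_div_iff₀ hpos] at hy1
    have hz0 : ‖x₀ - x₀‖ ^ (2 - p) = 0 := by
      rw [sub_self, norm_zero, Real.zero_rpow (by linarith)]
    simp only [hG, hU, hz0]
    linarith
  obtain ⟨c, hc1, hc2⟩ := exists_between (max_lt (hεM.trans_le hGz) hG0)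
  have hc3 : ε * M < c := (le_max_left _ _).trans_lt hc1
  have hc4 : G x₀ < c := (le_max_right _ _).trans_lt hc1
  have hK' : IsCompact (closure Ω ∩ G ⁻¹' Set.Ici c) :=
    hcomp.of_isClosed_subset (hGc.preimage_isClosed_of_isClosed isClosed_closure isClosed_Ici)
      Set.inter_subset_left
  have hKX : closure Ω ∩ G ⁻¹' Set.Ici c ⊆ Ω \ {x₀} := by
    rintro y ⟨hy, hyc⟩
    refine ⟨?_, ?_⟩
    · by_contra hyΩ
      have h1 := huv y ⟨hy, by rwa [hΩ.interior_eq]⟩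
      have h2 := mul_le_mul_of_nonneg_left (hM' y hy) hε0.le
      simp only [hG, hU, Set.mem_preimage, Set.mem_Ici] at hyc
      linarith
    · rintro rfl
      exact absurd hyc (not_le.2 hc4)
  have hsub : Ω ∩ G ⁻¹' Set.Ioi c ⊆ closure Ω ∩ G ⁻¹' Set.Ici c :=
    Set.inter_subset_inter subset_closure (Set.preimage_mono Set.Ioi_subset_Ici_self)
  have hX : IsOpen (Ω \ {x₀}) := hΩ.sdiff isClosed_singleton
  have hcl : Ω \ {x₀} ⊆ closure Ω := Set.sdiff_subset.trans subset_closure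
  have := comparison hconv (D := Ω ∩ G ⁻¹' Set.Ioi c) hX hK' hKX hsub
    ((hGc.mono subset_closure).isOpen_inter_preimage hΩ isOpen_Ioi) (hUc.mono hcl) hUS
    (hv.neg.mono Set.inter_subset_left) (hvS.mono_set (hsub.trans hKX)) (c := c)
    (fun y hy => by
      by_contra! hlt
      exact hy.2 ⟨(hKX hy.1).1, hlt⟩) x₁ ⟨hx₁, hc2.le⟩
  exact absurd this (not_le.2 hc2)

/-! ### Boundary barriers -/

lemma continuous_symHess {f : EucSp n → ℝ} (hf : ContDiff ℝ 2 f) : Continuous (symHess f) := by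
  rw [continuous_induced_rng]
  have e : (Subtype.val ∘ symHess f) = hessMatrix f := by
    ext1 x
    exact symHess_coe hf.contDiffAt
  rw [e]
  refine continuous_matrix fun i j => ?_
  have h := hf.continuous_iteratedFDeriv (m := 2) le_rfl
  simp only [hessMatrix, Matrix.of_apply]
  fun_prop

lemma projMat_mulVec (v h : EucSp n) :
    Matrix.mulVec (projMat v) (h : Fin n → ℝ) = inner ℝ v h • (v : Fin n → ℝ) := by
  ext i
  simp only [Matrix.mulVec, dotProduct, projMat, Matrix.of_apply, PiLp.inner_apply, Pi.smul_apply,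
    smul_eq_mul, Finset.sum_mul]
  refine Finset.sum_congr rfl fun j _ => ?_
  simp
  ring

/-- The quadratic form of the second fundamental form plus a multiple of the normal projection. -/
lemma qf_secondFF {ρ : EucSp n → ℝ} {x : EucSp n} (hρ : ContDiffAt ℝ 2 ρ x) {S : SymMat n} {t : ℝ}
    (hS : S.1 = secondFF ρ x + t • projMat (innerNormal ρ x)) (h : EucSp n) :
    qf S h = ‖gradient ρ x‖⁻¹ *
      qf (symHess ρ x) (h - inner ℝ (innerNormal ρ x) h • innerNormal ρ x) +
        t * (inner ℝ (innerNormal ρ x) h) ^ 2 := by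
  set ν := innerNormal ρ x with hν
  have hP : ∀ k : EucSp n, Matrix.mulVec (1 - projMat ν) (k : Fin n → ℝ) =
      ((k - inner ℝ ν k • ν : EucSp n) : Fin n → ℝ) := by
    intro k
    rw [Matrix.sub_mulVec, Matrix.one_mulVec, projMat_mulVec]
    rfl
  have hPt : (1 - projMat ν).transpose = 1 - projMat ν := by
    have := projMat_selfAdjoint ν
    rw [selfAdjoint.mem_iff, Matrix.star_eq_conjTranspose,
      Matrix.conjTranspose_eq_transpose_of_trivial] at this
    rw [Matrix.transpose_sub, Matrix.transpose_one, this]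
  rw [qf_eq_dotProduct, qf_eq_dotProduct, hS, secondFF, ← hν, symHess_coe hρ, Matrix.add_mulVec,
    dotProduct_add, Matrix.smul_mulVec, Matrix.smul_mulVec, dotProduct_smul, dotProduct_smul,
    smul_eq_mul, smul_eq_mul, projMat_mulVec, dotProduct_smul, ← Matrix.mulVec_mulVec,
    ← Matrix.mulVec_mulVec, hP h, Matrix.dotProduct_mulVec (h : Fin n → ℝ) (1 - projMat ν),
    ← Matrix.mulVec_transpose, hPt, hP h]
  congr 2
  rw [pow_two, smul_eq_mul]
  congr 1

/-- A local strictly `F`-subharmonic barrier at a boundary point. -/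
lemma exists_barrier {F : ConeSubequation n} {Ω : Set (EucSp n)}
    (hbdry : StrictlyConvexBoundary F Ω) {y₀ : EucSp n} (hy₀ : y₀ ∈ frontier Ω) :
    ∃ (β : EucSp n → ℝ) (s η : ℝ), 0 < s ∧ 0 < η ∧ Continuous β ∧ β y₀ = 0 ∧
      (∀ x ∈ closure Ω, ‖x - y₀‖ ≤ s → β x ≤ -(η * ‖x - y₀‖ ^ 2)) ∧
      ∀ x, ‖x - y₀‖ < s → ∃ b, ∃ A ∈ F.carrier, Taylor2 β x b A := by
  obtain ⟨ρ, hρ, rfl, hb⟩ := hbdry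
  obtain ⟨hg, t, ht⟩ := hb y₀ hy₀
  have hρ2 : ContDiff ℝ 2 ρ := hρ.of_le (by norm_cast)
  obtain ⟨S, hSF, hS⟩ := ht t le_rfl
  obtain ⟨δ, hδ, hSδ⟩ := ConeSubequation.mem_interior_iff.1 hSF
  have hcl : ∀ x ∈ closure {x | ρ x < 0}, ρ x ≤ 0 := fun x hx =>
    closure_lt_subset_le hρ.continuous continuous_const hx
  have hρ0 : ρ y₀ = 0 := frontier_lt_subset_eq hρ.continuous continuous_const hy₀
  set γ := ‖gradient ρ y₀‖ with hγ
  have hγ0 : 0 < γ := norm_pos_iff.2 hg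
  set ν := innerNormal ρ y₀ with hν
  set A := symHess ρ y₀ with hA
  set c : EucSp n := WithLp.toLp 2 (A.1.mulVec ν) with hc
  set η : ℝ := γ * δ / 8 with hη
  have hη0 : 0 < η := by positivity
  set T : ℝ := (‖c‖ ^ 2 / (4 * η) + |qf A ν| + γ * |t|) / γ ^ 2 with hT
  have hT0 : 0 ≤ T := by positivity
  have hTγ : T * γ ^ 2 = ‖c‖ ^ 2 / (4 * η) + |qf A ν| + γ * |t| := by
    rw [hT]
    field_simp
  set β : EucSp n → ℝ := fun x => ρ x + T / 2 * ρ x ^ 2 - η * ‖x - y₀‖ ^ 2 with hβ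
  have hβ2 : ContDiff ℝ 2 β := by
    have : ContDiff ℝ 2 fun x : EucSp n => ‖x - y₀‖ ^ 2 := (contDiff_id.sub contDiff_const).norm_sq ℝ
    fun_prop
  have hβT : Taylor2 β y₀ _ _ := ((taylor2_of_contDiffAt hρ2.contDiffAt).add
    ((taylor2_of_contDiffAt hρ2.contDiffAt).sq.const_mul (T / 2))).sub
      ((Taylor2.norm_sub_sq y₀ y₀).const_mul η)
  have hHess := hβT.unique (taylor2_of_contDiffAt hβ2.contDiffAt)
  have hgν : ∀ h, (inner ℝ (gradient ρ y₀) h) ^ 2 = γ ^ 2 * (inner ℝ ν h) ^ 2 := by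
    intro h
    rw [hν, innerNormal, inner_neg_left, inner_smul_left, ← hγ]
    simp only [conj_trivial]
    field_simp
  have hgint : symHess β y₀ ∈ interior F.carrier := by
    rw [ConeSubequation.mem_interior_iff]
    refine ⟨2 * η, by positivity, ?_⟩
    refine F.mono (F.smul_mem hSδ hγ0.le) fun h => ?_
    rw [← hHess, hρ0]
    simp only [qf_smul, qf_sub, qf_add, qf_one, qf_symProj, hgν, qf_secondFF hρ2.contDiffAt hS]
    rw [← hν, ← hA, ← hγ]
    set s := inner ℝ ν h with hs
    have e : qf A (h - s • ν) = qf A h + s ^ 2 * qf A ν - 2 * s * inner ℝ c h := by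
      have := qf_add_right A ((-s) • ν) h
      rw [qf_smul_right] at this
      have e2 : h - s • ν = (-s) • ν + h := by module
      rw [e2, this]
      have e3 : (WithLp.toLp 2 (A.1.mulVec ((-s) • ν : EucSp n)) : EucSp n) = (-s) • c := by
        rw [hc, WithLp.ofLp_smul, Matrix.mulVec_smul, WithLp.toLp_smul]
      rw [e3, inner_smul_left]
      simp only [conj_trivial]
      ring
    rw [e]
    have h1 : |2 * s * inner ℝ c h| ≤ 4 * η * ‖h‖ ^ 2 + ‖c‖ ^ 2 / (4 * η) * s ^ 2 := by
      have h2 : |2 * s * inner ℝ c h| ≤ 2 * |s| * (‖c‖ * ‖h‖) := by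
        rw [abs_mul, abs_mul, abs_two]
        gcongr
        exact abs_real_inner_le_norm c h
      refine h2.trans ?_
      have h3 : 0 ≤ (4 * η * ‖h‖ - ‖c‖ * |s|) ^ 2 / (4 * η) := by positivity
      have h4 : (4 * η * ‖h‖ - ‖c‖ * |s|) ^ 2 / (4 * η) =
          4 * η * ‖h‖ ^ 2 + ‖c‖ ^ 2 / (4 * η) * |s| ^ 2 - 2 * |s| * (‖c‖ * ‖h‖) := by
        field_simp
        ring
      rw [sq_abs] at h4
      linarith
    have h5 := (abs_le.1 h1).1
    have h6 : s ^ 2 * qf A ν ≤ s ^ 2 * |qf A ν| := by gcongr; exact le_abs_self _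
    have h7 : γ * (t * s ^ 2) ≤ γ * |t| * s ^ 2 := by
      rw [mul_assoc]; gcongr; exact le_abs_self _
    have h8 : T * γ ^ 2 * s ^ 2 = _ := congrArg (· * s ^ 2) hTγ
    have h9 : γ * δ = 8 * η := by rw [hη]; ring
    have h10 : γ * (δ * ‖h‖ ^ 2) = 8 * η * ‖h‖ ^ 2 := by rw [← h9]; ring
    have h11 : γ * (γ⁻¹ * (qf A h + s ^ 2 * qf A ν - 2 * s * inner ℝ c h)) =
        qf A h + s ^ 2 * qf A ν - 2 * s * inner ℝ c h := by field_simp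
    rw [mul_sub, mul_add, h10, h11]
    linarith
  have hev1 : ∀ᶠ x in 𝓝 y₀, symHess β x ∈ interior F.carrier :=
    (continuous_symHess hβ2).continuousAt.eventually (isOpen_interior.mem_nhds hgint)
  have hev2 : ∀ᶠ x in 𝓝 y₀, -(1 / (T + 1)) < ρ x := by
    refine continuousAt_const.eventually_lt hρ.continuous.continuousAt ?_
    rw [hρ0, neg_lt_zero]
    positivity
  obtain ⟨s, hs, hball⟩ := Metric.eventually_nhds_iff.1 (hev1.and hev2)
  refine ⟨β, s / 2, η, half_pos hs, hη0, hβ2.continuous, by simp [hβ, hρ0], fun x hx hxs => ?_,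
    fun x hxs => ⟨_, _, interior_subset (hball ?_).1, taylor2_of_contDiffAt hβ2.contDiffAt⟩⟩
  · have h1 := (hball (y := x) (by rw [dist_eq_norm]; linarith)).2
    have h2 := hcl x hx
    have h3 : 0 ≤ 1 + T / 2 * ρ x := by
      have h4 : T / 2 * -(1 / (T + 1)) ≤ T / 2 * ρ x := by gcongr
      have h5 : T / 2 * (1 / (T + 1)) ≤ 1 := by
        rw [mul_one_div, div_le_one (by positivity)]; linarith
      linarith
    simp only [hβ]
    nlinarith
  · rw [dist_eq_norm]; linarith

/-! ### Gluing and suprema -/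

/-- The function `max u v` on the ball of radius `s` about `c`, extended by `u`. -/
def glue (u v : EucSp n → ℝ) (c : EucSp n) (s : ℝ) (x : EucSp n) : ℝ :=
  if ‖x - c‖ < s then max (u x) (v x) else u x

section Glue

variable {u v : EucSp n → ℝ} {c x : EucSp n} {s : ℝ} {X Y : Set (EucSp n)}

lemma le_glue (u v : EucSp n → ℝ) (c : EucSp n) (s : ℝ) (x : EucSp n) : u x ≤ glue u v c s x := by
  unfold glue
  split_ifs
  exacts [le_max_left _ _, le_rfl]

lemma glue_of_lt (h : ‖x - c‖ < s) : glue u v c s x = max (u x) (v x) := if_pos h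

lemma glue_of_ge (h : s ≤ ‖x - c‖) : glue u v c s x = u x := if_neg h.not_gt

lemma glue_eventuallyEq_of_lt (h : ‖x - c‖ < s) :
    glue u v c s =ᶠ[𝓝 x] fun y => max (u y) (v y) := by
  filter_upwards [(continuous_sub_right c).norm.continuousAt.eventually_lt continuousAt_const h]
    with y hy using glue_of_lt hy

lemma glue_eventuallyEq_of_ge (hu : ContinuousOn u Y) (hv : ContinuousOn v Y)
    (hlt : ∀ y ∈ Y, ‖y - c‖ = s → v y < u y) (hx : x ∈ Y) (h : s ≤ ‖x - c‖) :
    glue u v c s =ᶠ[𝓝[Y] x] u := by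
  rcases h.eq_or_lt with h | h
  · filter_upwards [(hv x hx).eventually_lt (hu x hx) (hlt x hx h.symm)] with y hy
    unfold glue
    split_ifs
    exacts [max_eq_left hy.le, rfl]
  · filter_upwards [nhdsWithin_le_nhds (continuousAt_const.eventually_lt
      (continuous_sub_right c).norm.continuousAt h)] with y hy using glue_of_ge hy.le

lemma continuousOn_glue (hu : ContinuousOn u Y) (hv : ContinuousOn v Y)
    (hlt : ∀ y ∈ Y, ‖y - c‖ = s → v y < u y) : ContinuousOn (glue u v c s) Y := by
  intro x hx
  rcases lt_or_ge ‖x - c‖ s with h | h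
  · have : ContinuousWithinAt (fun y => max (u y) (v y)) Y x := (hu x hx).max (hv x hx)
    exact this.congr_of_eventuallyEq
      (nhdsWithin_le_nhds (glue_eventuallyEq_of_lt h)) (glue_of_lt h)
  · exact (hu x hx).congr_of_eventuallyEq (glue_eventuallyEq_of_ge hu hv hlt hx h) (glue_of_ge h)

lemma SubQ.congr_nhds {S : Set (SymMat n)}
    (h : ∀ x ∈ X, ∃ w, SubQ S {x} w ∧ u =ᶠ[𝓝 x] w) : SubQ S X u := by
  intro x hx b A hA
  obtain ⟨w, hw, he⟩ := h x hx
  refine hw x rfl b A ?_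
  filter_upwards [hA, (tendsto_const_add_nhds_zero x).eventually he] with k h1 h2
  rwa [← he.self_of_nhds, ← h2]

lemma subQ_glue {S : Set (SymMat n)} (hX : IsOpen X) (hXY : X ⊆ Y) (hu : ContinuousOn u Y)
    (hv : ContinuousOn v Y) (hlt : ∀ y ∈ Y, ‖y - c‖ = s → v y < u y) (huS : SubQ S X u)
    (hvS : SubQ S (X ∩ Metric.ball c s) v) : SubQ S X (glue u v c s) := by
  refine SubQ.congr_nhds fun x hx => ?_
  rcases lt_or_ge ‖x - c‖ s with h | h
  · refine ⟨_, ?_, glue_eventuallyEq_of_lt h⟩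
    refine (huS.mono_set ?_).max (hvS.mono_set ?_)
    · simpa using hx
    · simpa [dist_eq_norm] using ⟨hx, h⟩
  · refine ⟨u, huS.mono_set (by simpa using hx), ?_⟩
    have := glue_eventuallyEq_of_ge hu hv hlt (hXY hx) h
    rwa [nhdsWithin_eq_nhds.2 (mem_of_superset (hX.mem_nhds hx) hXY)] at this

end Glue

/-- A supremum of continuous subharmonics is subharmonic. -/
lemma subQ_of_approx {S : Set (SymMat n)} (hS : ClosedAbove S) {X : Set (EucSp n)} (hX : IsOpen X)
    {H : EucSp n → ℝ}
    (h : ∀ x ∈ X, ∀ ε : ℝ, 0 < ε → ∃ u : EucSp n → ℝ, ContinuousOn u X ∧ SubQ S X u ∧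
      (∀ y ∈ X, u y ≤ H y) ∧ H x - ε < u x) : SubQ S X H := by
  intro x hx b A hA
  refine hS A fun δ hδ => ?_
  obtain ⟨s, hs, hball⟩ := Metric.eventually_nhds_iff.1
    (((tendsto_sub_const_nhds x).eventually hA).and (hX.mem_nhds hx))
  set r := s / 2 with hr
  have hr0 : 0 < r := half_pos hs
  obtain ⟨u, huc, huS, huH, hux⟩ := h x hx (δ * r ^ 2 / 2) (by positivity)
  have hsub : ∀ y ∈ Metric.closedBall x r, dist y x < s := fun y hy => by
    rw [Metric.mem_closedBall] at hy; linarith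
  set ψ : EucSp n → ℝ := fun y => inner ℝ b y + qf (A + δ • 1) (y - x) / 2 with hψ
  have hT := fun y => Taylor2.quadratic b y x (A + δ • 1)
  have hψc : Continuous ψ := by
    simp only [hψ, qf]
    fun_prop
  have hle : ∀ y ∈ Metric.closedBall x r, u y - ψ y ≤ H x - ψ x - δ * ‖y - x‖ ^ 2 / 2 := by
    intro y hy
    obtain ⟨h1, h2⟩ := hball (hsub y hy)
    have h3 := huH y h2
    rw [add_sub_cancel] at h1
    simp only [hψ, qf_add, qf_smul, qf_one, sub_self, norm_zero, qf_zero_right]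
    rw [inner_sub_right] at h1
    linarith
  obtain ⟨y, hy, hmax⟩ := (isCompact_closedBall x r).exists_isMaxOn
    ⟨x, Metric.mem_closedBall_self hr0.le⟩
    ((huc.mono fun y hy => (hball (hsub y hy)).2).sub hψc.continuousOn)
  have hyr : dist y x < r := by
    by_contra! hge
    have h1 := hle y hy
    have h2 : u x - ψ x ≤ u y - ψ y := hmax (Metric.mem_closedBall_self hr0.le)
    rw [dist_eq_norm] at hge
    have : r ^ 2 ≤ ‖y - x‖ ^ 2 := by gcongr
    nlinarith
  refine huS.mem_of_taylor2 hS (hball (hsub y hy)).2 (hT y) ?_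
  filter_upwards [Metric.isOpen_ball.mem_nhds hyr] with z hz
    using hmax (Metric.ball_subset_closedBall hz)

/-! ### The Perron family -/

/-- Competitors for the Dirichlet problem with density at least `Θ` at `x₀`. -/
structure PerronFamily (F : ConeSubequation n) (p : ℝ) (Ω : Set (EucSp n)) (x₀ : EucSp n)
    (R Θ : ℝ) (φ w u : EucSp n → ℝ) : Prop where
  cont : ContinuousOn u (closure Ω)
  subQ : SubQ F.carrier (Ω \ {x₀}) u
  le_bdry : ∀ y ∈ frontier Ω, u y ≤ φ y
  ge_lower : ∀ x ∈ closure Ω, w x ≤ u x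
  density : DensityGe p x₀ R u Θ

namespace PerronFamily

variable {F : ConeSubequation n} {p : ℝ} {Ω : Set (EucSp n)} {x₀ : EucSp n} {R Θ : ℝ}
  {φ w u : EucSp n → ℝ}

lemma le_of_le_bdry (hconv : Convex ℝ F.carrier) (hp1 : 1 < p) (hp2 : p < 2)
    (hchar : HasRieszChar F p) (hΩ : IsOpen Ω) (hbd : Bornology.IsBounded Ω) (hR : 0 < R)
    (hΘ : 0 ≤ Θ) {M : ℝ} (hM : ∀ y ∈ frontier Ω, φ y ≤ M)
    (hu : PerronFamily F p Ω x₀ R Θ φ w u) : ∀ x ∈ closure Ω, u x ≤ M := by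
  refine max_principle_exc (D := Ω) hconv hp1 hp2 hchar hbd.isCompact_closure subset_closure hΩ
    hu.cont continuousOn_const hu.subQ (fun _ => hu.density.centerLe hR hΘ) (fun x hx => ?_)
    fun x _ => ⟨0, 0, Taylor2.const M x, fun δ hδ => ?_⟩
  · have hx' : x ∈ frontier Ω := by rwa [hΩ.frontier_eq]
    exact (hu.le_bdry x hx').trans (hM x hx')
  · rw [zero_sub]
    exact ConeSubequation.neg_smul_one_notMem hδ

/-- Uniform Hölder continuity of the competitors near interior points. -/
lemma exists_holder (hconv : Convex ℝ F.carrier) (hp1 : 1 < p) (hp2 : p < 2)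
    (hchar : HasRieszChar F p) (hΩ : IsOpen Ω) (hR : 0 < R) (hΘ : 0 ≤ Θ) (B : ℝ)
    {z : EucSp n} (hz : z ∈ Ω) :
    ∃ r > 0, ∃ k, ∀ u, PerronFamily F p Ω x₀ R Θ φ w u → (∀ x ∈ closure Ω, |u x| ≤ B) →
      ∀ x y, ‖x - z‖ < r → ‖y - z‖ < r → u x ≤ u y + k * ‖x - y‖ ^ (2 - p) := by
  obtain ⟨s, hs, hball⟩ := Metric.isOpen_iff.1 hΩ z hz
  set r := s / 4 with hr
  have hr0 : 0 < r := by positivity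
  have hq : 0 < (2 * r) ^ (2 - p) := by positivity
  refine ⟨r, hr0, 2 * B / (2 * r) ^ (2 - p), fun u hu huB x y hx hy => ?_⟩
  have hsub : Metric.closedBall y (2 * r) ⊆ Ω := by
    intro a ha
    refine hball ?_
    rw [Metric.mem_closedBall] at ha
    rw [Metric.mem_ball]
    rw [← dist_eq_norm] at hy
    linarith [dist_triangle a y z]
  refine le_kernel_of_subQ hconv hp1 hp2 hchar (hu.cont.mono (hsub.trans subset_closure))
    (hu.subQ.mono_set (Set.sdiff_subset_sdiff_left (Metric.ball_subset_closedBall.trans hsub)))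
    (fun _ => hu.density.centerLe hR hΘ) le_rfl (fun a ha => ?_) x ?_
  · rw [div_mul_cancel₀ _ hq.ne']
    have h1 := (abs_le.1 (huB a (subset_closure (hsub (by
      rw [Metric.mem_closedBall, dist_eq_norm, ha]))))).2
    have h2 := (abs_le.1 (huB y (subset_closure (hsub (Metric.mem_closedBall_self
      (by positivity)))))).1
    linarith
  · have := norm_sub_le_norm_sub_add_norm_sub x z y
    rw [norm_sub_rev z y] at this
    linarith

/-- Uniform upper bound for the competitors near a boundary point. -/
lemma eventually_le_bdry (hconv : Convex ℝ F.carrier) (hp1 : 1 < p) (hp2 : p < 2)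
    (hchar : HasRieszChar F p) (hΩ : IsOpen Ω) (hbd : Bornology.IsBounded Ω)
    (hbdry : StrictlyConvexBoundary F Ω) (hR : 0 < R) (hΘ : 0 ≤ Θ)
    (hφ : ContinuousOn φ (frontier Ω)) (B : ℝ)
    {y₀ : EucSp n} (hy₀ : y₀ ∈ frontier Ω) {ε : ℝ} (hε : 0 < ε) :
    ∀ᶠ x in 𝓝[closure Ω] y₀, ∀ u, PerronFamily F p Ω x₀ R Θ φ w u →
      (∀ x ∈ closure Ω, |u x| ≤ B) → u x ≤ φ y₀ + ε := by
  obtain ⟨β, s, η, hs, hη, hβ, hβ0, hβle, hβT⟩ := exists_barrier hbdry hy₀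
  have hev : ∀ᶠ x in 𝓝[frontier Ω] y₀, φ x < φ y₀ + ε / 2 :=
    (hφ y₀ hy₀).eventually_lt continuousWithinAt_const (by linarith)
  obtain ⟨s', hs', hball⟩ := Metric.eventually_nhds_iff.1 (eventually_nhdsWithin_iff.1 hev)
  set σ := min s (s' / 2) with hσ
  have hσ0 : 0 < σ := lt_min hs (by positivity)
  set C := (|B| + |φ y₀|) / (η * σ ^ 2) with hC
  have hC0 : 0 ≤ C := by positivity
  have hCη : C * (η * σ ^ 2) = |B| + |φ y₀| := by rw [hC]; field_simp
  have key : ∀ u, PerronFamily F p Ω x₀ R Θ φ w u → (∀ x ∈ closure Ω, |u x| ≤ B) →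
      ∀ x ∈ closure Ω ∩ Metric.closedBall y₀ σ, u x ≤ φ y₀ + ε / 2 - C * β x := by
    intro u hu huB
    refine max_principle_exc (D := Ω ∩ Metric.ball y₀ σ) hconv hp1 hp2 hchar
      (hbd.isCompact_closure.inter_right Metric.isClosed_closedBall)
      (Set.inter_subset_inter subset_closure Metric.ball_subset_closedBall)
      (hΩ.inter Metric.isOpen_ball) (hu.cont.mono Set.inter_subset_left)
      (continuous_const.sub (hβ.const_mul C)).continuousOn
      (hu.subQ.mono_set (Set.sdiff_subset_sdiff_left Set.inter_subset_left))
      (fun _ => hu.density.centerLe hR hΘ) ?_ fun x hx => ?_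
    · rintro x ⟨⟨hx1, hx2⟩, hx3⟩
      rw [Metric.mem_closedBall, dist_eq_norm] at hx2
      have hβx := hβle x hx1 (hx2.trans (min_le_left _ _))
      by_cases hxΩ : x ∈ Ω
      · have hxσ : ‖x - y₀‖ = σ := by
          refine le_antisymm hx2 (not_lt.1 fun h => hx3 ⟨hxΩ, ?_⟩)
          rwa [Metric.mem_ball, dist_eq_norm]
        rw [hxσ] at hβx
        have h1 := (abs_le.1 (huB x hx1)).2
        have h2 : C * β x ≤ C * -(η * σ ^ 2) := by gcongr
        linarith [le_abs_self B, neg_abs_le (φ y₀)]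
      · have hxf : x ∈ frontier Ω := by rw [hΩ.frontier_eq]; exact ⟨hx1, hxΩ⟩
        have h1 := hu.le_bdry x hxf
        have h2 := hball (y := x) (by
          rw [dist_eq_norm]
          linarith [min_le_right s (s' / 2)]) hxf
        have h3 : C * β x ≤ 0 := mul_nonpos_of_nonneg_of_nonpos hC0
          (hβx.trans (by rw [neg_nonpos]; positivity))
        linarith
    · obtain ⟨b, A, hA, hT⟩ := hβT x (by
        have := hx.2
        rw [Metric.mem_ball, dist_eq_norm] at this
        exact this.trans_le (min_le_left _ _))
      refine ⟨_, _, (hT.const_mul C).const_sub _, fun δ hδ hmem => ?_⟩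
      refine ConeSubequation.neg_smul_one_notMem (F := F) hδ ?_
      convert ConeSubequation.add_mem hconv hmem (F.smul_mem hA hC0) using 1
      abel
  have hβε : ∀ᶠ x in 𝓝 y₀, -(ε / 2) < C * β x := by
    refine continuousAt_const.eventually_lt (hβ.const_mul C).continuousAt ?_
    rw [hβ0]
    linarith
  rw [eventually_nhdsWithin_iff]
  filter_upwards [hβε, Metric.closedBall_mem_nhds y₀ hσ0] with x h1 h2 hx u hu huB
  linarith [key u hu huB x ⟨hx, h2⟩]

/-- Gluing a competitor with a subharmonic function on a ball. -/
lemma glue {v : EucSp n → ℝ} {c : EucSp n} {s : ℝ} (hΩ : IsOpen Ω)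
    (hu : PerronFamily F p Ω x₀ R Θ φ w u) (hv : Continuous v)
    (hlt : ∀ y ∈ closure Ω, ‖y - c‖ = s → v y < u y)
    (hvS : SubQ F.carrier (Metric.ball c s \ {x₀}) v)
    (hvφ : ∀ y ∈ frontier Ω, ‖y - c‖ < s → v y ≤ φ y)
    (hd : DensityGe p x₀ R (glue u v c s) Θ) :
    PerronFamily F p Ω x₀ R Θ φ w (glue u v c s) where
  cont := continuousOn_glue hu.cont hv.continuousOn hlt
  subQ := subQ_glue (hΩ.sdiff isClosed_singleton) (Set.sdiff_subset.trans subset_closure) hu.cont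
    hv.continuousOn hlt hu.subQ (hvS.mono_set fun _ hx => ⟨hx.2, hx.1.2⟩)
  le_bdry y hy := by
    unfold _root_.glue
    split_ifs with h
    · exact max_le (hu.le_bdry y hy) (hvφ y hy h)
    · exact hu.le_bdry y hy
  ge_lower x hx := (hu.ge_lower x hx).trans (le_glue u v c s x)
  density := hd

/-- The competitors attain the boundary values approximately. -/
lemma exists_ge_bdry (hΩ : IsOpen Ω) (hbdry : StrictlyConvexBoundary F Ω)
    (hRΩ : Metric.closedBall x₀ R ⊆ Ω) (hφ : ContinuousOn φ (frontier Ω))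
    (hu : PerronFamily F p Ω x₀ R Θ φ w u) (hu0 : ∃ N, ∀ x ∈ closure Ω, -N ≤ u x)
    {y₀ : EucSp n} (hy₀ : y₀ ∈ frontier Ω) {ε : ℝ} (hε : 0 < ε) :
    ∃ v, PerronFamily F p Ω x₀ R Θ φ w v ∧ ∀ᶠ x in 𝓝[closure Ω] y₀, φ y₀ - ε ≤ v x := by
  obtain ⟨β, s, η, hs, hη, hβ, hβ0, hβle, hβT⟩ := exists_barrier hbdry hy₀
  obtain ⟨N, hN⟩ := hu0
  have hev : ∀ᶠ x in 𝓝[frontier Ω] y₀, φ y₀ - ε / 2 < φ x :=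
    continuousWithinAt_const.eventually_lt (hφ y₀ hy₀) (by linarith)
  obtain ⟨s', hs', hball⟩ := Metric.eventually_nhds_iff.1 (eventually_nhdsWithin_iff.1 hev)
  have hfar : R < ‖x₀ - y₀‖ := by
    by_contra! h
    rw [hΩ.frontier_eq] at hy₀
    exact hy₀.2 (hRΩ (by rwa [Metric.mem_closedBall, dist_comm, dist_eq_norm]))
  set σ := min (min s s') (‖x₀ - y₀‖ - R) with hσ
  have hσ0 : 0 < σ := lt_min (lt_min hs hs') (by linarith)
  have hσs : σ ≤ s := (min_le_left _ _).trans (min_le_left _ _)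
  have hσs' : σ ≤ s' := (min_le_left _ _).trans (min_le_right _ _)
  have hσR : σ ≤ ‖x₀ - y₀‖ - R := min_le_right _ _
  set C := (|N| + |φ y₀|) / (η * σ ^ 2) with hC
  have hC0 : 0 ≤ C := by positivity
  have hCη : C * (η * σ ^ 2) = |N| + |φ y₀| := by rw [hC]; field_simp
  set v : EucSp n → ℝ := fun x => φ y₀ - ε / 2 + C * β x with hv
  have hfarx : ∀ x, ‖x - x₀‖ ≤ R → σ ≤ ‖x - y₀‖ := by
    intro x hx
    have := norm_sub_le_norm_sub_add_norm_sub x₀ x y₀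
    rw [norm_sub_rev x₀ x] at this
    linarith
  refine ⟨_root_.glue u v y₀ σ, hu.glue hΩ (continuous_const.add (hβ.const_mul C)) ?_ ?_ ?_ ?_, ?_⟩
  · intro y hy hyσ
    have h1 := hβle y hy (hyσ.le.trans hσs)
    rw [hyσ] at h1
    have h2 : C * β y ≤ C * -(η * σ ^ 2) := by gcongr
    have := hN y hy
    simp only [hv]
    linarith [le_abs_self N, le_abs_self (φ y₀)]
  · refine subQ_of_taylor2 fun x hx => ?_
    have hxσ := hx.1
    rw [Metric.mem_ball, dist_eq_norm] at hxσ
    obtain ⟨b, A, hA, hT⟩ := hβT x (hxσ.trans_le hσs)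
    exact ⟨_, _, F.smul_mem hA hC0, (hT.const_mul C).const_add _⟩
  · intro y hy hyσ
    have h1 := hball (y := y) (by rw [dist_eq_norm]; linarith) hy
    have h2 := hβle y (frontier_subset_closure hy) (hyσ.le.trans hσs)
    have h3 : C * β y ≤ 0 := mul_nonpos_of_nonneg_of_nonpos hC0
      (h2.trans (by rw [neg_nonpos]; positivity))
    simp only [hv]
    linarith
  · intro r hr hrR
    obtain ⟨x, hx, hux⟩ := hu.density r hr hrR
    refine ⟨x, hx, ?_⟩
    rwa [glue_of_ge (hfarx x (hx.le.trans hrR)), glue_of_ge (hfarx x₀ (by simpa using hr.le.trans hrR))]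
  · have hβε : ∀ᶠ x in 𝓝 y₀, -(ε / 2) < C * β x := by
      refine continuousAt_const.eventually_lt (hβ.const_mul C).continuousAt ?_
      rw [hβ0]
      linarith
    refine nhdsWithin_le_nhds ?_
    filter_upwards [hβε, Metric.ball_mem_nhds y₀ hσ0] with x h1 h2
    rw [Metric.mem_ball, dist_eq_norm] at h2
    rw [glue_of_lt h2]
    refine le_trans ?_ (le_max_right _ _)
    simp only [hv]
    linarith

end PerronFamily

/-! ### The Perron solution -/

namespace PerronFamily

variable {F : ConeSubequation n} {p : ℝ} {Ω : Set (EucSp n)} {x₀ : EucSp n} {R Θ : ℝ}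
  {φ w H : EucSp n → ℝ}

/-- The Perron family has a largest element, which attains the boundary values. -/
lemma exists_maximal (hconv : Convex ℝ F.carrier) (hp1 : 1 < p) (hp2 : p < 2)
    (hchar : HasRieszChar F p) (hΩ : IsOpen Ω) (hbd : Bornology.IsBounded Ω)
    (hbdry : StrictlyConvexBoundary F Ω) (hR : 0 < R) (hRΩ : Metric.closedBall x₀ R ⊆ Ω)
    (hΘ : 0 ≤ Θ) (hφ : ContinuousOn φ (frontier Ω)) {N : ℝ} (hN : ∀ x ∈ closure Ω, -N ≤ w x)
    (hw : PerronFamily F p Ω x₀ R Θ φ w w) :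
    ∃ H, PerronFamily F p Ω x₀ R Θ φ w H ∧ (∀ y ∈ frontier Ω, H y = φ y) ∧
      ∀ u, PerronFamily F p Ω x₀ R Θ φ w u → ∀ x ∈ closure Ω, u x ≤ H x := by
  set 𝓕 : Set (EucSp n → ℝ) := {u | PerronFamily F p Ω x₀ R Θ φ w u}
  have hfc : IsCompact (frontier Ω) :=
    hbd.isCompact_closure.of_isClosed_subset isClosed_frontier frontier_subset_closure
  obtain ⟨M, hM⟩ := (hfc.image_of_continuousOn hφ).bddAbove
  set B := max |M| |N| with hB
  have hbound : ∀ u ∈ 𝓕, ∀ x ∈ closure Ω, |u x| ≤ B := by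
    intro u hu x hx
    have h1 := le_of_le_bdry hconv hp1 hp2 hchar hΩ hbd hR hΘ (fun y hy => hM ⟨y, hy, rfl⟩) hu x hx
    have h2 := (hN x hx).trans (hu.ge_lower x hx)
    rw [abs_le]
    constructor
    · linarith [le_abs_self N, le_max_right |M| |N|]
    · linarith [le_abs_self M, le_max_left |M| |N|]
  set H : EucSp n → ℝ := fun x => sSup ((fun u => u x) '' 𝓕) with hH
  have hle : ∀ u ∈ 𝓕, ∀ x ∈ closure Ω, u x ≤ H x := fun u hu x hx =>
    le_csSup ⟨B, by rintro _ ⟨v, hv, rfl⟩; exact (abs_le.1 (hbound v hv x hx)).2⟩ ⟨u, hu, rfl⟩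
  have hlub : ∀ x a, (∀ u ∈ 𝓕, u x ≤ a) → H x ≤ a := fun x a h =>
    csSup_le ⟨_, w, hw, rfl⟩ (by rintro _ ⟨v, hv, rfl⟩; exact h v hv)
  have hex : ∀ x, ∀ ε : ℝ, 0 < ε → ∃ u ∈ 𝓕, H x - ε < u x := by
    intro x ε hε
    obtain ⟨_, ⟨u, hu, rfl⟩, h⟩ := exists_lt_of_lt_csSup (s := (fun u => u x) '' 𝓕)
      ⟨_, w, hw, rfl⟩ (sub_lt_self (H x) hε)
    exact ⟨u, hu, h⟩
  have hHφ : ∀ y ∈ frontier Ω, H y = φ y := by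
    intro y hy
    refine le_antisymm (hlub y _ fun u hu => hu.le_bdry y hy) ?_
    refine le_of_forall_pos_le_add fun ε hε => ?_
    obtain ⟨v, hv, hvy⟩ := exists_ge_bdry hΩ hbdry hRΩ hφ hw ⟨N, hN⟩ hy hε
    have h1 := hvy.self_of_nhdsWithin (frontier_subset_closure hy)
    have h2 := hle v hv y (frontier_subset_closure hy)
    linarith
  have hcont : ContinuousOn H (closure Ω) := by
    intro z hz
    by_cases hzΩ : z ∈ Ω
    · obtain ⟨r, hr, k, hk⟩ := exists_holder (x₀ := x₀) (φ := φ) (w := w) hconv hp1 hp2 hchar hΩ hR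
        hΘ B hzΩ
      have hH : ∀ x y, ‖x - z‖ < r → ‖y - z‖ < r → y ∈ Ω → H x ≤ H y + k * ‖x - y‖ ^ (2 - p) :=
        fun x y hx hy hyΩ => hlub x _ fun u hu => (hk u hu (hbound u hu) x y hx hy).trans
          (by gcongr; exact hle u hu y (subset_closure hyΩ))
      refine ContinuousAt.continuousWithinAt ?_
      have hK := fun c l => (continuous_kernel hp2 z l c).continuousAt (x := z)
      have h1 := (hK (H z) k).tendsto
      have h2 := (hK (H z) (-k)).tendsto
      simp only [sub_self, norm_zero, Real.zero_rpow (show 2 - p ≠ 0 by linarith), mul_zero,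
        add_zero] at h1 h2
      refine tendsto_of_tendsto_of_tendsto_of_le_of_le' h2 h1 ?_ ?_
      · filter_upwards [Metric.ball_mem_nhds z hr, hΩ.mem_nhds hzΩ] with y hy hyΩ
        rw [Metric.mem_ball, dist_eq_norm] at hy
        have := hH z y (by simpa using hr) hy hyΩ
        rw [norm_sub_rev] at this
        linarith
      · filter_upwards [Metric.ball_mem_nhds z hr] with y hy
        rw [Metric.mem_ball, dist_eq_norm] at hy
        exact hH y z hy (by simpa using hr) hzΩ
    · have hzf : z ∈ frontier Ω := by rw [hΩ.frontier_eq]; exact ⟨hz, hzΩ⟩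
      rw [ContinuousWithinAt, Metric.tendsto_nhds]
      intro ε hε
      obtain ⟨v, hv, hvz⟩ := exists_ge_bdry hΩ hbdry hRΩ hφ hw ⟨N, hN⟩ hzf (half_pos hε)
      filter_upwards [hvz, eventually_le_bdry (x₀ := x₀) (w := w) hconv hp1 hp2 hchar hΩ hbd hbdry hR
        hΘ hφ B hzf (half_pos hε), self_mem_nhdsWithin] with x h1 h2 h3
      have h4 := hlub x _ fun u hu => h2 u hu (hbound u hu)
      have h5 := hle v hv x h3
      rw [Real.dist_eq, abs_lt, hHφ z hzf]
      constructor <;> linarith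
  refine ⟨H, ⟨hcont, ?_, fun y hy => (hHφ y hy).le, fun x hx => hle w hw x hx, ?_⟩, hHφ, hle⟩
  · refine subQ_of_approx F.closedAbove (hΩ.sdiff isClosed_singleton) fun x _ ε hε => ?_
    obtain ⟨u, hu, hux⟩ := hex x ε hε
    exact ⟨u, hu.cont.mono (Set.sdiff_subset.trans subset_closure), hu.subQ,
      fun y hy => hle u hu y (subset_closure hy.1), hux⟩
  · intro r hr hrR
    have hsub : Metric.sphere x₀ r ⊆ closure Ω := (Metric.sphere_subset_closedBall.trans
      (Metric.closedBall_subset_closedBall hrR)).trans (hRΩ.trans subset_closure)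
    obtain ⟨x, hx, -⟩ := hw.density r hr hrR
    obtain ⟨y, hy, hmax⟩ := (isCompact_sphere x₀ r).exists_isMaxOn
      ⟨x, by rwa [mem_sphere_iff_norm]⟩ (hcont.mono hsub)
    refine ⟨y, by rwa [← mem_sphere_iff_norm], ?_⟩
    rw [← le_sub_iff_add_le]
    refine hlub x₀ _ fun u hu => ?_
    obtain ⟨a, ha, hua⟩ := hu.density r hr hrR
    have ha' : a ∈ Metric.sphere x₀ r := by rwa [mem_sphere_iff_norm]
    have h1 := hle u hu a (hsub ha')
    have h2 : H a ≤ H y := hmax ha'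
    linarith

/-- The largest element of the Perron family is `F`-harmonic off `x₀`. -/
lemma subQ_neg_of_maximal (hΩ : IsOpen Ω) (hH : PerronFamily F p Ω x₀ R Θ φ w H)
    (hmax : ∀ u, PerronFamily F p Ω x₀ R Θ φ w u → ∀ x ∈ closure Ω, u x ≤ H x) :
    SubQ (dualSet F.carrier) (Ω \ {x₀}) fun y => -H y := by
  intro x hx b A hA
  rw [ConeSubequation.mem_dualSet_iff]
  intro δ hδ hF
  have hX : IsOpen (Ω \ {x₀}) := hΩ.sdiff isClosed_singleton
  obtain ⟨s', hs', hball⟩ := Metric.eventually_nhds_iff.1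
    (((tendsto_sub_const_nhds x).eventually hA).and (hX.mem_nhds hx))
  set s := s' / 2 with hs
  have hs0 : 0 < s := half_pos hs'
  have hsub : ∀ y, ‖y - x‖ ≤ s → dist y x < s' := fun y hy => by rw [dist_eq_norm]; linarith
  set k : ℝ := H x + δ * s ^ 2 / 4 + inner ℝ b x with hk
  set v : EucSp n → ℝ := fun y => (inner ℝ (-b) y + qf (-A - δ • 1) (y - x) / 2) + k with hv
  have hvc : Continuous v := by
    simp only [hv, qf]
    fun_prop
  have hvH : ∀ y, ‖y - x‖ ≤ s → v y ≤ H y + δ * s ^ 2 / 4 - δ * ‖y - x‖ ^ 2 / 2 := by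
    intro y hy
    have h1 := (hball (hsub y hy)).1
    rw [add_sub_cancel, inner_sub_right] at h1
    simp only [hv, hk, inner_neg_left, qf_sub, qf_neg, qf_smul, qf_one]
    linarith
  have hx₀s : s ≤ ‖x₀ - x‖ := by
    by_contra! h
    exact (hball (hsub x₀ h.le)).2.2 rfl
  have hG : PerronFamily F p Ω x₀ R Θ φ w (_root_.glue H v x s) := by
    refine hH.glue hΩ hvc (fun y _ hy => ?_) ?_ (fun y hy hys => ?_) fun r hr hrR => ?_
    · have h1 := hvH y hy.le
      rw [hy] at h1
      have : 0 < δ * s ^ 2 := by positivity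
      linarith
    · exact subQ_of_taylor2 fun y _ => ⟨_, _, hF, (Taylor2.quadratic _ y x _).add_const k⟩
    · rw [hΩ.frontier_eq] at hy
      exact absurd (hball (hsub y hys.le)).2.1 hy.2
    · obtain ⟨y, hy, hHy⟩ := hH.density r hr hrR
      refine ⟨y, hy, ?_⟩
      rw [glue_of_ge hx₀s]
      exact hHy.trans (le_glue H v x s y)
  have h1 := hmax _ hG x (subset_closure hx.1)
  rw [glue_of_lt (by simpa using hs0)] at h1
  have h2 := (le_max_right _ _).trans h1
  have : 0 < δ * s ^ 2 := by positivity
  simp only [hv, hk, inner_neg_left, sub_self, qf_zero_right] at h2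
  linarith

/-- The largest element of the Perron family has density exactly `Θ`. -/
lemma tendsto_of_maximal (hconv : Convex ℝ F.carrier) (hinv : OrthInvariant F) (hp1 : 1 < p)
    (hp2 : p < 2) (hchar : HasRieszChar F p) (hΩ : IsOpen Ω) (hR : 0 < R)
    (hRΩ : Metric.closedBall x₀ R ⊆ Ω) (hΘ : 0 ≤ Θ) (hH : PerronFamily F p Ω x₀ R Θ φ w H)
    (hmax : ∀ u, PerronFamily F p Ω x₀ R Θ φ w u → ∀ x ∈ closure Ω, u x ≤ H x) :
    Tendsto (fun x => (H x - H x₀) / ‖x - x₀‖ ^ (2 - p)) (𝓝[≠] x₀) (𝓝 Θ) := by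
  have hcR : ContinuousOn H (Metric.closedBall x₀ R) := hH.cont.mono (hRΩ.trans subset_closure)
  have hSR : SubQ F.carrier (Metric.ball x₀ R \ {x₀}) H :=
    hH.subQ.mono_set (Set.sdiff_subset_sdiff_left (Metric.ball_subset_closedBall.trans hRΩ))
  have hexc := hH.density.centerLe hR hΘ
  obtain ⟨Θ₁, hΘ₁, hd, hup⟩ := exists_density hconv hp1 hp2 hchar hR hcR hSR hexc hH.density
  have ht := tendsto_density hconv hinv hp1 hp2 hchar hR hcR hSR hexc hd hup
  rcases hΘ₁.eq_or_lt with rfl | hlt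
  · exact ht
  exfalso
  set Θ₂ := (Θ + Θ₁) / 2 with hΘ₂
  have h1 := ht.eventually_const_lt (show Θ₂ < Θ₁ by linarith)
  rw [eventually_nhdsWithin_iff] at h1
  obtain ⟨s', hs', hball⟩ := Metric.eventually_nhds_iff.1 h1
  set s := min (s' / 2) R with hs
  have hs0 : 0 < s := lt_min (half_pos hs') hR
  have hsR : s ≤ R := min_le_right _ _
  have hsph : ∀ y, ‖y - x₀‖ = s → H x₀ + Θ₂ * s ^ (2 - p) < H y := by
    intro y hy
    have h2 := hball (y := y) (by
      rw [dist_eq_norm, hy]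
      linarith [min_le_left (s' / 2) R]) (by
      rintro rfl
      rw [sub_self, norm_zero] at hy
      exact hs0.ne hy)
    rw [hy, lt_div_iff₀ (by positivity)] at h2
    linarith
  obtain ⟨a, ha, -⟩ := hd s hs0 hsR
  obtain ⟨y, hy, hmin⟩ := (isCompact_sphere x₀ s).exists_isMinOn
    ⟨a, by rwa [mem_sphere_iff_norm]⟩ (hcR.mono (Metric.sphere_subset_closedBall.trans
      (Metric.closedBall_subset_closedBall hsR)))
  have hym := hsph y (by rwa [← mem_sphere_iff_norm])
  have hsq : 0 < s ^ (2 - p) := by positivity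
  obtain ⟨ε, hε, hεm⟩ := exists_between (lt_min (sub_pos.2 hym)
    (mul_pos (sub_pos.2 hlt) hsq))
  obtain ⟨hε1, hε2⟩ := lt_min_iff.1 hεm
  set v : EucSp n → ℝ := fun x => (H x₀ + ε) + Θ₂ * ‖x - x₀‖ ^ (2 - p) with hv
  have hv0 : v x₀ = H x₀ + ε := by
    simp [hv, Real.zero_rpow (show 2 - p ≠ 0 by linarith)]
  have hg0 : _root_.glue H v x₀ s x₀ = H x₀ + ε := by
    rw [glue_of_lt (by simpa using hs0), hv0, max_eq_right (by linarith)]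
  have hG : PerronFamily F p Ω x₀ R Θ φ w (_root_.glue H v x₀ s) := by
    refine hH.glue hΩ (continuous_kernel hp2 x₀ Θ₂ _) (fun z _ hz => ?_) ?_ (fun z hz hzs => ?_)
      fun r hr hrR => ?_
    · have h2 : H y ≤ H z := hmin (by rwa [mem_sphere_iff_norm])
      simp only [hv, hz]
      linarith
    · exact subQ_of_taylor2 fun z hz => kernel_hess_mem hp2 hchar hz.2 (by linarith) _
    · rw [hΩ.frontier_eq] at hz
      refine absurd (hRΩ ?_) hz.2
      rw [Metric.mem_closedBall, dist_eq_norm]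
      linarith
    · rw [hg0]
      obtain ⟨z, hz, hHz⟩ := hd r hr hrR
      refine ⟨z, hz, ?_⟩
      rcases lt_or_ge r s with hrs | hrs
      · rw [glue_of_lt (by rwa [hz])]
        refine le_trans ?_ (le_max_right _ _)
        simp only [hv, hz]
        gcongr
        linarith
      · refine le_trans ?_ (le_glue H v x₀ s z)
        have h3 : (Θ₁ - Θ) * s ^ (2 - p) ≤ (Θ₁ - Θ) * r ^ (2 - p) :=
          mul_le_mul_of_nonneg_left (Real.rpow_le_rpow hs0.le hrs (by linarith)) (by linarith)
        linarith
  have h4 := hmax _ hG x₀ (subset_closure (hRΩ (Metric.mem_closedBall_self hR.le)))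
  rw [hg0] at h4
  linarith

/-- The Riesz kernel gives a competitor. -/
lemma exists_kernel (hp1 : 1 < p) (hp2 : p < 2) (hchar : HasRieszChar F p)
    (hbd : Bornology.IsBounded Ω) (x₀ : EucSp n) (R : ℝ) (hΘ : 0 ≤ Θ)
    (hφ : ContinuousOn φ (frontier Ω)) :
    ∃ (w : EucSp n → ℝ) (N : ℝ), PerronFamily F p Ω x₀ R Θ φ w w ∧ ∀ x ∈ closure Ω, -N ≤ w x := by
  have hn : 0 < n := by linarith [two_le_of_hasRieszChar hp1 hchar]
  have hfc : IsCompact (frontier Ω) :=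
    hbd.isCompact_closure.of_isClosed_subset isClosed_frontier frontier_subset_closure
  have hK : ∀ c, Continuous fun x : EucSp n => c + Θ * ‖x - x₀‖ ^ (2 - p) :=
    fun c => continuous_kernel hp2 x₀ Θ c
  obtain ⟨m, hm⟩ := (hfc.image_of_continuousOn (hφ.sub (hK 0).continuousOn)).bddBelow
  refine ⟨fun x => m + Θ * ‖x - x₀‖ ^ (2 - p), -m, ⟨(hK m).continuousOn, ?_, fun y hy => ?_,
    fun _ _ => le_rfl, fun r hr _ => ?_⟩, fun x _ => ?_⟩
  · exact subQ_of_taylor2 fun x hx => kernel_hess_mem hp2 hchar hx.2 hΘ m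
  · have : m ≤ φ y - (0 + Θ * ‖y - x₀‖ ^ (2 - p)) := hm ⟨y, hy, rfl⟩
    linarith
  · refine ⟨x₀ + EuclideanSpace.single ⟨0, hn⟩ r, by simp [abs_of_pos hr], ?_⟩
    simp [abs_of_pos hr, Real.zero_rpow (show 2 - p ≠ 0 by linarith)]
  · have : 0 ≤ Θ * ‖x - x₀‖ ^ (2 - p) := by positivity
    linarith

end PerronFamily

/-- `F`-harmonicity of a continuous real function in terms of quadratic upper contact. -/
lemma fHarmonicOn_iff_subQ {F : ConeSubequation n} {X : Set (EucSp n)} (hX : IsOpen X)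
    {u : EucSp n → ℝ} (hu : ContinuousOn u X) :
    FHarmonicOn F X (fun y => (u y : EReal)) ↔
      SubQ F.carrier X u ∧ SubQ (dualSet F.carrier) X fun y => -u y := by
  have e : (fun y => -(u y : EReal)) = fun y => ((-u y : ℝ) : EReal) := by
    ext1 y
    rw [EReal.coe_neg]
  unfold FHarmonicOn
  rw [e]
  exact ⟨fun h => ⟨subQ_of_fSubharmonicOn h.1, subQ_of_fSubharmonicOn h.2⟩, fun h =>
    ⟨fSubharmonicOn_of_subQ F.closedAbove hX hu h.1,
      fSubharmonicOn_of_subQ F.closedAbove_dualSet hX hu.neg h.2⟩⟩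

/-- Theorem 7.9: for an O(n)-invariant convex cone subequation of Riesz
characteristic 1 < p < 2, the Dirichlet problem with prescribed density Θ ≥ 0 (relative to
h(x) = |x − x₀|^{2−p}) is uniquely solvable on a bounded domain with smooth strictly
F-convex boundary. -/
theorem dirichlet_singularities_stmt15 {n : ℕ} (F : ConeSubequation n)
    (hconv : Convex ℝ F.carrier) (hinv : OrthInvariant F)
    (p : ℝ) (hp1 : 1 < p) (hp2 : p < 2) (hchar : HasRieszChar F p)
    (Ω : Set (EucSp n)) (hΩ : IsBoundedDomain Ω) (hbdry : StrictlyConvexBoundary F Ω)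
    (x₀ : EucSp n) (hx₀ : x₀ ∈ Ω)
    (Θ : ℝ) (hΘ : 0 ≤ Θ) (φ : EucSp n → ℝ) (hφ : ContinuousOn φ (frontier Ω)) :
    ∃ H : EucSp n → ℝ,
      (ContinuousOn H (closure Ω) ∧
       FHarmonicOn F (Ω \ {x₀}) (fun y => (H y : EReal)) ∧
       (∀ y ∈ frontier Ω, H y = φ y) ∧
       Filter.Tendsto (fun y => (H y - H x₀) / ‖y - x₀‖ ^ (2 - p)) (𝓝[≠] x₀) (𝓝 Θ)) ∧
      ∀ H' : EucSp n → ℝ,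
        (ContinuousOn H' (closure Ω) ∧
         FHarmonicOn F (Ω \ {x₀}) (fun y => (H' y : EReal)) ∧
         (∀ y ∈ frontier Ω, H' y = φ y) ∧
         Filter.Tendsto (fun y => (H' y - H' x₀) / ‖y - x₀‖ ^ (2 - p)) (𝓝[≠] x₀) (𝓝 Θ)) →
        Set.EqOn H H' (closure Ω) := by
  obtain ⟨hΩo, -, hΩb⟩ := hΩ
  have hX : IsOpen (Ω \ {x₀}) := hΩo.sdiff isClosed_singleton
  have hXc : Ω \ {x₀} ⊆ closure Ω := Set.sdiff_subset.trans subset_closure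
  obtain ⟨R, hR, hRΩ⟩ := Metric.nhds_basis_closedBall.mem_iff.1 (hΩo.mem_nhds hx₀)
  obtain ⟨w, N, hw, hN⟩ := PerronFamily.exists_kernel (Ω := Ω) (φ := φ) hp1 hp2 hchar hΩb x₀ R hΘ hφ
  obtain ⟨H, hH, hHφ, hmax⟩ := PerronFamily.exists_maximal hconv hp1 hp2 hchar hΩo hΩb hbdry hR hRΩ
    hΘ hφ hN hw
  have hneg := PerronFamily.subQ_neg_of_maximal hΩo hH hmax
  have ht := PerronFamily.tendsto_of_maximal hconv hinv hp1 hp2 hchar hΩo hR hRΩ hΘ hH hmax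
  refine ⟨H, ⟨hH.cont, (fHarmonicOn_iff_subQ hX (hH.cont.mono hXc)).2 ⟨hH.subQ, hneg⟩, hHφ, ht⟩, ?_⟩
  rintro H' ⟨hc', hharm', hφ', ht'⟩ x hx
  obtain ⟨hS', hneg'⟩ := (fHarmonicOn_iff_subQ hX (hc'.mono hXc)).1 hharm'
  refine le_antisymm ?_ ?_
  · exact le_of_density_eq hconv hp1 hp2 hchar hΩo hΩb hx₀ hH.cont hH.subQ hc' hneg'
      (fun y hy => by rw [hHφ y hy, hφ' y hy]) ht ht' x hx
  · exact le_of_density_eq hconv hp1 hp2 hchar hΩo hΩb hx₀ hc' hS' hH.cont hneg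
      (fun y hy => by rw [hHφ y hy, hφ' y hy]) ht' ht x hx
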